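/- arXiv:0801.4928 — 6 statements merged into one kernel-verified Lean document; each statement's English description precedes it below -/
import Mathlib

section
/- Let λ be a Young diagram with k rows and λ_1 columns, and let T be a diagram of shape λ. Define a directed graph D_T on the vertex set {r_1, …, r_k} ∪ {c_1, …, c_{λ_1}} having, for each cell (i,j) of λ, an arc from r_i to c_j if T(i,j) = 0 and an arc from c_j to r_i if T(i,j) = 1 (and no other arcs). Then T is an X-diagram if and only if D_T contains no directed cycle. -/
/-- A diagram of shape `S`: a 0/1 filling (`Bool`-valued), required to be
`false` outside the cells of `S`. -/
def IsFilling (S : Finset (ℕ × ℕ)) (T : ℕ × ℕ → Bool) : Prop :=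
  ∀ c, c ∉ S → T c = false

/-- `T` avoids the 2×2 pattern `[[a,b],[c,d]]` (top-left `a`, top-right `b`,
bottom-left `c`, bottom-right `d`) within the shape `S`. -/
def Avoids (S : Finset (ℕ × ℕ)) (T : ℕ × ℕ → Bool) (a b c d : Bool) : Prop :=
  ¬ ∃ i i' j j' : ℕ, i < i' ∧ j < j' ∧
    (i, j) ∈ S ∧ (i, j') ∈ S ∧ (i', j) ∈ S ∧ (i', j') ∈ S ∧
    T (i, j) = a ∧ T (i, j') = b ∧ T (i', j) = c ∧ T (i', j') = d

/-- An X-diagram avoids the patterns `[[1,0],[0,1]]` and `[[0,1],[1,0]]`. -/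
def IsXDiagram (S : Finset (ℕ × ℕ)) (T : ℕ × ℕ → Bool) : Prop :=
  IsFilling S T ∧ Avoids S T true false false true ∧ Avoids S T false true true false

/-- A Le-diagram avoids the patterns `[[1,1],[1,0]]` and `[[0,1],[1,0]]`. -/
def IsLeDiagram (S : Finset (ℕ × ℕ)) (T : ℕ × ℕ → Bool) : Prop :=
  IsFilling S T ∧ Avoids S T true true true false ∧ Avoids S T false true true false

/-- Row `i` of the diagram is filled with 0s. -/
def ZeroRow (S : Finset (ℕ × ℕ)) (T : ℕ × ℕ → Bool) (i : ℕ) : Prop :=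
  ∀ j, (i, j) ∈ S → T (i, j) = false

/-- Column `j` of the diagram is filled with 0s. -/
def ZeroCol (S : Finset (ℕ × ℕ)) (T : ℕ × ℕ → Bool) (j : ℕ) : Prop :=
  ∀ i, (i, j) ∈ S → T (i, j) = false

/-- The arcs of the digraph `D_T`: for each cell `(i,j)` of the shape, an arc
from row vertex `r_i` (`Sum.inl i`) to column vertex `c_j` (`Sum.inr j`) if
`T (i,j) = 0`, and an arc from `c_j` to `r_i` if `T (i,j) = 1`. -/
def DArc (S : Finset (ℕ × ℕ)) (T : ℕ × ℕ → Bool) : ℕ ⊕ ℕ → ℕ ⊕ ℕ → Prop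
  | Sum.inl i, Sum.inr j => (i, j) ∈ S ∧ T (i, j) = false
  | Sum.inr j, Sum.inl i => (i, j) ∈ S ∧ T (i, j) = true
  | _, _ => False

/-- Symmetric form of the X-diagram condition. -/
theorem noCross {S : Finset (ℕ × ℕ)} {T : ℕ × ℕ → Bool} (h : IsXDiagram S T)
    {i i' j j' : ℕ} (h1 : (i, j) ∈ S) (h2 : (i, j') ∈ S) (h3 : (i', j) ∈ S)
    (h4 : (i', j') ∈ S) (t1 : T (i, j) = false) (t2 : T (i, j') = true)
    (t3 : T (i', j) = true) (t4 : T (i', j') = false) : False := by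
  obtain ⟨-, hA, hB⟩ := h
  have hi : i ≠ i' := by rintro rfl; simp_all
  have hj : j ≠ j' := by rintro rfl; simp_all
  rcases lt_or_gt_of_ne hi with hi | hi <;> rcases lt_or_gt_of_ne hj with hj | hj
  · exact hB ⟨i, i', j, j', hi, hj, h1, h2, h3, h4, t1, t2, t3, t4⟩
  · exact hA ⟨i, i', j', j, hi, hj, h2, h1, h4, h3, t2, t1, t4, t3⟩
  · exact hA ⟨i', i, j, j', hi, hj, h3, h4, h1, h2, t3, t4, t1, t2⟩
  · exact hB ⟨i', i, j', j, hi, hj, h4, h3, h2, h1, t4, t3, t2, t1⟩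

/-- There is a directed path of length two from row `i` to row `i'`. -/
def RowStep (S : Finset (ℕ × ℕ)) (T : ℕ × ℕ → Bool) (i i' : ℕ) : Prop :=
  ∃ j, (i, j) ∈ S ∧ (i', j) ∈ S ∧ T (i, j) = false ∧ T (i', j) = true

theorem rowStep_trans {μ : YoungDiagram} {T : ℕ × ℕ → Bool} (h : IsXDiagram μ.cells T)
    {a b c : ℕ} (hab : RowStep μ.cells T a b) (hbc : RowStep μ.cells T b c) :
    RowStep μ.cells T a c := by
  obtain ⟨j, h1, h2, t1, t2⟩ := hab
  obtain ⟨j', h3, h4, t3, t4⟩ := hbc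
  by_cases h5 : (a, j') ∈ μ.cells
  · refine ⟨j', h5, h4, ?_, t4⟩
    by_contra t5
    exact noCross h h1 h5 h2 h3 t1 (by simpa using t5) t2 t3
  · by_cases h6 : (c, j) ∈ μ.cells
    · refine ⟨j, h1, h6, t1, ?_⟩
      by_contra t6
      exact noCross h h3 h2 h4 h6 t3 t2 t4 (by simpa using t6)
    · exfalso
      rcases le_total j j' with hj | hj
      · exact h6 (μ.up_left_mem le_rfl hj h4)
      · exact h5 (μ.up_left_mem le_rfl hj h1)

/-- What a vertex reachable from row `i` looks like. -/
def Reach (S : Finset (ℕ × ℕ)) (T : ℕ × ℕ → Bool) (i : ℕ) : ℕ ⊕ ℕ → Prop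
  | Sum.inl i' => RowStep S T i i'
  | Sum.inr j => ∃ i', (i' = i ∨ RowStep S T i i') ∧ (i', j) ∈ S ∧ T (i', j) = false

theorem reach_of_transGen {μ : YoungDiagram} {T : ℕ × ℕ → Bool} (h : IsXDiagram μ.cells T)
    {i : ℕ} {v : ℕ ⊕ ℕ} (hv : Relation.TransGen (DArc μ.cells T) (Sum.inl i) v) :
    Reach μ.cells T i v := by
  induction hv with
  | @single b hb =>
    rcases b with b | b
    · exact hb.elim
    · exact ⟨i, Or.inl rfl, hb.1, hb.2⟩
  | @tail b c _ hbc ih =>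
    rcases b with b | b <;> rcases c with c | c
    · exact hbc.elim
    · exact ⟨b, Or.inr ih, hbc.1, hbc.2⟩
    · obtain ⟨i', hi, h1, t1⟩ := ih
      have hs : RowStep μ.cells T i' c := ⟨b, h1, hbc.1, t1, hbc.2⟩
      rcases hi with rfl | hi
      · exact hs
      · exact rowStep_trans h hi hs
    · exact hbc.elim

theorem no_row_cycle {μ : YoungDiagram} {T : ℕ × ℕ → Bool} (h : IsXDiagram μ.cells T)
    (i : ℕ) : ¬ Relation.TransGen (DArc μ.cells T) (Sum.inl i) (Sum.inl i) := by
  intro hc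
  obtain ⟨j, -, -, t1, t2⟩ := reach_of_transGen h hc
  simp [t1] at t2

/-- A crossing pattern produces a directed 4-cycle. -/
theorem cycle_of_cross {S : Finset (ℕ × ℕ)} {T : ℕ × ℕ → Bool}
    {i i' j j' : ℕ} (h1 : (i, j) ∈ S) (h2 : (i, j') ∈ S) (h3 : (i', j) ∈ S)
    (h4 : (i', j') ∈ S) (t1 : T (i, j) = false) (t2 : T (i, j') = true)
    (t3 : T (i', j) = true) (t4 : T (i', j') = false) :
    Relation.TransGen (DArc S T) (Sum.inl i) (Sum.inl i) := by
  have a1 : DArc S T (Sum.inl i) (Sum.inr j) := ⟨h1, t1⟩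
  have a2 : DArc S T (Sum.inr j) (Sum.inl i') := ⟨h3, t3⟩
  have a3 : DArc S T (Sum.inl i') (Sum.inr j') := ⟨h4, t4⟩
  have a4 : DArc S T (Sum.inr j') (Sum.inl i) := ⟨h2, t2⟩
  exact (((Relation.TransGen.single a1).tail a2).tail a3).tail a4

/-- a diagram `T` of Young-diagram shape is an X-diagram iff the
associated orientation `D_T` of the bipartite graph `G_λ` has no directed
cycle. -/
theorem stmt12 (μ : YoungDiagram) (T : ℕ × ℕ → Bool) (hT : IsFilling μ.cells T) :
    IsXDiagram μ.cells T ↔ ∀ v : ℕ ⊕ ℕ, ¬ Relation.TransGen (DArc μ.cells T) v v := by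
  constructor
  · intro h v hv
    rcases v with i | j
    · exact no_row_cycle h i hv
    · obtain ⟨b, hb, hbj⟩ := Relation.TransGen.head'_iff.1 hv
      rcases b with i | j'
      · exact no_row_cycle h i (Relation.TransGen.tail' hbj hb)
      · exact hb.elim
  · intro h
    refine ⟨hT, ?_, ?_⟩
    · rintro ⟨i, i', j, j', -, -, h1, h2, h3, h4, t1, t2, t3, t4⟩
      exact h _ (cycle_of_cross h2 h1 h4 h3 t2 t1 t4 t3)
    · rintro ⟨i, i', j, j', -, -, h1, h2, h3, h4, t1, t2, t3, t4⟩
      exact h _ (cycle_of_cross h1 h2 h3 h4 t1 t2 t3 t4)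
end

section
/- Let λ be a nonempty Young diagram and let x = (i, λ_i) be a corner box of λ, i.e., i = k or λ_i > λ_{i+1}. Let λ^{(1)} be λ with the box x removed, λ^{(2)} be λ with row i removed, λ^{(3)} be λ with the column of x removed (every part λ_j with λ_j ≥ λ_i decreased by 1), and λ^{(4)} be λ with both the row and the column of x removed (row i removed, and every remaining part λ_j with λ_j ≥ λ_i decreased by 1). Then F_λ(q) = q·F_{λ^{(1)}}(q) + F_{λ^{(2)}}(q) + F_{λ^{(3)}}(q) − F_{λ^{(4)}}(q) as polynomials in q. -/
/-- The generating polynomial `F_μ(q) = Σ_T q^{#1s(T)}` over Le-diagrams `T` of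
shape `μ`. -/
noncomputable def Fpoly (μ : YoungDiagram) : Polynomial ℤ :=
  ∑ j ∈ Finset.range (μ.cells.card + 1),
    Polynomial.C
      (({T : ℕ × ℕ → Bool | IsLeDiagram μ.cells T ∧
          (μ.cells.filter fun c => T c = true).card = j}.ncard : ℤ)) *
      Polynomial.X ^ j

/-- `A ⊆ S` is the set of ones of a Le-diagram: no zero has a one above and a one to the left. -/
def LeSet (S A : Finset (ℕ × ℕ)) : Prop :=
  ∀ r c, (r, c) ∈ S → (r, c) ∉ A → ∀ r' < r, ∀ c' < c, (r', c) ∈ A → (r, c') ∈ A → False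

open Classical in
/-- The finset of Le-sets in `S`. -/
noncomputable def leFin (S : Finset (ℕ × ℕ)) : Finset (Finset (ℕ × ℕ)) :=
  S.powerset.filter (LeSet S)

theorem mem_leFin {S A : Finset (ℕ × ℕ)} : A ∈ leFin S ↔ A ⊆ S ∧ LeSet S A := by
  simp [leFin]

theorem isLe_iff (μ : YoungDiagram) (T : ℕ × ℕ → Bool) (hT : IsFilling μ.cells T) :
    IsLeDiagram μ.cells T ↔ LeSet μ.cells (μ.cells.filter fun c => T c = true) := by
  constructor
  · rintro ⟨-, h1, h2⟩ r c hS hA r' hr c' hc ha hb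
    simp only [Finset.mem_filter, not_and, Bool.not_eq_true] at hA ha hb
    have hS' : (r', c') ∈ μ.cells := by
      have : (r, c) ∈ μ := hS
      exact μ.up_left_mem hr.le hc.le this
    cases h : T (r', c')
    · exact h2 ⟨r', r, c', c, hr, hc, hS', ha.1, hb.1, hS, h, ha.2, hb.2, hA hS⟩
    · exact h1 ⟨r', r, c', c, hr, hc, hS', ha.1, hb.1, hS, h, ha.2, hb.2, hA hS⟩
  · intro h
    refine ⟨hT, ?_, ?_⟩
    all_goals
      rintro ⟨r', r, c', c, hr, hc, hS', ha, hb, hS, t1, t2, t3, t4⟩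
      exact h r c hS (by simp [t4]) r' hr c' hc (by simp [ha, t2]) (by simp [hb, t3])

open Classical in
theorem ncard_eq (μ : YoungDiagram) (j : ℕ) :
    {T : ℕ × ℕ → Bool | IsLeDiagram μ.cells T ∧
      (μ.cells.filter fun c => T c = true).card = j}.ncard =
    ((leFin μ.cells).filter fun A => A.card = j).card := by
  rw [← Set.ncard_coe_finset]
  refine Set.ncard_congr (fun T _ => μ.cells.filter fun c => T c = true) ?_ ?_ ?_
  · rintro T ⟨hT, hj⟩
    simp only [Finset.coe_filter, Set.mem_ofPred_eq, mem_leFin]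
    exact ⟨⟨Finset.filter_subset _ _, (isLe_iff μ T hT.1).1 hT⟩, hj⟩
  · rintro T U ⟨hT, -⟩ ⟨hU, -⟩ h
    funext c
    by_cases hc : c ∈ μ.cells
    · have := Finset.ext_iff.1 h c
      simp only [Finset.mem_filter, hc, true_and] at this
      exact Bool.eq_iff_iff.2 this
    · rw [hT.1 c hc, hU.1 c hc]
  · intro A hA
    simp only [Finset.coe_filter, Set.mem_ofPred_eq, mem_leFin] at hA
    obtain ⟨⟨hs, hl⟩, hj⟩ := hA
    have e : (μ.cells.filter fun c => decide (c ∈ A) = true) = A := by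
      ext c
      simp only [Finset.mem_filter, decide_eq_true_eq]
      exact ⟨fun h => h.2, fun h => ⟨hs h, h⟩⟩
    have hf : IsFilling μ.cells (fun c => decide (c ∈ A)) := by
      intro c hc
      simp only [decide_eq_false_iff_not]
      exact fun h => hc (hs h)
    refine ⟨fun c => decide (c ∈ A), ⟨(isLe_iff μ _ hf).2 ?_, ?_⟩, e⟩
    · rw [e]; exact hl
    · rw [e]; exact hj

open Classical in
theorem Fpoly_eq (μ : YoungDiagram) :
    Fpoly μ = ∑ A ∈ leFin μ.cells, (Polynomial.X : Polynomial ℤ) ^ A.card := by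
  unfold Fpoly
  rw [← Finset.sum_fiberwise_of_maps_to (s := leFin μ.cells)
    (t := Finset.range (μ.cells.card + 1)) (g := Finset.card)]
  · refine Finset.sum_congr rfl fun j _ => ?_
    rw [ncard_eq, Finset.sum_congr rfl (g := fun _ => (Polynomial.X : Polynomial ℤ) ^ j)]
    · simp
    · intro A hA
      rw [(Finset.mem_filter.1 hA).2]
  · intro A hA
    have := Finset.card_le_card (mem_leFin.1 hA).1
    simp only [Finset.mem_range]
    omega

/-- The embedding `(r, c) ↦ (f r, g c)`. -/
def prodEmb (f g : ℕ → ℕ) (hf : StrictMono f) (hg : StrictMono g) : ℕ × ℕ ↪ ℕ × ℕ :=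
  ⟨Prod.map f g, hf.injective.prodMap hg.injective⟩

open Classical in
theorem sum_pull (S S' : Finset (ℕ × ℕ)) (f g : ℕ → ℕ) (hf : StrictMono f) (hg : StrictMono g)
    (h : ∀ r c, (r, c) ∈ S' ↔ (f r, g c) ∈ S) (P : Finset (ℕ × ℕ) → Prop)
    (hP : ∀ A, A ⊆ S → (P A ↔ ∀ r c, (r, c) ∈ A → (∃ r0, f r0 = r) ∧ ∃ c0, g c0 = c)) :
    ∑ A ∈ leFin S', (Polynomial.X : Polynomial ℤ) ^ A.card =
    ∑ A ∈ (leFin S).filter P, (Polynomial.X : Polynomial ℤ) ^ A.card := by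
  have key : ∀ (A : Finset (ℕ × ℕ)) r c,
      (f r, g c) ∈ A.map (prodEmb f g hf hg) ↔ (r, c) ∈ A := fun A r c =>
    Finset.mem_map' (prodEmb f g hf hg) (a := (r, c))
  have ex : ∀ (A : Finset (ℕ × ℕ)) r c, (r, c) ∈ A.map (prodEmb f g hf hg) →
      (∃ r0, f r0 = r) ∧ ∃ c0, g c0 = c := by
    intro A r c hA
    obtain ⟨⟨r0, c0⟩, -, e⟩ := Finset.mem_map.1 hA
    have e' : (f r0, g c0) = (r, c) := e
    rw [Prod.mk.injEq] at e'
    exact ⟨⟨r0, e'.1⟩, c0, e'.2⟩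
  have le_iff : ∀ A : Finset (ℕ × ℕ), LeSet S' A ↔ LeSet S (A.map (prodEmb f g hf hg)) := by
    intro A
    constructor
    · intro hL r c hS hA r' hr c' hc ha hb
      obtain ⟨⟨r0', rfl⟩, c0, rfl⟩ := ex _ _ _ ha
      obtain ⟨⟨r0, rfl⟩, c0', rfl⟩ := ex _ _ _ hb
      rw [key] at hA ha hb
      exact hL r0 c0 ((h _ _).2 hS) hA r0' (hf.lt_iff_lt.1 hr) c0' (hg.lt_iff_lt.1 hc) ha hb
    · intro hL r c hS hA r' hr c' hc ha hb
      exact hL (f r) (g c) ((h _ _).1 hS) (by rwa [key]) (f r') (hf hr) (g c') (hg hc)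
        ((key _ _ _).2 ha) ((key _ _ _).2 hb)
  have sub : ∀ A : Finset (ℕ × ℕ), A ⊆ S' ↔ A.map (prodEmb f g hf hg) ⊆ S := by
    intro A
    constructor
    · rintro hA ⟨r, c⟩ hm
      obtain ⟨⟨r0, rfl⟩, c0, rfl⟩ := ex _ _ _ hm
      exact (h _ _).1 (hA ((key _ _ _).1 hm))
    · rintro hA ⟨r, c⟩ hm
      exact (h _ _).2 (hA ((key _ _ _).2 hm))
  refine Finset.sum_bij (fun A _ => A.map (prodEmb f g hf hg)) ?_ ?_ ?_ ?_
  · intro A hA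
    rw [mem_leFin, sub, le_iff] at hA
    rw [Finset.mem_filter, mem_leFin, hP _ hA.1]
    exact ⟨hA, ex A⟩
  · intro A _ B _ e
    exact Finset.map_injective _ e
  · intro B hB
    rw [Finset.mem_filter, mem_leFin] at hB
    obtain ⟨⟨hs, hl⟩, hp⟩ := hB
    rw [hP _ hs] at hp
    have e : (S'.filter fun p => (f p.1, g p.2) ∈ B).map (prodEmb f g hf hg) = B := by
      ext ⟨r, c⟩
      constructor
      · intro hm
        obtain ⟨⟨r0, rfl⟩, c0, rfl⟩ := ex _ _ _ hm
        rw [key] at hm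
        exact (Finset.mem_filter.1 hm).2
      · intro hm
        obtain ⟨⟨r0, rfl⟩, c0, rfl⟩ := hp _ _ hm
        rw [key, Finset.mem_filter]
        exact ⟨(h _ _).2 (hs hm), hm⟩
    refine ⟨S'.filter fun p => (f p.1, g p.2) ∈ B, ?_, e⟩
    rw [mem_leFin, sub, le_iff, e]
    exact ⟨hs, hl⟩
  · intro A _
    rw [Finset.card_map]

/-- Skip the value `i`. -/
def skip (i r : ℕ) : ℕ := if r < i then r else r + 1

theorem skip_mono (i : ℕ) : StrictMono (skip i) := by
  intro a b h
  unfold skip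
  split_ifs <;> omega

theorem skip_ex (i r : ℕ) : (∃ r0, skip i r0 = r) ↔ r ≠ i := by
  constructor
  · rintro ⟨r0, rfl⟩
    unfold skip
    split_ifs <;> omega
  · intro h
    by_cases h' : r < i
    · exact ⟨r, by simp [skip, h']⟩
    · exact ⟨r - 1, by unfold skip; split_ifs <;> omega⟩

open Classical in
theorem sum_corner (S S' : Finset (ℕ × ℕ)) (x : ℕ × ℕ) (hx : x ∈ S) (hS' : S' = S.erase x)
    (hright : ∀ c, (x.1, c) ∈ S → c ≤ x.2) (hdown : ∀ r, (r, x.2) ∈ S → r ≤ x.1) :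
    ∑ A ∈ (leFin S).filter (fun A => x ∈ A), (Polynomial.X : Polynomial ℤ) ^ A.card =
    Polynomial.X * ∑ A ∈ leFin S', (Polynomial.X : Polynomial ℤ) ^ A.card := by
  subst hS'
  rw [Finset.mul_sum]
  symm
  have hsub : ∀ A ∈ leFin (S.erase x), x ∉ A := fun A hA hm => by
    simpa using (mem_leFin.1 hA).1 hm
  refine Finset.sum_bij (fun A _ => insert x A) ?_ ?_ ?_ ?_
  · intro A hA
    have hxA := hsub A hA
    rw [mem_leFin] at hA
    rw [Finset.mem_filter, mem_leFin]
    refine ⟨⟨?_, ?_⟩, Finset.mem_insert_self _ _⟩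
    · exact Finset.insert_subset hx (hA.1.trans (Finset.erase_subset _ _))
    · intro r c hS hn r' hr c' hc ha hb
      rw [Finset.mem_insert, not_or] at hn
      rw [Finset.mem_insert] at ha hb
      refine hA.2 r c (Finset.mem_erase.2 ⟨hn.1, hS⟩) hn.2 r' hr c' hc ?_ ?_
      · refine ha.resolve_left ?_
        rintro rfl
        have := hdown r hS
        simp only at this
        omega
      · refine hb.resolve_left ?_
        rintro rfl
        have := hright c hS
        simp only at this
        omega
  · intro A hA B hB e
    rw [← Finset.erase_insert (hsub A hA), ← Finset.erase_insert (hsub B hB)]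
    exact congrArg (fun Z => Finset.erase Z x) e
  · intro B hB
    rw [Finset.mem_filter, mem_leFin] at hB
    obtain ⟨⟨hs, hl⟩, hxB⟩ := hB
    refine ⟨B.erase x, ?_, Finset.insert_erase hxB⟩
    rw [mem_leFin]
    refine ⟨Finset.erase_subset_erase _ hs, ?_⟩
    intro r c hS hn r' hr c' hc ha hb
    rw [Finset.mem_erase] at hS ha hb hn
    exact hl r c hS.2 (fun h => hn ⟨hS.1, h⟩) r' hr c' hc ha.2 hb.2
  · intro A hA
    rw [Finset.card_insert_of_notMem (hsub A hA), pow_succ, mul_comm]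

/-- the corner recurrence
`F_λ = q F_{λ⁽¹⁾} + F_{λ⁽²⁾} + F_{λ⁽³⁾} − F_{λ⁽⁴⁾}`, where `x = (i, λ_i)` is a
corner box (0-indexed row `i`; the corner condition reads
`μ.rowLen (i+1) < μ.rowLen i`), and the diagrams `λ⁽¹⁾,…,λ⁽⁴⁾` are specified by
their row lengths: box removed, row removed, column removed, row and column
removed. -/
theorem stmt13 (μ μ1 μ2 μ3 μ4 : YoungDiagram) (i : ℕ)
    (hcorner : μ.rowLen (i + 1) < μ.rowLen i)
    (h1 : ∀ r, μ1.rowLen r = if r = i then μ.rowLen i - 1 else μ.rowLen r)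
    (h2 : ∀ r, μ2.rowLen r = if r < i then μ.rowLen r else μ.rowLen (r + 1))
    (h3 : ∀ r, μ3.rowLen r =
      if μ.rowLen i ≤ μ.rowLen r then μ.rowLen r - 1 else μ.rowLen r)
    (h4 : ∀ r, μ4.rowLen r = if r < i then μ.rowLen r - 1 else μ.rowLen (r + 1)) :
    Fpoly μ = Polynomial.X * Fpoly μ1 + Fpoly μ2 + Fpoly μ3 - Fpoly μ4 := by
  classical
  have anti : ∀ a b, a ≤ b → μ.rowLen b ≤ μ.rowLen a := fun a b h => μ.rowLen_anti a b h
  set j := μ.rowLen i - 1 with hj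
  have hge : ∀ r, r < i → μ.rowLen i ≤ μ.rowLen r := fun r h => anti _ _ h.le
  have hlt : ∀ r, i ≤ r → μ.rowLen (r + 1) < μ.rowLen i := fun r h =>
    (anti _ _ (Nat.succ_le_succ h)).trans_lt hcorner
  have mem : ∀ (ν : YoungDiagram) r c, (r, c) ∈ ν.cells ↔ c < ν.rowLen r := fun ν r c => by
    rw [YoungDiagram.mem_cells, YoungDiagram.mem_iff_lt_rowLen]
  have hx : (i, j) ∈ μ.cells := by rw [mem]; omega
  have hright : ∀ c, (i, c) ∈ μ.cells → c ≤ j := fun c h => by rw [mem] at h; omega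
  have hdown : ∀ r, (r, j) ∈ μ.cells → r ≤ i := fun r h => by
    rw [mem] at h
    by_contra hr
    have := anti (i + 1) r (by omega)
    omega
  have e1 : μ1.cells = μ.cells.erase (i, j) := by
    ext ⟨r, c⟩
    rw [Finset.mem_erase, mem, mem, h1, ne_eq, Prod.mk.injEq]
    split_ifs with h
    · subst h; omega
    · tauto
  have s1 := sum_corner μ.cells μ1.cells (i, j) hx e1 hright hdown
  have s2 := sum_pull μ.cells μ2.cells (skip i) id (skip_mono i) strictMono_id
    (fun r c => by
      rw [mem, mem, h2]; unfold skip; split_ifs <;> rfl)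
    (fun A => ∀ c, (i, c) ∉ A)
    (fun A _ => by
      simp only [skip_ex, id, exists_eq, and_true]
      exact ⟨fun h r c hm e => h c (e ▸ hm), fun h c hm => h i c hm rfl⟩)
  have s3 := sum_pull μ.cells μ3.cells id (skip j) strictMono_id (skip_mono j)
    (fun r c => by
      rw [mem, mem, h3]; unfold skip; simp only [id]; split_ifs <;> omega)
    (fun A => ∀ r, (r, j) ∉ A)
    (fun A _ => by
      simp only [skip_ex, id, exists_eq, true_and]
      exact ⟨fun h r c hm e => h r (e ▸ hm), fun h r hm => h r j hm rfl⟩)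
  have s4 := sum_pull μ.cells μ4.cells (skip i) (skip j) (skip_mono i) (skip_mono j)
    (fun r c => by
      rw [mem, mem, h4]; unfold skip
      by_cases hr : r < i
      · have := hge r hr
        simp only [hr, if_true]
        split_ifs <;> omega
      · have := hlt r (not_lt.1 hr)
        simp only [hr, if_false]
        split_ifs <;> omega)
    (fun A => (∀ c, (i, c) ∉ A) ∧ ∀ r, (r, j) ∉ A)
    (fun A _ => by
      simp only [skip_ex]
      exact ⟨fun h r c hm => ⟨fun e => h.1 c (e ▸ hm), fun e => h.2 r (e ▸ hm)⟩,
        fun h => ⟨fun c hm => (h i c hm).1 rfl, fun r hm => (h r j hm).2 rfl⟩⟩)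
  rw [Fpoly_eq, Fpoly_eq, Fpoly_eq, Fpoly_eq, Fpoly_eq, ← s1, s2, s3, s4]
  rw [← Finset.sum_filter_add_sum_filter_not (leFin μ.cells) (fun A => (i, j) ∈ A)]
  have hun : (leFin μ.cells).filter (fun A => (i, j) ∉ A) =
      (leFin μ.cells).filter (fun A => ∀ c, (i, c) ∉ A) ∪
      (leFin μ.cells).filter (fun A => ∀ r, (r, j) ∉ A) := by
    rw [← Finset.filter_or]
    refine Finset.filter_congr fun A hA => ?_
    rw [mem_leFin] at hA
    constructor
    · intro hn
      by_contra hcon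
      push Not at hcon
      obtain ⟨⟨c, hc⟩, r, hr⟩ := hcon
      have hc1 := hright c (hA.1 hc)
      have hr1 := hdown r (hA.1 hr)
      have hc2 : c ≠ j := fun e => hn (e ▸ hc)
      have hr2 : r ≠ i := fun e => hn (e ▸ hr)
      exact hA.2 i j hx hn r (by omega) c (by omega) hr hc
    · rintro (h | h)
      · exact h j
      · exact h i
  have hin := Finset.sum_union_inter (s₁ := (leFin μ.cells).filter (fun A => ∀ c, (i, c) ∉ A))
    (s₂ := (leFin μ.cells).filter (fun A => ∀ r, (r, j) ∉ A))
    (f := fun A => (Polynomial.X : Polynomial ℤ) ^ A.card)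
  rw [← hun, ← Finset.filter_and] at hin
  rw [sub_eq_add_neg, add_assoc, add_assoc, add_right_inj, ← add_assoc, ← hin, ← sub_eq_add_neg,
    eq_sub_iff_add_eq]
  congr!
end

section
/- Let λ be a Young diagram with k rows and λ_1 columns, and let G_λ be the simple bipartite graph with vertex set {r_1, …, r_k} ∪ {c_1, …, c_{λ_1}} and an edge {r_i, c_j} for each cell (i,j) of λ. Then the number of acyclic orientations of G_λ equals the number of Le-diagrams of shape λ. -/
namespace LeAux
open Relation

def Ac (S : Finset (ℕ × ℕ)) (T : ℕ × ℕ → Bool) : Prop :=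
  ∀ v : ℕ ⊕ ℕ, ¬ TransGen (DArc S T) v v

def F (S : Finset (ℕ × ℕ)) : Set (ℕ × ℕ → Bool) := {T | IsFilling S T ∧ Ac S T}

def L (S : Finset (ℕ × ℕ)) : Set (ℕ × ℕ → Bool) := {T | IsLeDiagram S T}

/-- The hereditary shape condition. -/
def P (S : Finset (ℕ × ℕ)) : Prop :=
  ∀ i i' j j' : ℕ, i < i' → j < j' → (i', j') ∈ S → (i', j) ∈ S → (i, j') ∈ S → (i, j) ∈ S

def Corner (S : Finset (ℕ × ℕ)) (i j : ℕ) : Prop :=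
  (i, j) ∈ S ∧ (∀ j', (i, j') ∈ S → j' ≤ j) ∧ (∀ i', (i', j) ∈ S → i' ≤ i)

def delR (S : Finset (ℕ × ℕ)) (i : ℕ) : Finset (ℕ × ℕ) := S.filter (fun c => c.1 ≠ i)
def delC (S : Finset (ℕ × ℕ)) (j : ℕ) : Finset (ℕ × ℕ) := S.filter (fun c => c.2 ≠ j)
def delRC (S : Finset (ℕ × ℕ)) (i j : ℕ) : Finset (ℕ × ℕ) :=
  S.filter (fun c => c.1 ≠ i ∧ c.2 ≠ j)

lemma mem_delR {S : Finset (ℕ × ℕ)} {i a b : ℕ} : (a, b) ∈ delR S i ↔ (a, b) ∈ S ∧ a ≠ i := by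
  simp [delR]
lemma mem_delC {S : Finset (ℕ × ℕ)} {j a b : ℕ} : (a, b) ∈ delC S j ↔ (a, b) ∈ S ∧ b ≠ j := by
  simp [delC]
lemma mem_delRC {S : Finset (ℕ × ℕ)} {i j a b : ℕ} :
    (a, b) ∈ delRC S i j ↔ (a, b) ∈ S ∧ a ≠ i ∧ b ≠ j := by
  simp [delRC]
lemma mem_er {S : Finset (ℕ × ℕ)} {i j a b : ℕ} :
    (a, b) ∈ S.erase (i, j) ↔ (a, b) ∈ S ∧ ¬ (a = i ∧ b = j) := by
  simp [and_comm]

lemma P_delR {S} (h : P S) (i : ℕ) : P (delR S i) := by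
  intro a a' b b' h1 h2 h3 h4 h5
  rw [mem_delR] at *
  exact ⟨h a a' b b' h1 h2 h3.1 h4.1 h5.1, h5.2⟩
lemma P_delC {S} (h : P S) (i : ℕ) : P (delC S i) := by
  intro a a' b b' h1 h2 h3 h4 h5
  rw [mem_delC] at *
  exact ⟨h a a' b b' h1 h2 h3.1 h4.1 h5.1, h4.2⟩
lemma P_delRC {S} (h : P S) (i j : ℕ) : P (delRC S i j) := by
  intro a a' b b' h1 h2 h3 h4 h5
  rw [mem_delRC] at *
  exact ⟨h a a' b b' h1 h2 h3.1 h4.1 h5.1, h5.2.1, h4.2.2⟩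
lemma P_er {S i j} (h : P S) (hc : Corner S i j) : P (S.erase (i, j)) := by
  intro a a' b b' h1 h2 h3 h4 h5
  rw [mem_er] at *
  refine ⟨h a a' b b' h1 h2 h3.1 h4.1 h5.1, ?_⟩
  rintro ⟨rfl, rfl⟩
  have := hc.2.2 a' h4.1
  omega

lemma exists_corner {S : Finset (ℕ × ℕ)} (h : S.Nonempty) : ∃ i j, Corner S i j := by
  obtain ⟨⟨a, b⟩, hab, hm⟩ := S.exists_max_image (fun c => c.1) h
  obtain ⟨⟨a', b'⟩, hab', hm'⟩ := (S.filter (fun c => c.1 = a)).exists_max_image (fun c => c.2)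
    ⟨(a, b), by simp [hab]⟩
  simp only [Finset.mem_filter] at hab' hm'
  obtain ⟨h1, h2⟩ := hab'
  subst h2
  refine ⟨a', b', h1, ?_, ?_⟩
  · intro j' hj
    exact hm' (a', j') ⟨hj, rfl⟩
  · intro i' hi
    exact hm (i', b') hi

lemma finite_filling (S : Finset (ℕ × ℕ)) : {T | IsFilling S T}.Finite := by
  have : Function.Injective (fun (T : {T | IsFilling S T}) (c : S) => T.1 c.1) := by
    intro T1 T2 h
    apply Subtype.ext
    funext c
    by_cases hc : c ∈ S
    · exact congrFun h ⟨c, hc⟩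
    · rw [T1.2 c hc, T2.2 c hc]
  have := Finite.of_injective _ this
  exact Set.toFinite _

lemma finF (S : Finset (ℕ × ℕ)) : (F S).Finite := (finite_filling S).subset (fun _ h => h.1)
lemma finL (S : Finset (ℕ × ℕ)) : (L S).Finite := (finite_filling S).subset (fun _ h => h.1)

/-! ### Le recurrence -/

lemma le_iff {S} (hP : P S) (T : ℕ × ℕ → Bool) : T ∈ L S ↔ IsFilling S T ∧
    ∀ i i' j j' : ℕ, i < i' → j < j' → (i, j') ∈ S → (i', j) ∈ S → (i', j') ∈ S →
      T (i, j') = true → T (i', j) = true → T (i', j') = true := by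
  unfold L IsLeDiagram Avoids
  simp only [Set.mem_ofPred_eq]
  refine and_congr_right fun _ => ⟨?_, ?_⟩
  · rintro ⟨h1, h2⟩ i i' j j' hi hj m1 m2 m3 t1 t2
    by_contra h3
    have m := hP i i' j j' hi hj m3 m2 m1
    cases h : T (i, j) with
    | true => exact h1 ⟨i, i', j, j', hi, hj, m, m1, m2, m3, h, t1, t2, by simpa using h3⟩
    | false => exact h2 ⟨i, i', j, j', hi, hj, m, m1, m2, m3, h, t1, t2, by simpa using h3⟩
  · intro h
    constructor <;>
    · rintro ⟨i, i', j, j', hi, hj, m, m1, m2, m3, t, t1, t2, t3⟩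
      have := h i i' j j' hi hj m1 m2 m3 t1 t2
      simp_all

lemma le_rec {S i j} (hP : P S) (hc : Corner S i j) :
    (L S).ncard + (L (delRC S i j)).ncard
      = (L (S.erase (i, j))).ncard + (L (delR S i)).ncard + (L (delC S j)).ncard := by
  have e0 : {T | T ∈ L S ∧ T (i, j) = false} = L (delR S i) ∪ L (delC S j) := by
    ext T
    simp only [Set.mem_ofPred_eq, Set.mem_union, le_iff hP, le_iff (P_delR hP i),
      le_iff (P_delC hP j)]
    constructor
    · rintro ⟨⟨hf, h⟩, h0⟩
      by_cases hr : ∀ b, (i, b) ∈ S → T (i, b) = false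
      · left
        constructor
        · rintro ⟨a, b⟩ hab
          rw [mem_delR] at hab
          by_cases hS : (a, b) ∈ S
          · have : a = i := by tauto
            subst this
            exact hr _ hS
          · exact hf _ hS
        · intro a a' b b' h1 h2 h3 h4 h5
          rw [mem_delR] at *
          exact h a a' b b' h1 h2 h3.1 h4.1 h5.1
      · right
        push Not at hr
        obtain ⟨b0, hb0, hb1⟩ := hr
        constructor
        · rintro ⟨a, b⟩ hab
          rw [mem_delC] at hab
          by_cases hS : (a, b) ∈ S
          · have : b = j := by tauto
            subst this
            by_contra ht
            have h1 := hc.2.1 _ hb0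
            have h2 := hc.2.2 _ hS
            have h3 : b0 ≠ b := by rintro rfl; exact hb1 h0
            have h4 : a ≠ i := by rintro rfl; exact ht h0
            have := h a i b0 b (by omega) (by omega) hS hb0 hc.1 (by simpa using ht)
              (by simpa using hb1)
            simp [h0] at this
          · exact hf _ hS
        · intro a a' b b' h1 h2 h3 h4 h5
          rw [mem_delC] at *
          exact h a a' b b' h1 h2 h3.1 h4.1 h5.1
    · rintro (⟨hf, h⟩ | ⟨hf, h⟩)
      · have hz : ∀ b, T (i, b) = false := fun b => hf _ (by simp [mem_delR])
        refine ⟨⟨fun c hcS => hf c (fun hh => hcS (Finset.mem_of_mem_filter _ hh)), ?_⟩, hz j⟩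
        intro a a' b b' h1 h2 h3 h4 h5 t1 t2
        have ha : a ≠ i := by rintro rfl; simp [hz] at t1
        have ha' : a' ≠ i := by rintro rfl; simp [hz] at t2
        exact h a a' b b' h1 h2 (mem_delR.2 ⟨h3, ha⟩) (mem_delR.2 ⟨h4, ha'⟩)
          (mem_delR.2 ⟨h5, ha'⟩) t1 t2
      · have hz : ∀ a, T (a, j) = false := fun b => hf _ (by simp [mem_delC])
        refine ⟨⟨fun c hcS => hf c (fun hh => hcS (Finset.mem_of_mem_filter _ hh)), ?_⟩, hz i⟩
        intro a a' b b' h1 h2 h3 h4 h5 t1 t2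
        have ha : b' ≠ j := by rintro rfl; simp [hz] at t1
        have ha' : b ≠ j := by rintro rfl; simp [hz] at t2
        exact h a a' b b' h1 h2 (mem_delC.2 ⟨h3, ha⟩) (mem_delC.2 ⟨h4, ha'⟩)
          (mem_delC.2 ⟨h5, ha⟩) t1 t2
  have e1 : L (delR S i) ∩ L (delC S j) = L (delRC S i j) := by
    ext T
    simp only [Set.mem_inter_iff, le_iff (P_delRC hP i j), le_iff (P_delR hP i),
      le_iff (P_delC hP j)]
    constructor
    · rintro ⟨⟨hf, h⟩, ⟨hf', -⟩⟩
      constructor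
      · rintro ⟨a, b⟩ hab
        by_cases h1 : (a, b) ∈ delR S i
        · refine hf' _ (fun h2 => hab ?_)
          rw [mem_delR] at h1
          rw [mem_delC] at h2
          exact mem_delRC.2 ⟨h1.1, h1.2, h2.2⟩
        · exact hf _ h1
      · intro a a' b b' h1 h2 h3 h4 h5
        rw [mem_delRC] at *
        exact h a a' b b' h1 h2 (mem_delR.2 ⟨h3.1, h3.2.1⟩) (mem_delR.2 ⟨h4.1, h4.2.1⟩)
          (mem_delR.2 ⟨h5.1, h5.2.1⟩)
    · rintro ⟨hf, h⟩
      have hz : ∀ b, T (i, b) = false := fun b => hf _ (by simp [mem_delRC])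
      have hz' : ∀ b, T (b, j) = false := fun b => hf _ (by simp [mem_delRC])
      have key : ∀ a a' b b', a < a' → b < b' → (a, b') ∈ S → (a', b) ∈ S → (a', b') ∈ S →
          T (a, b') = true → T (a', b) = true → T (a', b') = true := by
        intro a a' b b' h1 h2 h3 h4 h5 t1 t2
        have ha : b' ≠ j := by rintro rfl; simp [hz'] at t1
        have ha' : b ≠ j := by rintro rfl; simp [hz'] at t2
        have hb : a ≠ i := by rintro rfl; simp [hz] at t1
        have hb' : a' ≠ i := by rintro rfl; simp [hz] at t2
        exact h a a' b b' h1 h2 (mem_delRC.2 ⟨h3, hb, ha⟩) (mem_delRC.2 ⟨h4, hb', ha'⟩)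
          (mem_delRC.2 ⟨h5, hb', ha⟩) t1 t2
      refine ⟨⟨?_, ?_⟩, ⟨?_, ?_⟩⟩
      · rintro ⟨a, b⟩ hab
        refine hf _ (fun h2 => hab ?_)
        rw [mem_delRC] at h2
        exact mem_delR.2 ⟨h2.1, h2.2.1⟩
      · intro a a' b b' h1 h2 h3 h4 h5
        exact key a a' b b' h1 h2 (mem_delR.1 h3).1 (mem_delR.1 h4).1 (mem_delR.1 h5).1
      · rintro ⟨a, b⟩ hab
        refine hf _ (fun h2 => hab ?_)
        rw [mem_delRC] at h2
        exact mem_delC.2 ⟨h2.1, h2.2.2⟩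
      · intro a a' b b' h1 h2 h3 h4 h5
        exact key a a' b b' h1 h2 (mem_delC.1 h3).1 (mem_delC.1 h4).1 (mem_delC.1 h5).1
  have e2 : {T | T ∈ L S ∧ T (i, j) = true}
      = (fun T => Function.update T (i, j) true) '' L (S.erase (i, j)) := by
    ext T
    simp only [Set.mem_ofPred_eq, Set.mem_image, le_iff hP, le_iff (P_er hP hc)]
    constructor
    · rintro ⟨⟨hf, h⟩, h0⟩
      refine ⟨Function.update T (i, j) false, ⟨?_, ?_⟩, ?_⟩
      · intro c hcS
        by_cases hcc : c = (i, j)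
        · subst hcc; simp
        · rw [Function.update_of_ne hcc]
          exact hf _ (fun hh => hcS (Finset.mem_erase.2 ⟨hcc, hh⟩))
      · intro a a' b b' h1 h2 h3 h4 h5
        rw [Finset.mem_erase] at h3 h4 h5
        rw [Function.update_of_ne h3.1, Function.update_of_ne h4.1, Function.update_of_ne h5.1]
        exact h a a' b b' h1 h2 h3.2 h4.2 h5.2
      · simp [← h0]
    · rintro ⟨T, ⟨hf, h⟩, rfl⟩
      refine ⟨⟨?_, ?_⟩, by simp⟩
      · intro c hcS
        have hcc : c ≠ (i, j) := by rintro rfl; exact hcS hc.1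
        rw [Function.update_of_ne hcc]
        exact hf _ (fun hh => hcS (Finset.mem_of_mem_erase hh))
      · intro a a' b b' h1 h2 h3 h4 h5
        by_cases h6 : (a', b') = (i, j)
        · simp [h6]
        have h7 : (a, b') ≠ (i, j) := by
          rintro h
          simp only [Prod.mk.injEq] at h
          obtain ⟨rfl, rfl⟩ := h
          have := hc.2.2 _ h5
          omega
        have h8 : (a', b) ≠ (i, j) := by
          rintro h
          simp only [Prod.mk.injEq] at h
          obtain ⟨rfl, rfl⟩ := h
          have := hc.2.1 _ h5
          omega
        rw [Function.update_of_ne h6, Function.update_of_ne h7, Function.update_of_ne h8]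
        exact h a a' b b' h1 h2 (Finset.mem_erase.2 ⟨h7, h3⟩) (Finset.mem_erase.2 ⟨h8, h4⟩)
          (Finset.mem_erase.2 ⟨h6, h5⟩)
  have e3 : ({T | T ∈ L S ∧ T (i, j) = true}).ncard = (L (S.erase (i, j))).ncard := by
    rw [e2]
    apply Set.InjOn.ncard_image
    intro T1 h1 T2 h2 h
    funext c
    by_cases hcc : c = (i, j)
    · rw [h1.1 c (by simp [hcc]), h2.1 c (by simp [hcc])]
    · have := congrFun h c
      simpa [Function.update_of_ne hcc] using this
  have e4 : L S = {T | T ∈ L S ∧ T (i, j) = true} ∪ {T | T ∈ L S ∧ T (i, j) = false} := by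
    ext T
    cases h : T (i, j) <;> simp [h]
  have e5 := Set.ncard_union_eq (s := {T | T ∈ L S ∧ T (i, j) = true})
    (t := {T | T ∈ L S ∧ T (i, j) = false})
    (by
      rw [Set.disjoint_left]
      rintro T ⟨_, h⟩ ⟨_, h'⟩
      simp [h] at h') ((finL S).subset (fun _ h => h.1)) ((finL S).subset (fun _ h => h.1))
  rw [← e4, e3, e0] at e5
  have e6 := Set.ncard_union_add_ncard_inter (L (delR S i)) (L (delC S j)) (finL _) (finL _)
  rw [e1] at e6
  omega

/-! ### Acyclic recurrence -/

lemma acyc_of_stage {V : Type} {r r' : V → V → Prop} (s : V → ℕ)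
    (h : ∀ a b, r' a b → s a < s b ∨ (s a = s b ∧ r a b)) (hr : ∀ v, ¬ TransGen r v v) :
    ∀ v, ¬ TransGen r' v v := by
  have key : ∀ a b, TransGen r' a b → s a < s b ∨ (s a = s b ∧ TransGen r a b) := by
    intro a b hab
    induction hab with
    | single h1 =>
      rcases h _ _ h1 with h2 | ⟨h2, h3⟩
      · exact Or.inl h2
      · exact Or.inr ⟨h2, .single h3⟩
    | tail _ h1 ih =>
      rcases ih with h4 | ⟨h4, h5⟩ <;> rcases h _ _ h1 with h2 | ⟨h2, h3⟩
      · left; omega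
      · left; omega
      · left; omega
      · exact Or.inr ⟨by omega, h5.tail h3⟩
  intro v hv
  rcases key v v hv with h1 | ⟨_, h1⟩
  · omega
  · exact hr v h1

lemma DArc_mono {S S' : Finset (ℕ × ℕ)} {T T' : ℕ × ℕ → Bool}
    (h : ∀ c ∈ S, c ∈ S' ∧ T c = T' c) : ∀ a b, DArc S T a b → DArc S' T' a b := by
  rintro (a | a) (b | b) hab
  · exact hab
  · exact ⟨(h _ hab.1).1, (h _ hab.1).2 ▸ hab.2⟩
  · exact ⟨(h _ hab.1).1, (h _ hab.1).2 ▸ hab.2⟩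
  · exact hab

lemma DArc_congr {S : Finset (ℕ × ℕ)} {T T' : ℕ × ℕ → Bool}
    (h : ∀ c ∈ S, T c = T' c) : DArc S T = DArc S T' := by
  funext a b
  exact propext ⟨DArc_mono (fun c hc => ⟨hc, h c hc⟩) a b,
    DArc_mono (fun c hc => ⟨hc, (h c hc).symm⟩) a b⟩

lemma Ac_congr {S : Finset (ℕ × ℕ)} {T T' : ℕ × ℕ → Bool}
    (h : ∀ c ∈ S, T c = T' c) : Ac S T ↔ Ac S T' := by
  unfold Ac
  rw [DArc_congr h]

lemma Ac_mono {S S' : Finset (ℕ × ℕ)} {T T' : ℕ × ℕ → Bool}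
    (h : ∀ c ∈ S, c ∈ S' ∧ T c = T' c) (hA : Ac S' T') : Ac S T :=
  fun v hv => hA v (TransGen.mono (DArc_mono h) _ _ hv)

/-- Neighbours of the contracted corner edge. -/
def N (S : Finset (ℕ × ℕ)) (i j : ℕ) : ℕ ⊕ ℕ → Prop
  | Sum.inl a => (a, j) ∈ S ∧ a ≠ i
  | Sum.inr b => (i, b) ∈ S ∧ b ≠ j

/-- Out-neighbours of the contracted corner edge. -/
def D (T : ℕ × ℕ → Bool) (i j : ℕ) : ℕ ⊕ ℕ → Prop
  | Sum.inl a => T (a, j) = true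
  | Sum.inr b => T (i, b) = false

def Cl (S : Finset (ℕ × ℕ)) (i j : ℕ) (T : ℕ × ℕ → Bool) (Q : ℕ ⊕ ℕ → Prop) : Prop :=
  ∀ x y, Q x → Q y → N S i j x → N S i j y → D T i j x → ¬ D T i j y →
    ¬ TransGen (DArc (delRC S i j) T) x y

/-- The up-closure of out-neighbours. -/
def Up (S : Finset (ℕ × ℕ)) (i j : ℕ) (T : ℕ × ℕ → Bool) (Q : ℕ ⊕ ℕ → Prop) (y : ℕ ⊕ ℕ) : Prop :=
  ∃ x, Q x ∧ N S i j x ∧ D T i j x ∧ ReflTransGen (DArc (delRC S i j) T) x y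

lemma Up_step {S i j T Q x y} (h : Up S i j T Q x) (h' : DArc (delRC S i j) T x y) :
    Up S i j T Q y := by
  obtain ⟨z, h1, h2, h3, h4⟩ := h
  exact ⟨z, h1, h2, h3, h4.tail h'⟩

lemma Up_iff {S i j T Q y} (h : Cl S i j T Q) (hQ : Q y) (hN : N S i j y) :
    Up S i j T Q y ↔ D T i j y := by
  constructor
  · rintro ⟨x, h1, h2, h3, h4⟩
    rw [reflTransGen_iff_eq_or_transGen] at h4
    rcases h4 with rfl | h4
    · exact h3
    · by_contra h5
      exact h x y h1 hQ h2 hN h3 h5 h4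
  · intro hD
    exact ⟨y, hQ, hN, hD, .refl⟩

open Classical in
lemma Ac_ext {S S' : Finset (ℕ × ℕ)} {i j T T'} {Q : ℕ ⊕ ℕ → Prop} (x y : ℕ) (hx : 0 < x ∧ x < 3)
    (hy : 0 < y ∧ y < 3)
    (hT : ∀ c ∈ S', c ∈ S ∧ (c ≠ (i, j) → T' c = T c))
    (hrow : ∀ b, b ≠ j → (i, b) ∈ S' → Q (Sum.inr b))
    (hcol : ∀ a, a ≠ i → (a, j) ∈ S' → Q (Sum.inl a))
    (hcor : (i, j) ∈ S' → (T' (i, j) = false → x < y) ∧ (T' (i, j) = true → y < x))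
    (h2 : Ac (delRC S i j) T) (h : Cl S i j T Q) : Ac S' T' := by
  let s : ℕ ⊕ ℕ → ℕ := fun v =>
    if v = Sum.inl i then x else if v = Sum.inr j then y else
      if Up S i j T Q v then 3 else 0
  have si : s (Sum.inl i) = x := by simp [s]
  have sj : s (Sum.inr j) = y := by simp [s]
  have sl : ∀ a, a ≠ i → s (Sum.inl a) = if Up S i j T Q (Sum.inl a) then 3 else 0 := by
    intro a ha; simp [s, ha]
  have sr : ∀ a, a ≠ j → s (Sum.inr a) = if Up S i j T Q (Sum.inr a) then 3 else 0 := by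
    intro a ha; simp [s, ha]
  have sml : ∀ u v, (s u = if Up S i j T Q u then 3 else 0) →
      (s v = if Up S i j T Q v then 3 else 0) → DArc (delRC S i j) T u v →
      s u < s v ∨ s u = s v ∧ DArc (delRC S i j) T u v := by
    intro u v hu hv ha
    have := fun hh => Up_step (Q := Q) hh ha
    by_cases h1 : Up S i j T Q u
    · right
      rw [hu, hv]
      simp [h1, this h1, ha]
    · by_cases h2 : Up S i j T Q v
      · left; rw [hu, hv]; simp [h1, h2]
      · right; rw [hu, hv]; simp [h1, h2, ha]
  refine acyc_of_stage s ?_ h2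
  rintro (a | b) (a | b) hab
  · exact hab.elim
  · obtain ⟨hm, ht⟩ := hab
    obtain ⟨hmS, hTT⟩ := hT _ hm
    by_cases ha : a = i <;> by_cases hb : b = j
    · subst ha hb
      left; rw [si, sj]; exact (hcor hm).1 ht
    · subst ha
      have hD : D T a j (Sum.inr b) := by
        change T (a, b) = false
        rw [← hTT (by simp [hb]), ht]
      have := (Up_iff h (hrow b hb hm) ⟨hmS, hb⟩).2 hD
      left; rw [si, sr b hb]; simp [this]; omega
    · subst hb
      have hD : ¬ D T i b (Sum.inl a) := by
        change ¬ T (a, b) = true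
        rw [← hTT (by simp [ha]), ht]; simp
      have := mt (Up_iff h (hcol a ha hm) ⟨hmS, ha⟩).1 hD
      left; rw [sj, sl a ha]; simp [this]; omega
    · exact sml _ _ (sl a ha) (sr b hb)
        ⟨mem_delRC.2 ⟨hmS, ha, hb⟩, by rw [← hTT (by simp [ha]), ht]⟩
  · obtain ⟨hm, ht⟩ := hab
    obtain ⟨hmS, hTT⟩ := hT _ hm
    by_cases ha : a = i <;> by_cases hb : b = j
    · subst ha hb
      left; rw [si, sj]; exact (hcor hm).2 ht
    · subst ha
      have hD : ¬ D T a j (Sum.inr b) := by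
        change ¬ T (a, b) = false
        rw [← hTT (by simp [hb]), ht]; simp
      have := mt (Up_iff h (hrow b hb hm) ⟨hmS, hb⟩).1 hD
      left; rw [si, sr b hb]; simp [this]; omega
    · subst hb
      have hD : D T i b (Sum.inl a) := by
        change T (a, b) = true
        rw [← hTT (by simp [ha]), ht]
      have := (Up_iff h (hcol a ha hm) ⟨hmS, ha⟩).2 hD
      left; rw [sj, sl a ha]; simp [this]; omega
    · exact sml _ _ (sr b hb) (sl a ha)
        ⟨mem_delRC.2 ⟨hmS, ha, hb⟩, by rw [← hTT (by simp [ha]), ht]⟩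
  · exact hab.elim


lemma lift {S S' : Finset (ℕ × ℕ)} {T T' : ℕ × ℕ → Bool} {x y}
    (h : ∀ c ∈ S, c ∈ S' ∧ T c = T' c) (hA : TransGen (DArc S T) x y) :
    TransGen (DArc S' T') x y := TransGen.mono (DArc_mono h) _ _ hA

def isL : ℕ ⊕ ℕ → Prop
  | Sum.inl _ => True
  | Sum.inr _ => False

def isR : ℕ ⊕ ℕ → Prop
  | Sum.inl _ => False
  | Sum.inr _ => True

lemma Cl_of_delR {S i j T} (h : Ac (delR S i) T) : Cl S i j T isL := by
  rintro (a | a) (b | b) h1 h2 n1 n2 d1 d2 hp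
  · have hp' : TransGen (DArc (delR S i) T) _ _ := lift (S' := delR S i) (T' := T) (by
      rintro ⟨u, v⟩ hc
      rw [mem_delRC] at hc
      exact ⟨mem_delR.2 ⟨hc.1, hc.2.1⟩, rfl⟩) hp
    have a1 : DArc (delR S i) T (Sum.inr j) (Sum.inl a) := ⟨mem_delR.2 n1, d1⟩
    have a2 : DArc (delR S i) T (Sum.inl b) (Sum.inr j) := ⟨mem_delR.2 n2, by simpa [D] using d2⟩
    exact h _ ((hp'.tail a2).head a1)
  · exact h2.elim
  · exact h1.elim
  · exact h1.elim

lemma Cl_of_delC {S i j T} (h : Ac (delC S j) T) : Cl S i j T isR := by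
  rintro (a | a) (b | b) h1 h2 n1 n2 d1 d2 hp
  · exact h1.elim
  · exact h1.elim
  · exact h2.elim
  · have hp' : TransGen (DArc (delC S j) T) _ _ := lift (S' := delC S j) (T' := T) (by
      rintro ⟨u, v⟩ hc
      rw [mem_delRC] at hc
      exact ⟨mem_delC.2 ⟨hc.1, hc.2.2⟩, rfl⟩) hp
    have a1 : DArc (delC S j) T (Sum.inl i) (Sum.inr a) := ⟨mem_delC.2 n1, d1⟩
    have a2 : DArc (delC S j) T (Sum.inr b) (Sum.inl i) := ⟨mem_delC.2 n2, by simpa [D] using d2⟩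
    exact h _ ((hp'.tail a2).head a1)

lemma Cl_of_both {S i j T} (hc : (i, j) ∈ S) (h0 : T (i, j) = false) (h : Ac S T)
    (h' : Ac S (Function.update T (i, j) true)) : Cl S i j T (fun _ => True) := by
  rintro x y - - n1 n2 d1 d2 hp
  have hp1 : TransGen (DArc S T) x y := lift (by
      rintro ⟨u, v⟩ hc
      rw [mem_delRC] at hc
      exact ⟨hc.1, rfl⟩) hp
  have hp2 : TransGen (DArc S (Function.update T (i, j) true)) x y := lift (by
      rintro ⟨u, v⟩ hc
      rw [mem_delRC] at hc
      refine ⟨hc.1, ?_⟩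
      rw [Function.update_of_ne]
      simp [hc.2.1]) hp
  rcases x with a | a <;> rcases y with b | b
  · have a1 : DArc S T (Sum.inr j) (Sum.inl a) := ⟨n1.1, d1⟩
    have a2 : DArc S T (Sum.inl b) (Sum.inr j) := ⟨n2.1, by simpa [D] using d2⟩
    exact h _ ((hp1.tail a2).head a1)
  · have a1 : DArc S T (Sum.inr j) (Sum.inl a) := ⟨n1.1, d1⟩
    have a2 : DArc S T (Sum.inr b) (Sum.inl i) := ⟨n2.1, by simpa [D] using d2⟩
    have a3 : DArc S T (Sum.inl i) (Sum.inr j) := ⟨hc, h0⟩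
    exact h _ (((hp1.tail a2).tail a3).head a1)
  · have a1 : DArc S (Function.update T (i, j) true) (Sum.inl i) (Sum.inr a) :=
      ⟨n1.1, by rw [Function.update_of_ne (by simp [n1.2])]; exact d1⟩
    have a2 : DArc S (Function.update T (i, j) true) (Sum.inl b) (Sum.inr j) :=
      ⟨n2.1, by rw [Function.update_of_ne (by simp [n2.2])]; simpa [D] using d2⟩
    have a3 : DArc S (Function.update T (i, j) true) (Sum.inr j) (Sum.inl i) :=
      ⟨hc, by simp⟩
    exact h' _ (((hp2.tail a2).tail a3).head a1)
  · have a1 : DArc S T (Sum.inl i) (Sum.inr a) := ⟨n1.1, d1⟩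
    have a2 : DArc S T (Sum.inr b) (Sum.inl i) := ⟨n2.1, by simpa [D] using d2⟩
    exact h _ ((hp1.tail a2).head a1)

open Classical in
lemma add_arc {V : Type} {r r' : V → V → Prop} (a b : V)
    (h : ∀ u v, r' u v → r u v ∨ (u = a ∧ v = b)) (hr : ∀ v, ¬ TransGen r v v)
    (hn : ¬ ReflTransGen r b a) : ∀ v, ¬ TransGen r' v v := by
  refine acyc_of_stage (fun v => if ReflTransGen r b v then 1 else 0) ?_ hr
  intro u v huv
  rcases h u v huv with h1 | ⟨rfl, rfl⟩
  · by_cases hu : ReflTransGen r b u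
    · have := hu.tail h1
      simp [hu, this, h1]
    · by_cases hv : ReflTransGen r b v
      · simp [hu, hv]
      · simp [hu, hv, h1]
  · left
    simp [hn, ReflTransGen.refl]

lemma one_of_two {S i j T} (h0 : T (i, j) = false) (h : Ac (S.erase (i, j)) T) :
    Ac S T ∨ Ac S (Function.update T (i, j) true) := by
  by_cases hp : ReflTransGen (DArc (S.erase (i, j)) T) (Sum.inr j) (Sum.inl i)
  · right
    refine add_arc (Sum.inr j) (Sum.inl i) ?_ h ?_
    · rintro (a | b) (a | b) hab
      · exact hab.elim
      · obtain ⟨h1, h2⟩ := hab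
        have hne : (a, b) ≠ (i, j) := by
          intro he
          rw [he] at h2
          simp at h2
        rw [Function.update_of_ne hne] at h2
        exact Or.inl ⟨Finset.mem_erase.2 ⟨hne, h1⟩, h2⟩
      · obtain ⟨h1, h2⟩ := hab
        by_cases hne : (a, b) = (i, j)
        · simp only [Prod.mk.injEq] at hne
          simp [hne]
        rw [Function.update_of_ne hne] at h2
        exact Or.inl ⟨Finset.mem_erase.2 ⟨hne, h1⟩, h2⟩
      · exact hab.elim
    · intro hq
      rw [reflTransGen_iff_eq_or_transGen] at hp hq
      simp only [reduceCtorEq, false_or] at hp hq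
      exact h _ (hp.trans hq)
  · left
    refine add_arc (Sum.inl i) (Sum.inr j) ?_ h hp
    rintro (a | b) (a | b) hab
    · exact hab.elim
    · obtain ⟨h1, h2⟩ := hab
      by_cases hne : (a, b) = (i, j)
      · simp only [Prod.mk.injEq] at hne
        simp [hne]
      exact Or.inl ⟨Finset.mem_erase.2 ⟨hne, h1⟩, h2⟩
    · obtain ⟨h1, h2⟩ := hab
      have hne : (a, b) ≠ (i, j) := by
        intro he
        rw [he] at h2
        simp [h0] at h2
      exact Or.inl ⟨Finset.mem_erase.2 ⟨hne, h1⟩, h2⟩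
    · exact hab.elim

def W (S : Finset (ℕ × ℕ)) (i j : ℕ) : Set (ℕ × ℕ → Bool) :=
  {T | IsFilling (S.erase (i, j)) T ∧ Ac (delRC S i j) T ∧ Cl S i j T (fun _ => True)}

lemma finW (S : Finset (ℕ × ℕ)) (i j) : (W S i j).Finite :=
  (finite_filling (S.erase (i, j))).subset (fun _ h => h.1)

lemma F_rec1 {S i j} (hc : (i, j) ∈ S) :
    (F S).ncard = (F (S.erase (i, j))).ncard + (W S i j).ncard := by
  let U : Set (ℕ × ℕ → Bool) := {T | IsFilling (S.erase (i, j)) T ∧ Ac S T}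
  let V : Set (ℕ × ℕ → Bool) :=
    {T | IsFilling (S.erase (i, j)) T ∧ Ac S (Function.update T (i, j) true)}
  have fU : U.Finite := (finite_filling (S.erase (i, j))).subset (fun _ h => h.1)
  have fV : V.Finite := (finite_filling (S.erase (i, j))).subset (fun _ h => h.1)
  have z : ∀ T, IsFilling (S.erase (i, j)) T → T (i, j) = false := fun T h => h _ (by simp)
  have e1 : U ∪ V = F (S.erase (i, j)) := by
    ext T
    constructor
    · rintro (⟨hf, h⟩ | ⟨hf, h⟩)
      · exact ⟨hf, Ac_mono (fun c hc => ⟨Finset.mem_of_mem_erase hc, rfl⟩) h⟩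
      · refine ⟨hf, Ac_mono (fun c hc => ⟨Finset.mem_of_mem_erase hc, ?_⟩) h⟩
        rw [Function.update_of_ne (Finset.ne_of_mem_erase hc)]
    · rintro ⟨hf, h⟩
      rcases one_of_two (z T hf) h with h1 | h1
      · exact Or.inl ⟨hf, h1⟩
      · exact Or.inr ⟨hf, h1⟩
  have e2 : U ∩ V = W S i j := by
    ext T
    constructor
    · rintro ⟨⟨hf, h⟩, ⟨-, h'⟩⟩
      exact ⟨hf, Ac_mono (fun c hc => ⟨Finset.mem_of_mem_filter _ hc, rfl⟩) h,
        Cl_of_both hc (z T hf) h h'⟩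
    · rintro ⟨hf, h, h'⟩
      refine ⟨⟨hf, ?_⟩, ⟨hf, ?_⟩⟩
      · refine Ac_ext (T := T) 1 2 (by omega) (by omega) (fun c hc => ⟨hc, fun _ => rfl⟩)
          (fun _ _ _ => trivial) (fun _ _ _ => trivial) (fun _ => ⟨by omega, ?_⟩) h h'
        simp [z T hf]
      · refine Ac_ext (T := T) 2 1 (by omega) (by omega)
          (fun c hc => ⟨hc, fun hn => Function.update_of_ne hn _ _⟩)
          (fun _ _ _ => trivial) (fun _ _ _ => trivial) (fun _ => ⟨?_, by omega⟩) h h'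
        simp
  have e3 : F S = U ∪ (fun T => Function.update T (i, j) true) '' V := by
    ext T
    constructor
    · rintro ⟨hf, h⟩
      cases ht : T (i, j) with
      | false =>
        left
        refine ⟨?_, h⟩
        intro c hcS
        by_cases hcc : c = (i, j)
        · rw [hcc, ht]
        · exact hf _ (fun hh => hcS (Finset.mem_erase.2 ⟨hcc, hh⟩))
      | true =>
        right
        have e : Function.update (Function.update T (i, j) false) (i, j) true = T := by
          simp [← ht]
        refine ⟨Function.update T (i, j) false, ⟨?_, by rw [e]; exact h⟩, e⟩
        intro c hcS
        by_cases hcc : c = (i, j)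
        · subst hcc; simp
        · rw [Function.update_of_ne hcc]
          exact hf _ (fun hh => hcS (Finset.mem_erase.2 ⟨hcc, hh⟩))
    · rintro (⟨hf, h⟩ | ⟨T, ⟨hf, h⟩, rfl⟩)
      · exact ⟨fun c hcS => hf _ (fun hh => hcS (Finset.mem_of_mem_erase hh)), h⟩
      · refine ⟨fun c hcS => ?_, h⟩
        have hcc : c ≠ (i, j) := by rintro rfl; exact hcS hc
        change Function.update T (i, j) true c = false
        rw [Function.update_of_ne hcc]
        exact hf _ (fun hh => hcS (Finset.mem_of_mem_erase hh))
  have e4 : ((fun T => Function.update T (i, j) true) '' V).ncard = V.ncard := by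
    apply Set.InjOn.ncard_image
    intro T1 h1 T2 h2 h
    funext c
    by_cases hcc : c = (i, j)
    · rw [h1.1 c (by simp [hcc]), h2.1 c (by simp [hcc])]
    · have := congrFun h c
      simpa [Function.update_of_ne hcc] using this
  have e5 := Set.ncard_union_eq (s := U) (t := (fun T => Function.update T (i, j) true) '' V)
    (by
      rw [Set.disjoint_left]
      rintro T ⟨h, _⟩ ⟨T', _, rfl⟩
      have := z _ h
      simp at this) fU (fV.image _)
  have e6 := Set.ncard_union_add_ncard_inter U V fU fV
  rw [← e3, e4] at e5
  rw [e1, e2] at e6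
  omega

lemma ncard_restrict {S0 S' : Finset (ℕ × ℕ)} {W : Set (ℕ × ℕ → Bool)}
    (hf : ∀ T ∈ W, IsFilling S0 T) (h1 : ∀ T ∈ W, Ac S' T)
    (h2 : ∀ T1 ∈ W, ∀ T2 ∈ W, (∀ c ∈ S', T1 c = T2 c) → ∀ c ∈ S0, T1 c = T2 c)
    (h3 : ∀ T ∈ F S', ∃ T' ∈ W, ∀ c ∈ S', T' c = T c) : W.ncard = (F S').ncard := by
  have e : (fun (T : ℕ × ℕ → Bool) c => if c ∈ S' then T c else false) '' W = F S' := by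
    ext T
    constructor
    · rintro ⟨T, hT, rfl⟩
      refine ⟨fun c hc => by simp [hc], ?_⟩
      refine (Ac_congr ?_).1 (h1 T hT)
      intro c hc
      simp [hc]
    · intro hT
      obtain ⟨T', hT', h⟩ := h3 T hT
      refine ⟨T', hT', ?_⟩
      funext c
      by_cases hc : c ∈ S'
      · simp [hc, h c hc]
      · simp [hc, hT.1 c hc]
  rw [← e]
  symm
  apply Set.InjOn.ncard_image
  intro T1 m1 T2 m2 h
  have h' : ∀ c ∈ S', T1 c = T2 c := by
    intro c hc
    have := congrFun h c
    simpa [hc] using this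
  funext c
  by_cases hc : c ∈ S0
  · exact h2 T1 m1 T2 m2 h' c hc
  · rw [hf _ m1 c hc, hf _ m2 c hc]

/-- `x` is reachable from an out-neighbour of kind `Q`. -/
def Re (S : Finset (ℕ × ℕ)) (i j : ℕ) (T : ℕ × ℕ → Bool) (Q : ℕ ⊕ ℕ → Prop) (x : ℕ ⊕ ℕ) : Prop :=
  ∃ y, Q y ∧ N S i j y ∧ D T i j y ∧ TransGen (DArc (delRC S i j) T) y x

lemma Re_imp {S i j T T' Q x} (hT : ∀ c ∈ delRC S i j, T c = T' c)
    (hQ : ∀ y, Q y → N S i j y → D T i j y → D T' i j y) (h : Re S i j T Q x) :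
    Re S i j T' Q x := by
  obtain ⟨y, h1, h2, h3, h4⟩ := h
  exact ⟨y, h1, h2, hQ y h1 h2 h3, DArc_congr hT ▸ h4⟩

def Wp (S : Finset (ℕ × ℕ)) (i j : ℕ) (Q : ℕ ⊕ ℕ → Prop) : Set (ℕ × ℕ → Bool) :=
  {T | T ∈ W S i j ∧ ∀ x, ¬ Q x → N S i j x → (D T i j x ↔ Re S i j T Q x)}

lemma Cl_full {S i j T} {Q : ℕ ⊕ ℕ → Prop} (h : Cl S i j T Q)
    (h' : ∀ x, ¬ Q x → N S i j x → (D T i j x ↔ Re S i j T Q x)) :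
    Cl S i j T (fun _ => True) := by
  have key : ∀ x y, Q x → N S i j x → N S i j y → D T i j x → ¬ D T i j y →
      ¬ TransGen (DArc (delRC S i j) T) x y := by
    intro x y q1 n1 n2 d1 d2 hp
    by_cases q2 : Q y
    · exact h x y q1 q2 n1 n2 d1 d2 hp
    · exact d2 ((h' y q2 n2).2 ⟨x, q1, n1, d1, hp⟩)
  intro x y _ _ n1 n2 d1 d2 hp
  by_cases q1 : Q x
  · exact key x y q1 n1 n2 d1 d2 hp
  · obtain ⟨z, q, n, d, hz⟩ := (h' x q1 n1).1 d1
    exact key z y q n n2 d d2 (hz.trans hp)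

lemma Wp_union {S i j} (hP : P S) (hc : Corner S i j) :
    Wp S i j isL ∪ Wp S i j isR = W S i j := by
  ext T
  constructor
  · rintro (h | h) <;> exact h.1
  · intro h
    by_contra hn
    have hback : ∀ Q x, N S i j x → Re S i j T Q x → D T i j x := by
      rintro Q x n ⟨y, _, h2, h3, h4⟩
      by_contra h5
      exact h.2.2 y x trivial trivial h2 n h3 h5 h4
    have g : ∀ Q, T ∉ Wp S i j Q → ∃ x, ¬ Q x ∧ N S i j x ∧ D T i j x ∧ ¬ Re S i j T Q x := by
      intro Q hQ
      by_contra hcon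
      push Not at hcon
      exact hQ ⟨h, fun x q n => ⟨fun d => hcon x q n d, hback Q x n⟩⟩
    obtain ⟨x, q1, n1, d1, r1⟩ := g isL (fun hh => hn (Or.inl hh))
    obtain ⟨y, q2, n2, d2, r2⟩ := g isR (fun hh => hn (Or.inr hh))
    rcases x with a | b
    · exact q1 trivial
    rcases y with a | b'
    · have hb := hc.2.1 b n1.1
      have ha := hc.2.2 a n2.1
      have hbj := n1.2
      have hai := n2.2
      have hm : (a, b) ∈ delRC S i j :=
        mem_delRC.2 ⟨hP a i b j (by omega) (by omega) hc.1 n1.1 n2.1, hai, hbj⟩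
      cases ht : T (a, b) with
      | false => exact r1 ⟨Sum.inl a, trivial, n2, d2, .single ⟨hm, ht⟩⟩
      | true => exact r2 ⟨Sum.inr b, trivial, n1, d1, .single ⟨hm, ht⟩⟩
    · exact q2 trivial

def W0 (S : Finset (ℕ × ℕ)) (i j : ℕ) : Set (ℕ × ℕ → Bool) :=
  {T | T ∈ W S i j ∧ ∀ x, N S i j x → ¬ D T i j x}

lemma finN (S : Finset (ℕ × ℕ)) (i j) : {x | N S i j x}.Finite := by
  apply ((S.image (fun c => (Sum.inl c.1 : ℕ ⊕ ℕ))) ∪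
    (S.image (fun c => (Sum.inr c.2 : ℕ ⊕ ℕ)))).finite_toSet.subset
  rintro (a | b) h
  · have h' : N S i j (Sum.inl a) := h
    simp only [Finset.coe_union, Finset.coe_image, Set.mem_union, Set.mem_image]
    exact Or.inl ⟨_, h'.1, rfl⟩
  · have h' : N S i j (Sum.inr b) := h
    simp only [Finset.coe_union, Finset.coe_image, Set.mem_union, Set.mem_image]
    exact Or.inr ⟨_, h'.1, rfl⟩

lemma Wp_inter {S i j} : Wp S i j isL ∩ Wp S i j isR = W0 S i j := by
  ext T
  constructor
  · rintro ⟨⟨h, h1⟩, ⟨-, h2⟩⟩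
    refine ⟨h, ?_⟩
    have step : ∀ x, N S i j x → D T i j x → ∃ y, N S i j y ∧ D T i j y ∧
        TransGen (DArc (delRC S i j) T) y x := by
      rintro (a | b) n d
      · obtain ⟨y, _, n', d', p⟩ := (h2 (Sum.inl a) (fun q => q) n).1 d
        exact ⟨y, n', d', p⟩
      · obtain ⟨y, _, n', d', p⟩ := (h1 (Sum.inr b) (fun q => q) n).1 d
        exact ⟨y, n', d', p⟩
    let X := {x // N S i j x}
    have : Finite X := (finN S i j).to_subtype
    let r : X → X → Prop := fun x y => TransGen (DArc (delRC S i j) T) x.1 y.1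
    have : IsTrans X r := ⟨fun _ _ _ h1 h2 => TransGen.trans h1 h2⟩
    have : Std.Irrefl r := ⟨fun x hx => h.2.1 x.1 hx⟩
    have wf : WellFounded r := Finite.wellFounded_of_trans_of_irrefl r
    have key : ∀ x : X, ¬ D T i j x.1 := by
      intro x
      induction x using wf.induction with
      | _ x ih =>
        intro d
        obtain ⟨y, n', d', p⟩ := step x.1 x.2 d
        exact ih ⟨y, n'⟩ p d'
    intro x n
    exact key ⟨x, n⟩
  · rintro ⟨h, h1⟩
    have : ∀ Q, T ∈ Wp S i j Q := by
      intro Q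
      refine ⟨h, fun x _ n => ⟨fun d => (h1 x n d).elim, ?_⟩⟩
      rintro ⟨y, _, n', d', _⟩
      exact (h1 y n' d').elim
    exact ⟨this _, this _⟩

lemma W_Ac {S S' : Finset (ℕ × ℕ)} {i j T} (h : T ∈ W S i j) (hs : S' ⊆ S) (hn : (i, j) ∉ S') :
    Ac S' T :=
  Ac_ext (T := T) 1 2 (by omega) (by omega) (fun c hc => ⟨hs hc, fun _ => rfl⟩)
    (fun _ _ _ => trivial) (fun _ _ _ => trivial) (fun hh => (hn hh).elim) h.2.1 h.2.2

open Classical in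
lemma card_WL {S i j} : (Wp S i j isL).ncard = (F (delR S i)).ncard := by
  apply ncard_restrict (S0 := S.erase (i, j))
  · intro T hT
    exact hT.1.1
  · intro T hT
    exact W_Ac hT.1 (Finset.filter_subset _ _) (by simp [mem_delR])
  · rintro T1 h1 T2 h2 he ⟨a, b⟩ hm
    rw [mem_er] at hm
    by_cases ha : a = i
    · subst ha
      have hb : b ≠ j := by tauto
      have n : N S a j (Sum.inr b) := ⟨hm.1, hb⟩
      have i1 := h1.2 (Sum.inr b) (fun q => q) n
      have i2 := h2.2 (Sum.inr b) (fun q => q) n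
      have e : Re S a j T1 isL (Sum.inr b) ↔ Re S a j T2 isL (Sum.inr b) := by
        constructor
        · apply Re_imp
          · rintro ⟨u, v⟩ hc
            rw [mem_delRC] at hc
            exact he _ (mem_delR.2 ⟨hc.1, hc.2.1⟩)
          · rintro (u | u) q n d
            · exact (he _ (mem_delR.2 n)).symm.trans d
            · exact q.elim
        · apply Re_imp
          · rintro ⟨u, v⟩ hc
            rw [mem_delRC] at hc
            exact (he _ (mem_delR.2 ⟨hc.1, hc.2.1⟩)).symm
          · rintro (u | u) q n d
            · exact (he _ (mem_delR.2 n)).trans d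
            · exact q.elim
      have : (T1 (a, b) = false) ↔ (T2 (a, b) = false) := i1.trans (e.trans i2.symm)
      cases h1 : T1 (a, b) <;> cases h2 : T2 (a, b) <;> simp_all
    · exact he _ (mem_delR.2 ⟨hm.1, ha⟩)
  · intro T hT
    let T' : ℕ × ℕ → Bool := fun c => if c.1 = i then
      decide (c ∈ S ∧ c.2 ≠ j ∧ ¬ Re S i j T isL (Sum.inr c.2)) else T c
    have t1 : ∀ a b, a ≠ i → T' (a, b) = T (a, b) := by intro a b h; simp [T', h]
    have t2 : ∀ c ∈ delRC S i j, T' c = T c := by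
      rintro ⟨a, b⟩ hc
      exact t1 a b (mem_delRC.1 hc).2.1
    have hR : ∀ x, Re S i j T' isL x ↔ Re S i j T isL x := by
      intro x
      constructor
      · apply Re_imp t2
        rintro (u | u) q n d
        · exact (t1 u j n.2).symm.trans d
        · exact q.elim
      · apply Re_imp (fun c hc => (t2 c hc).symm)
        rintro (u | u) q n d
        · exact (t1 u j n.2).trans d
        · exact q.elim
    have hA : ∀ c ∈ delR S i, T' c = T c := by
      rintro ⟨a, b⟩ hc
      exact t1 a b (mem_delR.1 hc).2
    have hAc : Ac (delR S i) T' := (Ac_congr hA).2 hT.2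
    have hW : ∀ x, ¬ isL x → N S i j x → (D T' i j x ↔ Re S i j T' isL x) := by
      rintro (a | b) q n
      · exact (q trivial).elim
      · rw [hR]
        change T' (i, b) = false ↔ _
        simp [T', n.1, n.2]
    refine ⟨T', ⟨⟨?_, ?_, Cl_full (Cl_of_delR hAc) hW⟩, hW⟩, hA⟩
    · rintro ⟨a, b⟩ hc
      rw [mem_er] at hc
      by_cases ha : a = i
      · subst ha
        simp only [T', if_true, decide_eq_false_iff_not]
        tauto
      · rw [t1 a b ha]
        apply hT.1
        rw [mem_delR]
        tauto
    · refine Ac_mono ?_ hAc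
      rintro ⟨a, b⟩ hc
      rw [mem_delRC] at hc
      exact ⟨mem_delR.2 ⟨hc.1, hc.2.1⟩, rfl⟩

open Classical in
lemma card_WR {S i j} : (Wp S i j isR).ncard = (F (delC S j)).ncard := by
  apply ncard_restrict (S0 := S.erase (i, j))
  · intro T hT
    exact hT.1.1
  · intro T hT
    exact W_Ac hT.1 (Finset.filter_subset _ _) (by simp [mem_delC])
  · rintro T1 h1 T2 h2 he ⟨a, b⟩ hm
    rw [mem_er] at hm
    by_cases hb : b = j
    · subst hb
      have ha : a ≠ i := by tauto
      have n : N S i b (Sum.inl a) := ⟨hm.1, ha⟩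
      have i1 := h1.2 (Sum.inl a) (fun q => q) n
      have i2 := h2.2 (Sum.inl a) (fun q => q) n
      have e : Re S i b T1 isR (Sum.inl a) ↔ Re S i b T2 isR (Sum.inl a) := by
        constructor
        · apply Re_imp
          · rintro ⟨u, v⟩ hc
            rw [mem_delRC] at hc
            exact he _ (mem_delC.2 ⟨hc.1, hc.2.2⟩)
          · rintro (u | u) q n d
            · exact q.elim
            · exact (he _ (mem_delC.2 n)).symm.trans d
        · apply Re_imp
          · rintro ⟨u, v⟩ hc
            rw [mem_delRC] at hc
            exact (he _ (mem_delC.2 ⟨hc.1, hc.2.2⟩)).symm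
          · rintro (u | u) q n d
            · exact q.elim
            · exact (he _ (mem_delC.2 n)).trans d
      have : (T1 (a, b) = true) ↔ (T2 (a, b) = true) := i1.trans (e.trans i2.symm)
      cases h1 : T1 (a, b) <;> cases h2 : T2 (a, b) <;> simp_all
    · exact he _ (mem_delC.2 ⟨hm.1, hb⟩)
  · intro T hT
    let T' : ℕ × ℕ → Bool := fun c => if c.2 = j then
      decide (c ∈ S ∧ c.1 ≠ i ∧ Re S i j T isR (Sum.inl c.1)) else T c
    have t1 : ∀ a b, b ≠ j → T' (a, b) = T (a, b) := by intro a b h; simp [T', h]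
    have t2 : ∀ c ∈ delRC S i j, T' c = T c := by
      rintro ⟨a, b⟩ hc
      exact t1 a b (mem_delRC.1 hc).2.2
    have hR : ∀ x, Re S i j T' isR x ↔ Re S i j T isR x := by
      intro x
      constructor
      · apply Re_imp t2
        rintro (u | u) q n d
        · exact q.elim
        · exact (t1 i u n.2).symm.trans d
      · apply Re_imp (fun c hc => (t2 c hc).symm)
        rintro (u | u) q n d
        · exact q.elim
        · exact (t1 i u n.2).trans d
    have hA : ∀ c ∈ delC S j, T' c = T c := by
      rintro ⟨a, b⟩ hc
      exact t1 a b (mem_delC.1 hc).2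
    have hAc : Ac (delC S j) T' := (Ac_congr hA).2 hT.2
    have hW : ∀ x, ¬ isR x → N S i j x → (D T' i j x ↔ Re S i j T' isR x) := by
      rintro (a | b) q n
      · rw [hR]
        change T' (a, j) = true ↔ _
        simp [T', n.1, n.2]
      · exact (q trivial).elim
    refine ⟨T', ⟨⟨?_, ?_, Cl_full (Cl_of_delC hAc) hW⟩, hW⟩, hA⟩
    · rintro ⟨a, b⟩ hc
      rw [mem_er] at hc
      by_cases hb : b = j
      · subst hb
        simp only [T', if_true, decide_eq_false_iff_not]
        tauto
      · rw [t1 a b hb]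
        apply hT.1
        rw [mem_delC]
        tauto
    · refine Ac_mono ?_ hAc
      rintro ⟨a, b⟩ hc
      rw [mem_delRC] at hc
      exact ⟨mem_delC.2 ⟨hc.1, hc.2.2⟩, rfl⟩

lemma card_W0 {S i j} : (W0 S i j).ncard = (F (delRC S i j)).ncard := by
  apply ncard_restrict (S0 := S.erase (i, j))
  · intro T hT
    exact hT.1.1
  · intro T hT
    exact hT.1.2.1
  · rintro T1 h1 T2 h2 he ⟨a, b⟩ hm
    rw [mem_er] at hm
    by_cases ha : a = i
    · subst ha
      have hb : b ≠ j := by tauto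
      have n : N S a j (Sum.inr b) := ⟨hm.1, hb⟩
      have i1 : ¬ T1 (a, b) = false := h1.2 _ n
      have i2 : ¬ T2 (a, b) = false := h2.2 _ n
      simp_all
    · by_cases hb : b = j
      · subst hb
        have n : N S i b (Sum.inl a) := ⟨hm.1, ha⟩
        have i1 : ¬ T1 (a, b) = true := h1.2 _ n
        have i2 : ¬ T2 (a, b) = true := h2.2 _ n
        simp_all
      · exact he _ (mem_delRC.2 ⟨hm.1, ha, hb⟩)
  · intro T hT
    let T' : ℕ × ℕ → Bool := fun c => if c.1 = i then decide (c ∈ S ∧ c.2 ≠ j) else T c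
    have t1 : ∀ a b, a ≠ i → T' (a, b) = T (a, b) := by intro a b h; simp [T', h]
    have t2 : ∀ c ∈ delRC S i j, T' c = T c := by
      rintro ⟨a, b⟩ hc
      exact t1 a b (mem_delRC.1 hc).2.1
    have hD : ∀ x, N S i j x → ¬ D T' i j x := by
      rintro (a | b) n
      · change ¬ T' (a, j) = true
        rw [t1 a j n.2, hT.1 _ (by simp [mem_delRC])]
        simp
      · change ¬ T' (i, b) = false
        simp [T', n.1, n.2]
    refine ⟨T', ⟨⟨?_, (Ac_congr t2).2 hT.2, ?_⟩, hD⟩, t2⟩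
    · rintro ⟨a, b⟩ hc
      rw [mem_er] at hc
      by_cases ha : a = i
      · subst ha
        simp only [T', if_true, decide_eq_false_iff_not]
        tauto
      · rw [t1 a b ha]
        apply hT.1
        rw [mem_delRC]
        tauto
    · intro x y _ _ n _ d
      exact (hD x n d).elim

lemma F_rec {S i j} (hP : P S) (hc : Corner S i j) :
    (F S).ncard + (F (delRC S i j)).ncard
      = (F (S.erase (i, j))).ncard + (F (delR S i)).ncard + (F (delC S j)).ncard := by
  have e1 := F_rec1 hc.1
  have e2 := Set.ncard_union_add_ncard_inter (Wp S i j isL) (Wp S i j isR)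
    ((finW S i j).subset (fun _ h => h.1)) ((finW S i j).subset (fun _ h => h.1))
  rw [Wp_union hP hc, Wp_inter, card_WL, card_WR, card_W0] at e2
  omega

lemma main (n : ℕ) : ∀ S : Finset (ℕ × ℕ), S.card = n → P S → (F S).ncard = (L S).ncard := by
  induction n using Nat.strong_induction_on with
  | _ n ih =>
    intro S hn hP
    rcases S.eq_empty_or_nonempty with rfl | hne
    · congr 1
      ext T
      rw [le_iff hP]
      refine and_congr_right fun _ => ⟨fun _ => by simp, fun _ v hv => ?_⟩
      obtain ⟨w, h, -⟩ := TransGen.head'_iff.1 hv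
      rcases v with a | a <;> rcases w with b | b <;> simp [DArc] at h
    · obtain ⟨i, j, hc⟩ := exists_corner hne
      have lt : ∀ S' ⊆ S, (i, j) ∉ S' → S'.card < n := by
        intro S' hs hm
        rw [← hn]
        exact Finset.card_lt_card ⟨hs, fun h => hm (h hc.1)⟩
      have a1 := ih _ (lt (S.erase (i, j)) (Finset.erase_subset _ _) (by simp)) _ rfl (P_er hP hc)
      have a2 := ih _ (lt (delR S i) (Finset.filter_subset _ _) (by simp [mem_delR])) _ rfl
        (P_delR hP i)
      have a3 := ih _ (lt (delC S j) (Finset.filter_subset _ _) (by simp [mem_delC])) _ rfl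
        (P_delC hP j)
      have a4 := ih _ (lt (delRC S i j) (Finset.filter_subset _ _) (by simp [mem_delRC])) _ rfl
        (P_delRC hP i j)
      have b1 := F_rec hP hc
      have b2 := le_rec hP hc
      omega

end LeAux

/-- the number of acyclic orientations of the bipartite graph
`G_λ` (orientations are encoded by diagrams `T` of shape `λ`, the direction of
the edge of the cell `(i,j)` being given by `T (i,j)`) equals the number of
Le-diagrams of shape `λ`. -/
theorem stmt14 (μ : YoungDiagram) :
    {T : ℕ × ℕ → Bool | IsFilling μ.cells T ∧
        ∀ v : ℕ ⊕ ℕ, ¬ Relation.TransGen (DArc μ.cells T) v v}.ncard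
  = {T : ℕ × ℕ → Bool | IsLeDiagram μ.cells T}.ncard := by
  refine LeAux.main _ μ.cells rfl ?_
  intro i i' j j' h1 h2 h3 _ _
  exact μ.isLowerSet (Prod.mk_le_mk.2 ⟨h1.le, h2.le⟩) h3
end

section
/- For every Le-complete polyomino S there exists a bijection Φ from the set of X-diagrams of shape S onto the set of Le-diagrams of shape S such that for every X-diagram T, the diagrams T and Φ(T) have the same set of zero-rows and the same set of zero-columns; in particular, the number of X-diagrams of shape S equals the number of Le-diagrams of shape S. -/
/-- Two cells are edge-adjacent. -/
def CellAdj (c d : ℕ × ℕ) : Prop :=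
  (c.1 = d.1 ∧ (c.2 + 1 = d.2 ∨ d.2 + 1 = c.2)) ∨
  (c.2 = d.2 ∧ (c.1 + 1 = d.1 ∨ d.1 + 1 = c.1))

/-- A polyomino: a finite nonempty edge-connected set of cells. -/
def IsPolyomino (S : Finset (ℕ × ℕ)) : Prop :=
  S.Nonempty ∧ ∀ c ∈ S, ∀ d ∈ S,
    Relation.ReflTransGen (fun x y => x ∈ S ∧ y ∈ S ∧ CellAdj x y) c d

/-- `S` is Le-complete: for rows `i < j` and columns `k < l`, if `(j,k)`,
`(j,l)`, `(i,l)` are cells of `S` then so is `(i,k)`. -/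
def LeComplete (S : Finset (ℕ × ℕ)) : Prop :=
  ∀ i j k l : ℕ, i < j → k < l → (j, k) ∈ S → (j, l) ∈ S → (i, l) ∈ S → (i, k) ∈ S

/-- X-condition for the set `D` of ones. -/
def XP (S D : Finset (ℕ × ℕ)) : Prop :=
  ∀ i i' j j', (i, j) ∈ S → (i, j') ∈ S → (i', j) ∈ S → (i', j') ∈ S →
    (i, j) ∈ D → (i, j') ∉ D → (i', j) ∉ D → (i', j') ∈ D → False

/-- Le-condition for the set `D` of ones. -/
def LP (S D : Finset (ℕ × ℕ)) : Prop :=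
  ∀ i i' j j', i < i' → j < j' → (i, j) ∈ S → (i, j') ∈ S → (i', j) ∈ S → (i', j') ∈ S →
    (i, j') ∈ D → (i', j) ∈ D → (i', j') ∉ D → False

open Classical in
noncomputable def XD (S : Finset (ℕ × ℕ)) : Finset (Finset (ℕ × ℕ)) := S.powerset.filter (XP S)

open Classical in
noncomputable def LD (S : Finset (ℕ × ℕ)) : Finset (Finset (ℕ × ℕ)) := S.powerset.filter (LP S)

theorem mem_XD {S D : Finset (ℕ × ℕ)} : D ∈ XD S ↔ D ⊆ S ∧ XP S D := by simp [XD]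
theorem mem_LD {S D : Finset (ℕ × ℕ)} : D ∈ LD S ↔ D ⊆ S ∧ LP S D := by simp [LD]

open Classical in
noncomputable def sub (S : Finset (ℕ × ℕ)) (p q : ℕ → Prop) : Finset (ℕ × ℕ) :=
  @Finset.filter _ (fun x => p x.1 ∧ q x.2) (Classical.decPred _) S

theorem mem_sub {S : Finset (ℕ × ℕ)} {p q : ℕ → Prop} {i j : ℕ} :
    (i, j) ∈ sub S p q ↔ (i, j) ∈ S ∧ p i ∧ q j := by simp [sub]

theorem sub_subset (S : Finset (ℕ × ℕ)) (p q : ℕ → Prop) : sub S p q ⊆ S :=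
  fun _ h => (mem_sub.1 h).1

theorem mem_XD_sub {S D : Finset (ℕ × ℕ)} {p q : ℕ → Prop} :
    D ∈ XD (sub S p q) ↔ D ∈ XD S ∧ D ⊆ sub S p q := by
  rw [mem_XD, mem_XD]
  constructor
  · rintro ⟨h1, h2⟩
    refine ⟨⟨h1.trans (sub_subset _ _ _), ?_⟩, h1⟩
    intro i i' j j' a b c d e f g h
    have h3 := mem_sub.1 (h1 e)
    have h4 := mem_sub.1 (h1 h)
    exact h2 i i' j j' (mem_sub.2 ⟨a, h3.2.1, h3.2.2⟩) (mem_sub.2 ⟨b, h3.2.1, h4.2.2⟩)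
      (mem_sub.2 ⟨c, h4.2.1, h3.2.2⟩) (mem_sub.2 ⟨d, h4.2.1, h4.2.2⟩) e f g h
  · rintro ⟨⟨h1, h2⟩, h3⟩
    refine ⟨h3, ?_⟩
    intro i i' j j' a b c d
    exact h2 i i' j j' (mem_sub.1 a).1 (mem_sub.1 b).1 (mem_sub.1 c).1 (mem_sub.1 d).1

theorem mem_LD_sub {S D : Finset (ℕ × ℕ)} {p q : ℕ → Prop} :
    D ∈ LD (sub S p q) ↔ D ∈ LD S ∧ D ⊆ sub S p q := by
  rw [mem_LD, mem_LD]
  constructor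
  · rintro ⟨h1, h2⟩
    refine ⟨⟨h1.trans (sub_subset _ _ _), ?_⟩, h1⟩
    intro i i' j j' hi hj a b c d e f g
    have h3 := mem_sub.1 (h1 e)
    have h4 := mem_sub.1 (h1 f)
    exact h2 i i' j j' hi hj (mem_sub.2 ⟨a, h3.2.1, h4.2.2⟩) (mem_sub.2 ⟨b, h3.2.1, h3.2.2⟩)
      (mem_sub.2 ⟨c, h4.2.1, h4.2.2⟩) (mem_sub.2 ⟨d, h4.2.1, h3.2.2⟩) e f g
  · rintro ⟨⟨h1, h2⟩, h3⟩
    refine ⟨h3, ?_⟩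
    intro i i' j j' hi hj a b c d
    exact h2 i i' j j' hi hj (mem_sub.1 a).1 (mem_sub.1 b).1 (mem_sub.1 c).1 (mem_sub.1 d).1

section corner
variable {S : Finset (ℕ × ℕ)} {r c : ℕ}

open Classical in
noncomputable def Fl (S : Finset (ℕ × ℕ)) (e : ℕ × ℕ) : Finset (Finset (ℕ × ℕ)) :=
  (XD S).filter (fun D => e ∉ D ∧ insert e D ∈ XD S)

theorem X1 (he : (r, c) ∈ S)
    (hbi : ∀ i b, (i, c) ∈ S → (r, b) ∈ S → (i, b) ∈ S) :
    (XD S).card = (XD (S.erase (r, c))).card + (Fl S (r, c)).card := by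
  classical
  set P := (XD S).filter (fun D => (r, c) ∈ D) with hP
  set Q := (XD S).filter (fun D => (r, c) ∉ D) with hQ
  have h0 : P.card + Q.card = (XD S).card := Finset.card_filter_add_card_filter_not _
  have h1 : (P.image (fun D => D.erase (r, c))).card = P.card := by
    apply Finset.card_image_of_injOn
    intro D hD D' hD' h
    simp only [hP, Finset.coe_filter, Set.mem_ofPred_eq] at hD hD'
    simp only at h
    rw [← Finset.insert_erase hD.2, h, Finset.insert_erase hD'.2]
  have h2 : Q ∪ P.image (fun D => D.erase (r, c)) = XD (S.erase (r, c)) := by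
    ext D
    simp only [Finset.mem_union, Finset.mem_image, hP, hQ, Finset.mem_filter, mem_XD]
    constructor
    · rintro (⟨⟨h1, h2⟩, h3⟩ | ⟨D', ⟨⟨h1, h2⟩, h3⟩, rfl⟩)
      · refine ⟨fun x hx => Finset.mem_erase.2 ⟨fun h => h3 (h ▸ hx), h1 hx⟩, ?_⟩
        intro i i' j j' a b c d
        exact h2 i i' j j' (Finset.mem_of_mem_erase a) (Finset.mem_of_mem_erase b)
          (Finset.mem_of_mem_erase c) (Finset.mem_of_mem_erase d)
      · refine ⟨Finset.erase_subset_erase _ h1, ?_⟩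
        intro i i' j j' a b c d
        have := h2 i i' j j' (Finset.mem_of_mem_erase a) (Finset.mem_of_mem_erase b)
          (Finset.mem_of_mem_erase c) (Finset.mem_of_mem_erase d)
        simp only [Finset.mem_erase] at *
        tauto
    · rintro ⟨h1, h2⟩
      have h3 : (r, c) ∉ D := fun h => (Finset.mem_erase.1 (h1 h)).1 rfl
      have h4 : D ⊆ S := h1.trans (Finset.erase_subset _ _)
      by_cases hA : ∃ b i, b ≠ c ∧ i ≠ r ∧ (r, b) ∈ S ∧ (i, c) ∈ S ∧
          (r, b) ∈ D ∧ (i, b) ∉ D ∧ (i, c) ∈ D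
      · right
        refine ⟨insert (r, c) D, ⟨⟨Finset.insert_subset he h4, ?_⟩, Finset.mem_insert_self _ _⟩,
          Finset.erase_insert h3⟩
        obtain ⟨b, i, hb, hi, hbS, hiS, hbD, hibD, hiD⟩ := hA
        have key : ∀ i' b', b' ≠ c → i' ≠ r → (r, b') ∈ S → (i', c) ∈ S →
            (i', c) ∉ D → (r, b') ∉ D → (i', b') ∈ D → False := by
          intro i' b' hb' hi' h5 h6 h7 h8 h9
          have k1 := h2 r i b b'
          have k2 := h2 i i' c b'
          have k3 := hbi i b' hiS h5
          have k4 := hbi i b hiS hbS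
          have k5 := hbi i' b' h6 h5
          simp only [Finset.mem_erase, ne_eq, Prod.mk.injEq] at k1 k2
          by_cases k : (i, b') ∈ D <;> simp_all
        intro x x' y y' a b c' d e f g h
        have k1 := h2 x x' y y'
        have k2 := key x' y'
        have k3 := key x y
        have k4 := key x' y
        have k5 := key x y'
        simp only [Finset.mem_erase, Finset.mem_insert, ne_eq, Prod.mk.injEq] at *
        grind
      · left
        refine ⟨⟨h4, ?_⟩, h3⟩
        intro x x' y y' a b c' d e f g h
        have k1 := h2 x x' y y'
        simp only [Finset.mem_erase, ne_eq, Prod.mk.injEq] at *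
        by_cases hx : x = r ∧ y' = c
        · obtain ⟨rfl, rfl⟩ := hx
          apply hA
          refine ⟨y, x', ?_⟩
          grind
        by_cases hx : x' = r ∧ y = c
        · obtain ⟨rfl, rfl⟩ := hx
          apply hA
          refine ⟨y', x, ?_⟩
          grind
        grind
  have h3 : Q ∩ P.image (fun D => D.erase (r, c)) = Fl S (r, c) := by
    ext D
    simp only [Finset.mem_inter, Finset.mem_image, hP, hQ, Finset.mem_filter, Fl]
    constructor
    · rintro ⟨⟨h1, h2⟩, D', ⟨h3, h4⟩, rfl⟩
      exact ⟨h1, h2, by rwa [Finset.insert_erase h4]⟩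
    · rintro ⟨h1, h2, h3⟩
      exact ⟨⟨h1, h2⟩, _, ⟨h3, Finset.mem_insert_self _ _⟩, Finset.erase_insert h2⟩
  have h4 := Finset.card_union_add_card_inter Q (P.image (fun D => D.erase (r, c)))
  rw [h2, h3] at h4
  omega

theorem mem_Fl (he : (r, c) ∈ S) (hbi : ∀ i b, (i, c) ∈ S → (r, b) ∈ S → (i, b) ∈ S)
    {D : Finset (ℕ × ℕ)} : D ∈ Fl S (r, c) ↔ D ⊆ S ∧ (r, c) ∉ D ∧ XP (S.erase (r, c)) D ∧
      ∀ i b, b ≠ c → i ≠ r → (r, b) ∈ S → (i, c) ∈ S →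
        ((r, b) ∈ D → (i, c) ∈ D → (i, b) ∈ D) ∧ ((r, b) ∉ D → (i, c) ∉ D → (i, b) ∉ D) := by
  simp only [Fl, Finset.mem_filter, mem_XD]
  constructor
  · rintro ⟨⟨h1, h2⟩, h3, h4, h5⟩
    refine ⟨h1, h3, ?_, ?_⟩
    · intro x x' y y' a b c' d
      exact h2 x x' y y' (Finset.mem_of_mem_erase a) (Finset.mem_of_mem_erase b)
          (Finset.mem_of_mem_erase c') (Finset.mem_of_mem_erase d)
    · intro i b hb hi hbS hiS
      have k1 := h2 r i b c hbS he (hbi i b hiS hbS) hiS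
      have k2 := h5 r i c b he hbS hiS (hbi i b hiS hbS)
      simp only [Finset.mem_insert, Prod.mk.injEq] at k2
      grind
  · rintro ⟨h1, h2, h3, h4⟩
    refine ⟨⟨h1, ?_⟩, h2, Finset.insert_subset he h1, ?_⟩
    all_goals
      intro x x' y y' a b c' d e f g h
      have k1 := h3 x x' y y'
      have k2 := h4 x' y'
      have k3 := h4 x y
      have k4 := h4 x' y
      have k5 := h4 x y'
      simp only [Finset.mem_erase, Finset.mem_insert, ne_eq, Prod.mk.injEq] at *
      grind

open Classical in
noncomputable def gg (S : Finset (ℕ × ℕ)) (r c : ℕ) (D : Finset (ℕ × ℕ)) : Finset (ℕ × ℕ) :=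
  D ∪ S.filter (fun x => x.2 = c ∧ x.1 ≠ r ∧ ∀ b, (r, b) ∈ D → (x.1, b) ∈ D)

open Classical in
noncomputable def hh (S : Finset (ℕ × ℕ)) (r c : ℕ) (D : Finset (ℕ × ℕ)) : Finset (ℕ × ℕ) :=
  D ∪ S.filter (fun x => x.1 = r ∧ x.2 ≠ c ∧ ∃ i, i ≠ r ∧ (i, c) ∈ S ∧ (i, c) ∉ D ∧ (i, x.2) ∈ D)

theorem mem_gg {D : Finset (ℕ × ℕ)} {i j : ℕ} : (i, j) ∈ gg S r c D ↔
    (i, j) ∈ D ∨ ((i, j) ∈ S ∧ j = c ∧ i ≠ r ∧ ∀ b, (r, b) ∈ D → (i, b) ∈ D) := by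
  simp [gg]

theorem mem_hh {D : Finset (ℕ × ℕ)} {i j : ℕ} : (i, j) ∈ hh S r c D ↔
    (i, j) ∈ D ∨ ((i, j) ∈ S ∧ i = r ∧ j ≠ c ∧
      ∃ i, i ≠ r ∧ (i, c) ∈ S ∧ (i, c) ∉ D ∧ (i, j) ∈ D) := by
  simp [hh]

def TA (S : Finset (ℕ × ℕ)) (r c : ℕ) (D : Finset (ℕ × ℕ)) : Prop :=
  ∀ i, i ≠ r → (i, c) ∈ S → (i, c) ∉ D → ∃ b, b ≠ c ∧ (r, b) ∈ D ∧ (i, b) ∉ D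

def TB (S : Finset (ℕ × ℕ)) (r c : ℕ) (D : Finset (ℕ × ℕ)) : Prop :=
  ∀ b, b ≠ c → (r, b) ∈ D → ∃ i, i ≠ r ∧ (i, c) ∈ S ∧ (i, c) ∉ D ∧ (i, b) ∈ D

theorem gg_mem (he : (r, c) ∈ S) (hbi : ∀ i b, (i, c) ∈ S → (r, b) ∈ S → (i, b) ∈ S)
    {D : Finset (ℕ × ℕ)} (hD : D ∈ XD (sub S (fun _ => True) (· ≠ c))) :
    gg S r c D ∈ Fl S (r, c) ∧ TA S r c (gg S r c D) ∧
      sub (gg S r c D) (fun _ => True) (· ≠ c) = D := by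
  rw [mem_XD_sub, mem_XD] at hD
  obtain ⟨⟨h1, h2⟩, h3⟩ := hD
  have h3' : ∀ i j, (i, j) ∈ D → j ≠ c := fun i j h => (mem_sub.1 (h3 h)).2.2
  have h1' : ∀ i j, (i, j) ∈ D → (i, j) ∈ S := fun i j h => h1 h
  refine ⟨(mem_Fl he hbi).2 ⟨?_, ?_, ?_, ?_⟩, ?_, ?_⟩
  · rintro ⟨i, j⟩ h
    rw [mem_gg] at h
    rcases h with h | h
    · exact h1 h
    · exact h.1
  · rw [mem_gg]
    rintro (h | h)
    · exact h3' _ _ h rfl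
    · exact h.2.2.1 rfl
  · intro x x' y y' a b c' d e f g h
    simp only [mem_gg, Finset.mem_erase] at *
    by_cases hy : y = c
    · subst hy
      have hy' : y' ≠ y := by rintro rfl; tauto
      have : ∃ b, (r, b) ∈ D ∧ (x', b) ∉ D := by
        by_contra hcon; push Not at hcon; grind
      obtain ⟨b1, hb1, hb2⟩ := this
      have k := h2 x x' b1 y'
      have := hbi x b1 a.2 (h1' _ _ hb1)
      have := hbi x' b1 c'.2 (h1' _ _ hb1)
      grind
    by_cases hy2 : y' = c
    · subst hy2
      have : ∃ b, (r, b) ∈ D ∧ (x, b) ∉ D := by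
        by_contra hcon; push Not at hcon; grind
      obtain ⟨b1, hb1, hb2⟩ := this
      have k := h2 x x' y b1
      have := hbi x b1 b.2 (h1' _ _ hb1)
      have := hbi x' b1 d.2 (h1' _ _ hb1)
      grind
    have := h2 x x' y y'
    grind
  · intro i b hb hi hbS hiS
    simp only [mem_gg]
    constructor
    · grind
    · intro u v
      have : ∃ b, (r, b) ∈ D ∧ (i, b) ∉ D := by
        by_contra hcon; push Not at hcon; grind
      obtain ⟨b1, hb1, hb2⟩ := this
      have k := h2 r i b1 b
      have := hbi i b1 hiS (h1' _ _ hb1)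
      have := hbi i b hiS hbS
      grind
  · intro i hi hiS hiD
    simp only [mem_gg] at *
    have : ∃ b, (r, b) ∈ D ∧ (i, b) ∉ D := by
      by_contra hcon; push Not at hcon; grind
    grind
  · ext ⟨i, j⟩
    simp only [mem_sub, mem_gg]
    grind

theorem hh_mem (he : (r, c) ∈ S) (hbi : ∀ i b, (i, c) ∈ S → (r, b) ∈ S → (i, b) ∈ S)
    {D : Finset (ℕ × ℕ)} (hD : D ∈ XD (sub S (· ≠ r) (fun _ => True))) :
    hh S r c D ∈ Fl S (r, c) ∧ TB S r c (hh S r c D) ∧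
      sub (hh S r c D) (· ≠ r) (fun _ => True) = D := by
  rw [mem_XD_sub, mem_XD] at hD
  obtain ⟨⟨h1, h2⟩, h3⟩ := hD
  have h3' : ∀ i j, (i, j) ∈ D → i ≠ r := fun i j h => (mem_sub.1 (h3 h)).2.1
  have h1' : ∀ i j, (i, j) ∈ D → (i, j) ∈ S := fun i j h => h1 h
  refine ⟨(mem_Fl he hbi).2 ⟨?_, ?_, ?_, ?_⟩, ?_, ?_⟩
  · rintro ⟨i, j⟩ h
    rw [mem_hh] at h
    rcases h with h | h
    · exact h1 h
    · exact h.1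
  · rw [mem_hh]
    rintro (h | h)
    · exact h3' _ _ h rfl
    · exact h.2.2.1 rfl
  · intro x x' y y' a b c' d e f g h
    simp only [mem_hh, Finset.mem_erase] at *
    by_cases hx : x = r
    · subst hx
      have : ∃ i, i ≠ x ∧ (i, c) ∈ S ∧ (i, c) ∉ D ∧ (i, y) ∈ D := by grind
      obtain ⟨i1, k1, k2, k3, k4⟩ := this
      have k := h2 i1 x' y y'
      have := hbi i1 y' k2 b.2
      have := hbi i1 y k2 a.2
      grind
    by_cases hx : x' = r
    · subst hx
      have : ∃ i, i ≠ x' ∧ (i, c) ∈ S ∧ (i, c) ∉ D ∧ (i, y') ∈ D := by grind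
      obtain ⟨i1, k1, k2, k3, k4⟩ := this
      have k := h2 x i1 y y'
      have := hbi i1 y' k2 d.2
      have := hbi i1 y k2 c'.2
      grind
    have := h2 x x' y y'
    grind
  · intro i b hb hi hbS hiS
    simp only [mem_hh]
    constructor
    · intro u v
      have : ∃ i, i ≠ r ∧ (i, c) ∈ S ∧ (i, c) ∉ D ∧ (i, b) ∈ D := by grind
      obtain ⟨i1, k1, k2, k3, k4⟩ := this
      have k := h2 i1 i b c
      have := hbi i1 b k2 hbS
      have := hbi i b hiS hbS
      grind
    · grind
  · intro i hi hiD
    simp only [mem_hh] at *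
    grind
  · ext ⟨i, j⟩
    simp only [mem_sub, mem_hh]
    grind

theorem Fl_cases (he : (r, c) ∈ S) (hbi : ∀ i b, (i, c) ∈ S → (r, b) ∈ S → (i, b) ∈ S)
    {D : Finset (ℕ × ℕ)} (hD : D ∈ Fl S (r, c)) : TA S r c D ∨ TB S r c D := by
  by_contra hcon
  simp only [TA, TB] at hcon
  push Not at hcon
  obtain ⟨⟨i, h1, h2, h3, h4⟩, b, h5, h6, h7⟩ := hcon
  exact h7 i h1 h2 h3 (h4 b h5 h6)

theorem Fl_A (he : (r, c) ∈ S) (hbi : ∀ i b, (i, c) ∈ S → (r, b) ∈ S → (i, b) ∈ S)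
    {D : Finset (ℕ × ℕ)} (hD : D ∈ Fl S (r, c)) (hA : TA S r c D) :
    sub D (fun _ => True) (· ≠ c) ∈ XD (sub S (fun _ => True) (· ≠ c)) ∧
    gg S r c (sub D (fun _ => True) (· ≠ c)) = D := by
  rw [mem_Fl he hbi] at hD
  obtain ⟨h1, h2, h3, h4⟩ := hD
  have h1' : ∀ i j, (i, j) ∈ D → (i, j) ∈ S := fun i j h => h1 h
  constructor
  · rw [mem_XD]
    constructor
    · rintro ⟨i, j⟩ h
      rw [mem_sub] at *
      exact ⟨h1 h.1, h.2⟩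
    · intro x x' y y' a b c' d
      have := h3 x x' y y'
      simp only [mem_sub, Finset.mem_erase, ne_eq, Prod.mk.injEq] at *
      clear h4 hbi h1'
      grind
  · ext ⟨i, j⟩
    simp only [mem_gg, mem_sub]
    by_cases hj : j = c
    · subst hj
      have := hA i
      by_cases hi : i = r
      · grind
      · constructor
        · grind
        · grind
    · grind

theorem Fl_B (he : (r, c) ∈ S) (hbi : ∀ i b, (i, c) ∈ S → (r, b) ∈ S → (i, b) ∈ S)
    {D : Finset (ℕ × ℕ)} (hD : D ∈ Fl S (r, c)) (hB : TB S r c D) :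
    sub D (· ≠ r) (fun _ => True) ∈ XD (sub S (· ≠ r) (fun _ => True)) ∧
    hh S r c (sub D (· ≠ r) (fun _ => True)) = D := by
  rw [mem_Fl he hbi] at hD
  obtain ⟨h1, h2, h3, h4⟩ := hD
  have h1' : ∀ i j, (i, j) ∈ D → (i, j) ∈ S := fun i j h => h1 h
  constructor
  · rw [mem_XD]
    constructor
    · rintro ⟨i, j⟩ h
      rw [mem_sub] at *
      exact ⟨h1 h.1, h.2⟩
    · intro x x' y y' a b c' d
      have := h3 x x' y y'
      simp only [mem_sub, Finset.mem_erase, ne_eq, Prod.mk.injEq] at *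
      clear h4 hbi h1'
      grind
  · ext ⟨i, j⟩
    simp only [mem_hh, mem_sub]
    by_cases hi : i = r
    · subst hi
      have := hB j
      by_cases hj : j = c
      · grind
      · constructor
        · grind
        · grind
    · grind

theorem Fl_AB (he : (r, c) ∈ S) (hbi : ∀ i b, (i, c) ∈ S → (r, b) ∈ S → (i, b) ∈ S)
    {D : Finset (ℕ × ℕ)} (hD : D ∈ Fl S (r, c)) (hA : TA S r c D) (hB : TB S r c D) :
    ∀ b, (r, b) ∉ D := by
  classical
  rw [mem_Fl he hbi] at hD
  obtain ⟨h1, h2, h3, h4⟩ := hD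
  have h1' : ∀ i j, (i, j) ∈ D → (i, j) ∈ S := fun i j h => h1 h
  intro b0 hb0
  have hb0c : b0 ≠ c := by rintro rfl; exact h2 hb0
  obtain ⟨i0, k1, k2, k3, k4⟩ := hB b0 hb0c hb0
  -- rows with `v = 0`
  set I := (S.image Prod.fst).filter (fun i => i ≠ r ∧ (i, c) ∈ S ∧ (i, c) ∉ D) with hI
  set U : ℕ → Finset ℕ :=
    fun i => (S.image Prod.snd).filter (fun b => (r, b) ∈ D ∧ (i, b) ∈ D) with hU
  have hIm : ∀ i, i ∈ I ↔ i ≠ r ∧ (i, c) ∈ S ∧ (i, c) ∉ D := by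
    intro i
    simp only [hI, Finset.mem_filter, Finset.mem_image, Prod.exists]
    constructor
    · exact fun h => h.2
    · exact fun h => ⟨⟨i, c, h.2.1, rfl⟩, h⟩
  have hUm : ∀ i b, b ∈ U i ↔ (r, b) ∈ D ∧ (i, b) ∈ D := by
    intro i b
    simp only [hU, Finset.mem_filter, Finset.mem_image, Prod.exists]
    constructor
    · exact fun h => h.2
    · exact fun h => ⟨⟨r, b, h1 h.1, rfl⟩, h⟩
  obtain ⟨i, hi, hmax⟩ := Finset.exists_max_image I (fun i => (U i).card)
    ⟨i0, (hIm _).2 ⟨k1, k2, k3⟩⟩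
  obtain ⟨l1, l2, l3⟩ := (hIm _).1 hi
  obtain ⟨b, hbc, hb1, hb2⟩ := hA i l1 l2 l3
  obtain ⟨i', m1, m2, m3, m4⟩ := hB b hbc hb1
  have := hmax i' ((hIm _).2 ⟨m1, m2, m3⟩)
  have hlt : U i ⊂ U i' := by
    rw [Finset.ssubset_iff_of_subset]
    · refine ⟨b, (hUm _ _).2 ⟨hb1, m4⟩, fun h => hb2 ((hUm _ _).1 h).2⟩
    · intro b' hb'
      obtain ⟨n1, n2⟩ := (hUm _ _).1 hb'
      refine (hUm _ _).2 ⟨n1, ?_⟩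
      by_contra n3
      have k := h3 i i' b' b
      have q1 := hbi i b l2 (h1' _ _ hb1)
      have q2 := hbi i' b' m2 (h1' _ _ n1)
      simp only [Finset.mem_erase, ne_eq, Prod.mk.injEq] at k
      have q3 := h1' _ _ n2
      have q4 := h1' _ _ m4
      exact k ⟨by simp [l1], q3⟩ ⟨by simp [l1], q1⟩ ⟨by simp [m1], q2⟩ ⟨by simp [m1], q4⟩
        n2 hb2 n3 m4
  have := Finset.card_lt_card hlt
  omega

theorem X2 (he : (r, c) ∈ S) (hbi : ∀ i b, (i, c) ∈ S → (r, b) ∈ S → (i, b) ∈ S) :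
    (Fl S (r, c)).card + (XD (sub S (· ≠ r) (· ≠ c))).card =
      (XD (sub S (fun _ => True) (· ≠ c))).card + (XD (sub S (· ≠ r) (fun _ => True))).card := by
  classical
  set G := (XD (sub S (fun _ => True) (· ≠ c))).image (gg S r c) with hG
  set K := (XD (sub S (· ≠ r) (fun _ => True))).image (hh S r c) with hK
  have hGm : ∀ D, D ∈ G ↔ D ∈ Fl S (r, c) ∧ TA S r c D := by
    intro D
    simp only [hG, Finset.mem_image]
    constructor
    · rintro ⟨D', h, rfl⟩
      exact ⟨(gg_mem he hbi h).1, (gg_mem he hbi h).2.1⟩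
    · rintro ⟨h1, h2⟩
      exact ⟨_, Fl_A he hbi h1 h2⟩
  have hKm : ∀ D, D ∈ K ↔ D ∈ Fl S (r, c) ∧ TB S r c D := by
    intro D
    simp only [hK, Finset.mem_image]
    constructor
    · rintro ⟨D', h, rfl⟩
      exact ⟨(hh_mem he hbi h).1, (hh_mem he hbi h).2.1⟩
    · rintro ⟨h1, h2⟩
      exact ⟨_, Fl_B he hbi h1 h2⟩
  have hginj : Set.InjOn (gg S r c) (XD (sub S (fun _ => True) (· ≠ c))) := by
    intro D hD D' hD' h
    rw [← (gg_mem he hbi hD).2.2, h, (gg_mem he hbi hD').2.2]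
  have hGc : G.card = (XD (sub S (fun _ => True) (· ≠ c))).card :=
    Finset.card_image_of_injOn hginj
  have hKc : K.card = (XD (sub S (· ≠ r) (fun _ => True))).card := by
    apply Finset.card_image_of_injOn
    intro D hD D' hD' h
    rw [← (hh_mem he hbi hD).2.2, h, (hh_mem he hbi hD').2.2]
  have hU : G ∪ K = Fl S (r, c) := by
    ext D
    rw [Finset.mem_union, hGm, hKm]
    have := @Fl_cases S r c he hbi D
    tauto
  have hHsub : ∀ D, D ∈ XD (sub S (· ≠ r) (· ≠ c)) ↔
      D ∈ XD (sub S (fun _ => True) (· ≠ c)) ∧ ∀ b, (r, b) ∉ D := by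
    intro D
    rw [mem_XD_sub, mem_XD_sub]
    constructor
    · rintro ⟨h1, h2⟩
      refine ⟨⟨h1, ?_⟩, ?_⟩
      · rintro ⟨i, j⟩ h
        have := h2 h
        rw [mem_sub] at *
        tauto
      · intro b h
        exact (mem_sub.1 (h2 h)).2.1 rfl
    · rintro ⟨⟨h1, h2⟩, h3⟩
      refine ⟨h1, ?_⟩
      rintro ⟨i, j⟩ h
      have := h2 h
      rw [mem_sub] at *
      refine ⟨this.1, ?_, this.2.2⟩
      rintro rfl
      exact h3 _ h
  have hI : G ∩ K = (XD (sub S (· ≠ r) (· ≠ c))).image (gg S r c) := by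
    ext D
    rw [Finset.mem_inter, hGm, hKm, Finset.mem_image]
    constructor
    · rintro ⟨⟨h1, h2⟩, -, h3⟩
      have h4 := Fl_AB he hbi h1 h2 h3
      refine ⟨_, (hHsub _).2 ⟨(Fl_A he hbi h1 h2).1, ?_⟩, (Fl_A he hbi h1 h2).2⟩
      intro b hb
      exact h4 b (mem_sub.1 hb).1
    · rintro ⟨D', h, rfl⟩
      obtain ⟨h1, h2⟩ := (hHsub _).1 h
      obtain ⟨k1, k2, -⟩ := gg_mem he hbi h1
      refine ⟨⟨k1, k2⟩, k1, ?_⟩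
      intro b hb hbD
      rw [mem_gg] at hbD
      rcases hbD with h | h
      · exact absurd h (h2 b)
      · exact absurd h.2.1 hb
  have hIc : (G ∩ K).card = (XD (sub S (· ≠ r) (· ≠ c))).card := by
    rw [hI]
    apply Finset.card_image_of_injOn
    intro D hD D' hD'
    exact hginj ((hHsub _).1 hD).1 ((hHsub _).1 hD').1
  have := Finset.card_union_add_card_inter G K
  rw [hU, hIc, hGc, hKc] at this
  exact this

theorem L1 (he : (r, c) ∈ S) (hr : ∀ i j, (i, j) ∈ S → i ≤ r) (hc : ∀ j, (r, j) ∈ S → j ≤ c)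
    (hbi : ∀ i b, (i, c) ∈ S → (r, b) ∈ S → (i, b) ∈ S) :
    (LD S).card + (LD (sub S (· ≠ r) (· ≠ c))).card = (LD (S.erase (r, c))).card +
      (LD (sub S (fun _ => True) (· ≠ c))).card + (LD (sub S (· ≠ r) (fun _ => True))).card := by
  classical
  set P := (LD S).filter (fun D => (r, c) ∈ D) with hP
  set Q := (LD S).filter (fun D => (r, c) ∉ D) with hQ
  have h0 : P.card + Q.card = (LD S).card := Finset.card_filter_add_card_filter_not _
  have h1 : P.card = (LD (S.erase (r, c))).card := by
    apply Finset.card_nbij' (fun D => D.erase (r, c)) (fun D => insert (r, c) D)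
    · intro D hD
      simp only [hP, Finset.coe_filter, Set.mem_ofPred_eq, mem_LD, Finset.mem_coe] at *
      obtain ⟨⟨h1, h2⟩, h3⟩ := hD
      refine ⟨Finset.erase_subset_erase _ h1, ?_⟩
      intro i i' j j' hi hj a b c d
      have := h2 i i' j j' hi hj
      simp only [Finset.mem_erase] at *
      grind
    · intro D hD
      simp only [hP, Finset.coe_filter, Set.mem_ofPred_eq, mem_LD, Finset.mem_coe] at *
      obtain ⟨h1, h2⟩ := hD
      refine ⟨⟨Finset.insert_subset he (h1.trans (Finset.erase_subset _ _)), ?_⟩,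
        Finset.mem_insert_self _ _⟩
      intro i i' j j' hi hj a b c' d
      have := h2 i i' j j' hi hj
      have := hr i' j c'
      have := hc j'
      simp only [Finset.mem_erase, Finset.mem_insert, ne_eq, Prod.mk.injEq] at *
      grind
    · intro D hD
      simp only [hP, Finset.coe_filter, Set.mem_ofPred_eq] at hD
      exact Finset.insert_erase hD.2
    · intro D hD
      apply Finset.erase_insert
      intro h
      have := (mem_LD.1 hD).1 h
      simp at this
  have h2 : LD (sub S (fun _ => True) (· ≠ c)) ∪ LD (sub S (· ≠ r) (fun _ => True)) = Q := by
    ext D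
    rw [Finset.mem_union, mem_LD_sub, mem_LD_sub, hQ, Finset.mem_filter, ← and_or_left]
    refine and_congr_right fun hD => ?_
    rw [mem_LD] at hD
    obtain ⟨hD1, hD2⟩ := hD
    constructor
    · rintro (h | h) h'
      · exact (mem_sub.1 (h h')).2.2 rfl
      · exact (mem_sub.1 (h h')).2.1 rfl
    · intro h
      by_contra hcon
      push Not at hcon
      obtain ⟨h1, h2⟩ := hcon
      rw [Finset.not_subset] at h1 h2
      obtain ⟨⟨i, j⟩, h3, h4⟩ := h1
      obtain ⟨⟨i', j'⟩, h5, h6⟩ := h2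
      rw [mem_sub] at h4 h6
      have k1 := hD1 h3
      have k2 := hD1 h5
      obtain rfl : j = c := by grind
      obtain rfl : i' = r := by grind
      have k3 := hr _ _ k1
      have k4 := hc _ k2
      have k5 : i ≠ i' := by rintro rfl; exact h h3
      have k6 : j' ≠ j := by rintro rfl; exact h h5
      exact hD2 i i' j' j (by omega) (by omega) (hbi _ _ k1 k2) k1 k2 he h3 h5 h
  have h3 : LD (sub S (fun _ => True) (· ≠ c)) ∩ LD (sub S (· ≠ r) (fun _ => True)) =
      LD (sub S (· ≠ r) (· ≠ c)) := by
    ext D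
    rw [Finset.mem_inter, mem_LD_sub, mem_LD_sub, mem_LD_sub, ← and_and_left]
    refine and_congr_right fun hD => ?_
    simp only [Finset.subset_iff, Prod.forall, mem_sub]
    grind
  have := Finset.card_union_add_card_inter (LD (sub S (fun _ => True) (· ≠ c)))
    (LD (sub S (· ≠ r) (fun _ => True)))
  rw [h2, h3] at this
  omega

end corner

theorem LeComplete.sub' {S : Finset (ℕ × ℕ)} (h : LeComplete S) (p q : ℕ → Prop) :
    LeComplete (sub S p q) := by
  intro i j k l h1 h2 h3 h4 h5
  have := h i j k l h1 h2
  rw [mem_sub] at *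
  tauto

theorem card_eq (n : ℕ) : ∀ S : Finset (ℕ × ℕ), S.card ≤ n → LeComplete S →
    (XD S).card = (LD S).card := by
  classical
  induction n with
  | zero =>
    intro S hS _
    obtain rfl : S = ∅ := by simpa using hS
    have h1 : XD ∅ = {∅} := by
      ext D; rw [mem_XD]; simp [XP]
    have h2 : LD ∅ = {∅} := by
      ext D; rw [mem_LD]; simp [LP]
    rw [h1, h2]
  | succ n ih =>
    intro S hS hL
    rcases S.eq_empty_or_nonempty with rfl | hne
    · exact ih _ (by simp) hL
    obtain ⟨⟨r, c0⟩, h1, hr⟩ := Finset.exists_max_image S Prod.fst hne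
    obtain ⟨⟨r', c⟩, h2, hc⟩ := Finset.exists_max_image (S.filter (fun x => x.1 = r)) Prod.snd
      ⟨(r, c0), by simp [h1]⟩
    simp only [Finset.mem_filter, and_imp, Prod.forall] at h2 hc hr
    obtain ⟨he, rfl⟩ := h2
    have hc' : ∀ j, (r', j) ∈ S → j ≤ c := fun j hj => hc _ j hj rfl
    have hbi : ∀ i b, (i, c) ∈ S → (r', b) ∈ S → (i, b) ∈ S := by
      intro i b h3 h4
      rcases (hr _ _ h3).lt_or_eq with h5 | rfl
      · rcases (hc' _ h4).lt_or_eq with h6 | rfl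
        · exact hL i r' b c h5 h6 h4 he h3
        · exact h3
      · exact h4
    have hlt : ∀ p q : ℕ → Prop, ¬ (p r' ∧ q c) → (sub S p q).card ≤ n := by
      intro p q h
      have : (sub S p q).card < S.card := by
        apply Finset.card_lt_card
        rw [Finset.ssubset_iff_of_subset (sub_subset _ _ _)]
        exact ⟨_, he, fun h' => h (mem_sub.1 h').2⟩
      omega
    have e1 := ih _ (hlt (fun _ => True) (· ≠ c) (by simp)) (hL.sub' _ _)
    have e2 := ih _ (hlt (· ≠ r') (fun _ => True) (by simp)) (hL.sub' _ _)
    have e3 := ih _ (hlt (· ≠ r') (· ≠ c) (by simp)) (hL.sub' _ _)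
    have e4 := ih (S.erase (r', c)) (by rw [Finset.card_erase_of_mem he]; omega) (by
      intro i j k l k1 k2 k3 k4 k5
      simp only [Finset.mem_erase] at *
      refine ⟨?_, hL i j k l k1 k2 k3.2 k4.2 k5.2⟩
      intro h
      have := hr _ _ k3.2
      simp only [Prod.mk.injEq] at h
      omega)
    have f1 := X1 he hbi
    have f2 := X2 he hbi
    have f3 := L1 he hr hc' hbi
    omega

/-- Möbius inversion in the form of a bijection. -/
theorem exists_equiv {A B L : Type} [Fintype A] [Fintype B] [Fintype L] [DecidableEq L]
    (z : A → Finset L) (w : B → Finset L)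
    (h : ∀ Z, Fintype.card {a // Z ⊆ z a} = Fintype.card {b // Z ⊆ w b}) :
    ∃ Φ : A ≃ B, ∀ a, w (Φ a) = z a := by
  classical
  have key : ∀ n, ∀ Z : Finset L, Fintype.card L - Z.card ≤ n →
      Fintype.card {a // z a = Z} = Fintype.card {b // w b = Z} := by
    have gen : ∀ (C : Type) [Fintype C] (f : C → Finset L) (Z : Finset L),
        Fintype.card {a // Z ⊆ f a} = Fintype.card {a // f a = Z} +
          ∑ Y ∈ Finset.univ.filter (fun Y => Z ⊂ Y), Fintype.card {a // f a = Y} := by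
      intro C _ f Z
      simp only [Fintype.card_subtype]
      rw [Finset.card_eq_sum_card_fiberwise (f := f) (t := Finset.univ.filter (fun Y => Z ⊆ Y))
        (by intro a; simp)]
      have : Finset.univ.filter (fun Y => Z ⊆ Y) =
          insert Z (Finset.univ.filter (fun Y => Z ⊂ Y)) := by
        ext Y
        simp only [Finset.mem_filter, Finset.mem_insert, Finset.mem_univ, true_and]
        rw [Finset.ssubset_iff_subset_ne]
        constructor
        · intro h; by_cases h' : Z = Y
          · exact Or.inl h'.symm
          · exact Or.inr ⟨h, h'⟩
        · rintro (rfl | h)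
          · exact subset_rfl
          · exact h.1
      rw [this, Finset.sum_insert (by simp)]
      congr 1
      · congr 1
        ext a
        simp only [Finset.mem_filter, Finset.mem_univ, true_and]
        constructor
        · exact fun h => h.2
        · rintro rfl; exact ⟨subset_rfl, rfl⟩
      · apply Finset.sum_congr rfl
        intro Y hY
        congr 1
        ext a
        simp only [Finset.mem_filter, Finset.mem_univ, true_and] at *
        constructor
        · exact fun h => h.2
        · rintro rfl; exact ⟨hY.1, rfl⟩
    intro n
    induction n with
    | zero =>
      intro Z hZ
      have e := h Z
      rw [gen A z Z, gen B w Z] at e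
      have : Finset.univ.filter (fun Y => Z ⊂ Y) = ∅ := by
        ext Y
        simp only [Finset.mem_filter, Finset.mem_univ, true_and, Finset.notMem_empty, iff_false]
        intro hY
        have := Finset.card_lt_card hY
        have := Finset.card_le_univ Y
        omega
      rw [this] at e
      simpa using e
    | succ n ih =>
      intro Z hZ
      have e := h Z
      rw [gen A z Z, gen B w Z] at e
      have : ∑ Y ∈ Finset.univ.filter (fun Y => Z ⊂ Y), Fintype.card {a // z a = Y} =
          ∑ Y ∈ Finset.univ.filter (fun Y => Z ⊂ Y), Fintype.card {a // w a = Y} := by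
        apply Finset.sum_congr rfl
        intro Y hY
        simp only [Finset.mem_filter, Finset.mem_univ, true_and] at hY
        apply ih
        have := Finset.card_lt_card hY
        omega
      omega
  have eqv : ∀ Z, Nonempty ({a // z a = Z} ≃ {b // w b = Z}) :=
    fun Z => ⟨Fintype.equivOfCardEq (key _ Z le_rfl)⟩
  let e := fun Z => (eqv Z).some
  refine ⟨(Equiv.sigmaFiberEquiv z).symm.trans
    ((Equiv.sigmaCongrRight e).trans (Equiv.sigmaFiberEquiv w)), ?_⟩
  intro a
  exact (e (z a) ⟨a, rfl⟩).2

open Classical in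
noncomputable def ones (S : Finset (ℕ × ℕ)) (T : ℕ × ℕ → Bool) : Finset (ℕ × ℕ) :=
  S.filter (fun x => T x = true)

open Classical in
noncomputable def fillEquiv (S : Finset (ℕ × ℕ)) (P : (ℕ × ℕ → Bool) → Prop)
    (A : Finset (Finset (ℕ × ℕ)))
    (hP : ∀ T, P T → IsFilling S T) (hA : ∀ D ∈ A, D ⊆ S)
    (h : ∀ T, IsFilling S T → (P T ↔ ones S T ∈ A)) : {T // P T} ≃ {D // D ∈ A} where
  toFun T := ⟨ones S T.1, (h _ (hP _ T.2)).1 T.2⟩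
  invFun D := ⟨fun x => decide (x ∈ D.1), by
    have h1 : IsFilling S (fun x => decide (x ∈ D.1)) := by
      intro x hx
      simp only [decide_eq_false_iff_not]
      exact fun h' => hx (hA _ D.2 h')
    rw [h _ h1]
    have : ones S (fun x => decide (x ∈ D.1)) = D.1 := by
      ext x
      simp only [ones, Finset.mem_filter, decide_eq_true_eq]
      exact ⟨fun h => h.2, fun h => ⟨hA _ D.2 h, h⟩⟩
    rw [this]
    exact D.2⟩
  left_inv T := by
    apply Subtype.ext
    funext x
    have := hP _ T.2 x
    simp only [ones, Finset.mem_filter]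
    by_cases hx : x ∈ S
    · simp [hx]
    · simp [hx, this hx]
  right_inv D := by
    apply Subtype.ext
    ext x
    simp only [ones, Finset.mem_filter, decide_eq_true_eq]
    exact ⟨fun h => h.2, fun h => ⟨hA _ D.2 h, h⟩⟩

theorem mem_ones {S : Finset (ℕ × ℕ)} {T : ℕ × ℕ → Bool} {x : ℕ × ℕ} :
    x ∈ ones S T ↔ x ∈ S ∧ T x = true := by simp [ones]

theorem X_iff (S : Finset (ℕ × ℕ)) (T : ℕ × ℕ → Bool) (hT : IsFilling S T) :
    IsXDiagram S T ↔ ones S T ∈ XD S := by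
  rw [mem_XD]
  unfold IsXDiagram Avoids XP
  simp only [mem_ones, not_and, Bool.not_eq_true]
  constructor
  · rintro ⟨-, h1, h2⟩
    refine ⟨Finset.filter_subset _ _, ?_⟩
    intro i i' j j' a b c d e f g h
    have f' := f b
    have g' := g c
    rcases lt_trichotomy i i' with hi | rfl | hi
    · rcases lt_trichotomy j j' with hj | rfl | hj
      · exact h1 ⟨i, i', j, j', hi, hj, a, b, c, d, e.2, f', g', h.2⟩
      · grind
      · exact h2 ⟨i, i', j', j, hi, hj, b, a, d, c, f', e.2, h.2, g'⟩
    · grind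
    · rcases lt_trichotomy j j' with hj | rfl | hj
      · exact h2 ⟨i', i, j, j', hi, hj, c, d, a, b, g', h.2, e.2, f'⟩
      · grind
      · exact h1 ⟨i', i, j', j, hi, hj, d, c, b, a, h.2, g', f', e.2⟩
  · rintro ⟨-, h⟩
    refine ⟨hT, ?_, ?_⟩
    · rintro ⟨i, i', j, j', hi, hj, a, b, c, d, e, f, g, k⟩
      exact h i i' j j' a b c d ⟨a, e⟩ (fun _ => f) (fun _ => g) ⟨d, k⟩
    · rintro ⟨i, i', j, j', hi, hj, a, b, c, d, e, f, g, k⟩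
      exact h i i' j' j b a d c ⟨b, f⟩ (fun _ => e) (fun _ => k) ⟨c, g⟩

theorem L_iff (S : Finset (ℕ × ℕ)) (T : ℕ × ℕ → Bool) (hT : IsFilling S T) :
    IsLeDiagram S T ↔ ones S T ∈ LD S := by
  rw [mem_LD]
  unfold IsLeDiagram Avoids LP
  simp only [mem_ones, not_and, Bool.not_eq_true]
  constructor
  · rintro ⟨-, h1, h2⟩
    refine ⟨Finset.filter_subset _ _, ?_⟩
    intro i i' j j' hi hj a b c d e f g
    cases h : T (i, j)
    · exact h2 ⟨i, i', j, j', hi, hj, a, b, c, d, h, e.2, f.2, g d⟩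
    · exact h1 ⟨i, i', j, j', hi, hj, a, b, c, d, h, e.2, f.2, g d⟩
  · rintro ⟨-, h⟩
    refine ⟨hT, ?_, ?_⟩
    all_goals
      rintro ⟨i, i', j, j', hi, hj, a, b, c, d, e, f, g, k⟩
      exact h i i' j j' hi hj a b c d ⟨b, f⟩ ⟨c, g⟩ (fun _ => k)

/-- The zero lines (rows on the left, columns on the right) below `N`. -/
noncomputable def zl (N : ℕ) (D : Finset (ℕ × ℕ)) : Finset (Fin N ⊕ Fin N) :=
  (Finset.univ.filter (fun i : Fin N => ∀ x ∈ D, x.1 ≠ i)).disjSum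
    (Finset.univ.filter (fun i : Fin N => ∀ x ∈ D, x.2 ≠ i))

theorem inl_mem_zl {N : ℕ} {D : Finset (ℕ × ℕ)} {i : Fin N} :
    Sum.inl i ∈ zl N D ↔ ∀ x ∈ D, x.1 ≠ i := by simp [zl]
theorem inr_mem_zl {N : ℕ} {D : Finset (ℕ × ℕ)} {i : Fin N} :
    Sum.inr i ∈ zl N D ↔ ∀ x ∈ D, x.2 ≠ i := by simp [zl]

theorem subset_zl {N : ℕ} {S D : Finset (ℕ × ℕ)} (hD : D ⊆ S) (Z : Finset (Fin N ⊕ Fin N)) :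
    Z ⊆ zl N D ↔ D ⊆ sub S (fun i => ∀ k : Fin N, Sum.inl k ∈ Z → i ≠ k)
      (fun j => ∀ k : Fin N, Sum.inr k ∈ Z → j ≠ k) := by
  constructor
  · rintro h ⟨i, j⟩ hx
    refine mem_sub.2 ⟨hD hx, fun k hk => ?_, fun k hk => ?_⟩
    · exact inl_mem_zl.1 (h hk) _ hx
    · exact inr_mem_zl.1 (h hk) _ hx
  · rintro h (k | k) hk
    · rw [inl_mem_zl]
      rintro ⟨i, j⟩ hx
      exact (mem_sub.1 (h hx)).2.1 k hk
    · rw [inr_mem_zl]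
      rintro ⟨i, j⟩ hx
      exact (mem_sub.1 (h hx)).2.2 k hk

theorem zeroRow_iff {S : Finset (ℕ × ℕ)} {T : ℕ × ℕ → Bool} {i : ℕ} :
    ZeroRow S T i ↔ ∀ x ∈ ones S T, x.1 ≠ i := by
  unfold ZeroRow
  constructor
  · rintro h ⟨a, b⟩ hx rfl
    rw [mem_ones] at hx
    have := h b hx.1
    simp_all
  · intro h j hj
    by_contra hT
    exact h (i, j) (mem_ones.2 ⟨hj, by simpa using hT⟩) rfl

theorem zeroCol_iff {S : Finset (ℕ × ℕ)} {T : ℕ × ℕ → Bool} {j : ℕ} :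
    ZeroCol S T j ↔ ∀ x ∈ ones S T, x.2 ≠ j := by
  unfold ZeroCol
  constructor
  · rintro h ⟨a, b⟩ hx rfl
    rw [mem_ones] at hx
    have := h a hx.1
    simp_all
  · intro h i hi
    by_contra hT
    exact h (i, j) (mem_ones.2 ⟨hi, by simpa using hT⟩) rfl

theorem main_equiv (S : Finset (ℕ × ℕ)) (hLe : LeComplete S) :
    ∃ Φ : {T : ℕ × ℕ → Bool // IsXDiagram S T} ≃
           {T : ℕ × ℕ → Bool // IsLeDiagram S T},
      ∀ T : {T : ℕ × ℕ → Bool // IsXDiagram S T},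
        (∀ i, ZeroRow S T.1 i ↔ ZeroRow S (Φ T).1 i) ∧
        (∀ j, ZeroCol S T.1 j ↔ ZeroCol S (Φ T).1 j) := by
  classical
  obtain ⟨N, hN⟩ : ∃ N, ∀ i j, (i, j) ∈ S → i < N ∧ j < N := by
    refine ⟨S.sup (fun x => x.1 + x.2 + 1), fun i j h => ?_⟩
    have := Finset.le_sup (f := fun x : ℕ × ℕ => x.1 + x.2 + 1) h
    simp only at this
    omega
  obtain ⟨Ψ, hΨ⟩ := exists_equiv (A := {D // D ∈ XD S}) (B := {D // D ∈ LD S})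
    (fun D => zl N D.1) (fun D => zl N D.1) (by
      intro Z
      set p := (fun i => ∀ k : Fin N, Sum.inl k ∈ Z → i ≠ (k : ℕ)) with hp
      set q := (fun j => ∀ k : Fin N, Sum.inr k ∈ Z → j ≠ (k : ℕ)) with hq
      have e := card_eq _ (sub S p q) le_rfl (hLe.sub' p q)
      rw [← Fintype.card_coe, ← Fintype.card_coe] at e
      refine Eq.trans (Fintype.card_congr ?_) (e.trans (Fintype.card_congr ?_))
      · exact (Equiv.subtypeSubtypeEquivSubtypeInter (· ∈ XD S) (fun D => Z ⊆ zl N D)).trans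
          (Equiv.subtypeEquivRight fun D => by
            rw [mem_XD_sub]
            exact and_congr_right fun h => subset_zl (mem_XD.1 h).1 Z)
      · exact ((Equiv.subtypeSubtypeEquivSubtypeInter (· ∈ LD S) (fun D => Z ⊆ zl N D)).trans
          (Equiv.subtypeEquivRight fun D => by
            rw [mem_LD_sub]
            exact and_congr_right fun h => subset_zl (mem_LD.1 h).1 Z)).symm)
  let eX := fillEquiv S (IsXDiagram S) (XD S) (fun T h => h.1) (fun D h => (mem_XD.1 h).1) (X_iff S)
  let eL := fillEquiv S (IsLeDiagram S) (LD S) (fun T h => h.1) (fun D h => (mem_LD.1 h).1)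
    (L_iff S)
  refine ⟨(eX.trans Ψ).trans eL.symm, fun T => ?_⟩
  have h1 : ones S ((eX.trans Ψ).trans eL.symm T).1 = (Ψ (eX T)).1 := by
    have : eL (eL.symm (Ψ (eX T))) = Ψ (eX T) := eL.apply_symm_apply _
    exact congrArg Subtype.val this
  have h2 : zl N (Ψ (eX T)).1 = zl N (ones S T.1) := hΨ (eX T)
  rw [← h1] at h2
  have hb : ∀ T' x, x ∈ ones S T' → x.1 < N ∧ x.2 < N := fun T' x hx => hN x.1 x.2 (mem_ones.1 hx).1
  constructor
  · intro i
    rw [zeroRow_iff, zeroRow_iff]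
    by_cases hi : i < N
    · have := (Finset.ext_iff.1 h2) (Sum.inl ⟨i, hi⟩)
      rw [inl_mem_zl, inl_mem_zl] at this
      exact this.symm
    · constructor
      all_goals
        intro _ x hx
        have := hb _ x hx
        omega
  · intro i
    rw [zeroCol_iff, zeroCol_iff]
    by_cases hi : i < N
    · have := (Finset.ext_iff.1 h2) (Sum.inr ⟨i, hi⟩)
      rw [inr_mem_zl, inr_mem_zl] at this
      exact this.symm
    · constructor
      all_goals
        intro _ x hx
        have := hb _ x hx
        omega

/-- for every Le-complete polyomino there is a bijection between
X-diagrams and Le-diagrams preserving the set of zero-rows and of zero-columns;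
in particular the two families are equinumerous. -/
theorem stmt17 (S : Finset (ℕ × ℕ)) (hS : IsPolyomino S) (hLe : LeComplete S) :
    (∃ Φ : {T : ℕ × ℕ → Bool // IsXDiagram S T} ≃
           {T : ℕ × ℕ → Bool // IsLeDiagram S T},
      ∀ T : {T : ℕ × ℕ → Bool // IsXDiagram S T},
        (∀ i, ZeroRow S T.1 i ↔ ZeroRow S (Φ T).1 i) ∧
        (∀ j, ZeroCol S T.1 j ↔ ZeroCol S (Φ T).1 j)) ∧
    {T : ℕ × ℕ → Bool | IsXDiagram S T}.ncard
      = {T : ℕ × ℕ → Bool | IsLeDiagram S T}.ncard := by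
  refine ⟨main_equiv S hLe, ?_⟩
  obtain ⟨Φ, -⟩ := main_equiv S hLe
  exact Nat.card_congr Φ
end

section
/- For every Le-complete polyomino S there exists a bijection Φ₂ from the set of X-diagrams of shape S onto the set of Le-diagrams of shape S such that for every X-diagram T, the diagrams T and Φ₂(T) have the same set of zero-columns and the same set of restricted rows. -/
/-- No column of the shape is a zero-column. -/
def NoZeroCol (S : Finset (ℕ × ℕ)) (T : ℕ × ℕ → Bool) : Prop :=
  ∀ j, (∃ i, (i, j) ∈ S) → ¬ ZeroCol S T j

/-- Row `i` is restricted: it contains a 0 having a 1 above it in the same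
column. -/
def RestrictedRow (S : Finset (ℕ × ℕ)) (T : ℕ × ℕ → Bool) (i : ℕ) : Prop :=
  ∃ j, (i, j) ∈ S ∧ T (i, j) = false ∧ ∃ i', i' < i ∧ (i', j) ∈ S ∧ T (i', j) = true

namespace XLe
open Finset

abbrev D := Finset (ℕ × ℕ)

def Xd (S T : D) : Prop := ∀ a b k l, (a,k) ∈ S → (a,l) ∈ S → (b,k) ∈ S → (b,l) ∈ S →
  (a,k) ∈ T → (b,l) ∈ T → (a,l) ∉ T → (b,k) ∉ T → False
def Led (S T : D) : Prop := ∀ a b k l, a < b → k < l → (a,l) ∈ S → (b,k) ∈ S → (b,l) ∈ S →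
  (a,l) ∈ T → (b,k) ∈ T → (b,l) ∈ T
def zc (T : D) (j : ℕ) : Prop := ∀ i, (i,j) ∉ T
def rr (S T : D) (i : ℕ) : Prop := ∃ j a, (i,j) ∈ S ∧ (i,j) ∉ T ∧ a < i ∧ (a,j) ∈ T
def LeC (S : D) : Prop :=
  ∀ i j k l : ℕ, i < j → k < l → (j, k) ∈ S → (j, l) ∈ S → (i, l) ∈ S → (i, k) ∈ S

open Classical in
noncomputable def fam (P : D → D → Prop) (S : D) (z r : ℕ → Prop) : Finset D :=
  S.powerset.filter (fun T => P S T ∧ (∀ j, zc T j ↔ z j) ∧ ∀ i, rr S T i ↔ r i)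

theorem mem_fam {P : D → D → Prop} {S : D} {z r : ℕ → Prop} {T : D} :
    T ∈ fam P S z r ↔ T ⊆ S ∧ P S T ∧ (∀ j, zc T j ↔ z j) ∧ ∀ i, rr S T i ↔ r i := by
  simp [fam]

/-- the corner -/
structure Cor (S : D) (i j : ℕ) : Prop where
  le : LeC S
  mem : (i,j) ∈ S
  row : ∀ a k, (a,k) ∈ S → a ≤ i
  col : ∀ k, (i,k) ∈ S → k ≤ j

theorem Cor.rect {S : D} {i j : ℕ} (h : Cor S i j) {a k : ℕ} (ha : (a,j) ∈ S) (hk : (i,k) ∈ S) :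
    (a,k) ∈ S := by
  rcases eq_or_ne a i with rfl | h1
  · exact hk
  rcases eq_or_ne k j with rfl | h2
  · exact ha
  have := h.row a j ha
  have := h.col k hk
  exact h.le a i k j (by omega) (by omega) hk h.mem ha

theorem exists_cor {S : D} (h : LeC S) (hne : S.Nonempty) : ∃ i j, Cor S i j := by
  obtain ⟨p, hp, hm⟩ := S.exists_max_image (fun p => p.1) hne
  obtain ⟨q, hq, hm2⟩ := (S.filter (fun q => q.1 = p.1)).exists_max_image (fun p => p.2) ⟨p, by simp [hp]⟩
  simp only [mem_filter] at hq hm2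
  refine ⟨q.1, q.2, h, hq.1, ?_, ?_⟩
  · intro a k hk
    rw [hq.2]; exact hm _ hk
  · intro k hk
    exact hm2 (q.1, k) ⟨hk, hq.2⟩

/-- removed column -/
theorem fam_col_X {S : D} {i j : ℕ} (h : Cor S i j) (z r : ℕ → Prop) (hz : z j) :
    fam Xd S z r = fam Xd (S.filter (·.2 ≠ j)) z r := by
  ext T
  simp only [mem_fam]
  constructor
  · rintro ⟨h1, h2, h3, h4⟩
    have hj := (h3 j).2 hz
    refine ⟨?_, ?_, h3, ?_⟩
    · rintro ⟨a, k⟩ hp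
      have := h1 hp
      have := hj a
      grind
    · intro a b k l; simp only [mem_filter]; intros; grind [Xd]
    · intro i; rw [← h4 i]
      unfold rr; simp only [mem_filter]
      unfold zc at hj
      grind
  · rintro ⟨h1, h2, h3, h4⟩
    have hj := (h3 j).2 hz
    refine ⟨h1.trans (filter_subset _ _), ?_, h3, ?_⟩
    · intro a b k l; simp only [Xd, mem_filter] at h2; unfold zc at hj; intros
      apply h2 a b k l <;> grind
    · intro i; rw [← h4 i]
      unfold rr; simp only [mem_filter]
      unfold zc at hj
      grind

theorem fam_col_L {S : D} {i j : ℕ} (h : Cor S i j) (z r : ℕ → Prop) (hz : z j) :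
    fam Led S z r = fam Led (S.filter (·.2 ≠ j)) z r := by
  ext T
  simp only [mem_fam]
  constructor
  · rintro ⟨h1, h2, h3, h4⟩
    have hj := (h3 j).2 hz
    refine ⟨?_, ?_, h3, ?_⟩
    · rintro ⟨a, k⟩ hp
      have := h1 hp
      have := hj a
      grind
    · intro a b k l; simp only [mem_filter]; intros; grind [Led]
    · intro i; rw [← h4 i]
      unfold rr; simp only [mem_filter]
      unfold zc at hj
      grind
  · rintro ⟨h1, h2, h3, h4⟩
    have hj := (h3 j).2 hz
    refine ⟨h1.trans (filter_subset _ _), ?_, h3, ?_⟩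
    · intro a b k l; simp only [Led, mem_filter] at h2; unfold zc at hj; intros
      apply h2 a b k l <;> grind
    · intro i; rw [← h4 i]
      unfold rr; simp only [mem_filter]
      unfold zc at hj
      grind

open Classical in
/-- diagrams on `S` minus the corner, zero columns prescribed except for `j`. -/
theorem split12 (P : D → D → Prop) (S : D) (j : ℕ) (z r : ℕ → Prop) (hz : ¬ z j) :
    (S.powerset.filter (fun T => P S T ∧ (∀ l, l ≠ j → (zc T l ↔ z l)) ∧ ∀ i, rr S T i ↔ r i)).card
      = (fam P S z r).card + (fam P S (fun l => z l ∨ l = j) r).card := by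
  rw [← card_union_of_disjoint]
  · congr 1
    ext T
    simp only [mem_union, mem_fam, mem_filter, mem_powerset]
    by_cases hT : zc T j
    · constructor
      · rintro ⟨h1, h2, h3, h4⟩
        right
        refine ⟨h1, h2, ?_, h4⟩
        intro l; by_cases hl : l = j
        · subst hl; simp [hT]
        · simp [hl, h3]
      · rintro (⟨h1, h2, h3, h4⟩ | ⟨h1, h2, h3, h4⟩)
        · exact absurd ((h3 j).1 hT) hz
        · exact ⟨h1, h2, fun l hl => by simp [h3, hl], h4⟩
    · constructor
      · rintro ⟨h1, h2, h3, h4⟩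
        left
        refine ⟨h1, h2, ?_, h4⟩
        intro l; by_cases hl : l = j
        · subst hl; simp [hT, hz]
        · simp [hl, h3]
      · rintro (⟨h1, h2, h3, h4⟩ | ⟨h1, h2, h3, h4⟩)
        · exact ⟨h1, h2, fun l hl => h3 l, h4⟩
        · exact absurd ((h3 j).2 (Or.inr rfl)) hT
  · rw [Finset.disjoint_left]
    intro T h1 h2
    rw [mem_fam] at h1 h2
    exact hz ((h1.2.2.1 j).1 ((h2.2.2.1 j).2 (Or.inr rfl)))

theorem rr_insert {S : D} {i j : ℕ} (h : Cor S i j) {T : D} (hT : T ⊆ S.erase (i,j)) (b : ℕ) :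
    rr S (insert (i,j) T) b ↔ rr (S.erase (i,j)) T b := by
  have := h.row
  simp only [rr, mem_erase, mem_insert]
  constructor
  · rintro ⟨k, a, h1, h2, h3, h4⟩
    refine ⟨k, a, ?_⟩
    have := this _ _ h1
    grind
  · rintro ⟨k, a, h1, h2, h3, h4⟩
    refine ⟨k, a, ?_⟩
    grind

theorem rr_erase {S : D} {i j : ℕ} (h : Cor S i j) {T : D} (b : ℕ) (hb : b ≠ i) :
    rr S T b ↔ rr (S.erase (i,j)) T b := by
  simp only [rr, mem_erase]
  grind

theorem rr_cor {S : D} {i j : ℕ} (h : Cor S i j) {T : D} (hT : T ⊆ S) (hc : (i,j) ∉ T)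
    (hz : ¬ zc T j) : rr S T i := by
  simp only [zc, not_forall, not_not] at hz
  obtain ⟨a, ha⟩ := hz
  have := h.row a j (hT ha)
  refine ⟨j, a, h.mem, hc, ?_, ha⟩
  grind

open Classical in
/-- diagrams with the corner filled. -/
theorem card1 (P : D → D → Prop) {S : D} {i j : ℕ} (h : Cor S i j) (z r : ℕ → Prop) (hz : ¬ z j)
    (hP : ∀ T ⊆ S.erase (i,j), P S (insert (i,j) T) → P (S.erase (i,j)) T) :
    ((fam P S z r).filter (fun T => (i,j) ∈ T)).card =
    (((S.erase (i,j)).powerset.filter (fun T => P (S.erase (i,j)) T ∧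
      (∀ l, l ≠ j → (zc T l ↔ z l)) ∧ ∀ b, rr (S.erase (i,j)) T b ↔ r b)).filter
      (fun T => P S (insert (i,j) T))).card := by
  apply card_nbij' (fun T => T.erase (i,j)) (fun T => insert (i,j) T)
  · intro T hT
    simp only [coe_filter, Set.mem_ofPred_eq, mem_fam, mem_filter, mem_powerset] at hT ⊢
    obtain ⟨⟨h1, h2, h3, h4⟩, h5⟩ := hT
    have e : insert (i,j) (T.erase (i,j)) = T := insert_erase h5
    have hs : T.erase (i,j) ⊆ S.erase (i,j) := erase_subset_erase _ h1
    refine ⟨⟨hs, hP _ hs (by rwa [e]), ?_, ?_⟩, by rwa [e]⟩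
    · intro l hl; rw [← h3 l]; simp [zc, hl]
    · intro b; rw [← rr_insert h hs, e, h4]
  · intro T hT
    simp only [coe_filter, Set.mem_ofPred_eq, mem_fam, mem_filter, mem_powerset] at hT ⊢
    obtain ⟨⟨h1, h2, h3, h4⟩, h5⟩ := hT
    refine ⟨⟨?_, h5, ?_, ?_⟩, mem_insert_self _ _⟩
    · exact insert_subset h.mem (h1.trans (erase_subset _ _))
    · intro l
      by_cases hl : l = j
      · subst hl
        simp only [hz, iff_false]
        exact fun hh => hh i (mem_insert_self _ _)
      · rw [← h3 l hl]; simp [zc, hl]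
    · intro b; rw [rr_insert h h1, h4]
  · intro T hT
    simp only [coe_filter, Set.mem_ofPred_eq] at hT
    exact insert_erase hT.2
  · intro T hT
    simp only [coe_filter, Set.mem_ofPred_eq, mem_filter, mem_powerset] at hT
    apply erase_insert
    intro hh; simpa using hT.1.1 hh

theorem Led_insert {S : D} {i j : ℕ} (h : Cor S i j) {T : D} (hT : T ⊆ S.erase (i,j)) :
    Led S (insert (i,j) T) ↔ Led (S.erase (i,j)) T := by
  have h1 := h.row
  have h2 := h.col
  simp only [Led, mem_erase, mem_insert]
  constructor
  · intro H a b k l hab hkl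
    have := H a b k l hab hkl
    have := h1 b l
    have := h2 l
    grind
  · intro H a b k l hab hkl g1 g2 g3 g4 g5
    have := H a b k l hab hkl
    have := h1 b l g3
    have := h2 l
    have := h2 k
    grind

open Classical in
theorem rec_L {S : D} {i j : ℕ} (h : Cor S i j) (z r : ℕ → Prop) (hz : ¬ z j) :
    (fam Led S z r).card = (fam Led (S.erase (i,j)) z r).card
      + (fam Led (S.erase (i,j)) (fun l => z l ∨ l = j) r).card
      + if r i then (fam Led (S.filter (·.1 ≠ i)) z (fun b => r b ∧ b ≠ i)).card else 0 := by
  rw [← split12 _ _ _ _ _ hz, ← card_filter_add_card_filter_not (fun T => (i,j) ∈ T),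
    card1 Led h z r hz (fun T hT => (Led_insert h hT).1)]
  congr 1
  · congr 1
    apply filter_true_of_mem
    intro T hT
    simp only [mem_filter, mem_powerset] at hT
    exact (Led_insert h hT.1).2 hT.2.1
  · split_ifs with hr
    · congr 1
      ext T
      simp only [mem_filter, mem_fam]
      constructor
      · rintro ⟨⟨h1, h2, h3, h4⟩, h5⟩
        obtain ⟨a, ha⟩ : ∃ a, (a,j) ∈ T := by
          by_contra hh; push Not at hh; exact hz ((h3 j).1 hh)
        have hai := h.row a j (h1 ha)
        have hne : a ≠ i := by rintro rfl; exact h5 ha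
        have hrow : ∀ k, (i,k) ∉ T := by
          intro k hk
          have := h.col k (h1 hk)
          have : k ≠ j := by rintro rfl; exact h5 hk
          exact h5 (h2 a i k j (by omega) (by omega) (h1 ha) (h1 hk) h.mem ha hk)
        refine ⟨?_, ?_, h3, ?_⟩
        · rintro ⟨b, k⟩ hp
          have := h1 hp
          have := hrow k
          grind
        · intro a b k l; simp only [mem_filter]; intros; grind [Led]
        · intro b; rw [← h4 b]
          unfold rr; simp only [mem_filter]
          grind
      · rintro ⟨h1, h2, h3, h4⟩
        have hrow : ∀ k, (i,k) ∉ T := by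
          intro k hk; simpa using h1 hk
        have hs := h1.trans (filter_subset _ _)
        refine ⟨⟨hs, ?_, h3, ?_⟩, hrow j⟩
        · intro a b k l hab _ h1 _ _ _ _
          have := h.row b l
          have := h2 a b k l
          grind
        · intro b
          by_cases hb : b = i
          · subst hb
            simp only [hr, iff_true]
            exact rr_cor h hs (hrow j) (by rwa [h3])
          · have := h4 b
            simp only [hb, ne_eq, not_false_eq_true, and_true] at this
            rw [← this]
            unfold rr; simp only [mem_filter]
            grind
    · rw [card_eq_zero, filter_eq_empty_iff]
      intro T hT hc
      rw [mem_fam] at hT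
      exact hr ((hT.2.2.2 i).1 (rr_cor h hT.1 hc (by rwa [hT.2.2.1])))


def A1 (S : D) (i j : ℕ) (T : D) : Prop := ∀ a k, (i,k) ∈ S → (a,j) ∈ S → (a,k) ∈ T → (i,k) ∉ T →
  a ≠ i → k ≠ j → (a,j) ∈ T
def A0 (S : D) (i j : ℕ) (T : D) : Prop := ∀ a k, (a,j) ∈ T → (i,k) ∈ T → (a,k) ∈ T
def Full (S : D) (i j : ℕ) (T : D) : Prop := ∀ k, k ≠ j → (i,k) ∈ S →
  ((i,k) ∈ T ↔ ∀ a, (a,j) ∈ T → (a,k) ∈ T)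

theorem Xd_mono {S S' T : D} (h : S' ⊆ S) (hX : Xd S T) : Xd S' T :=
  fun a b k l h1 h2 h3 h4 => hX a b k l (h h1) (h h2) (h h3) (h h4)

theorem Xd_insert_of {S : D} {i j : ℕ} {T : D} (hX : Xd S (insert (i,j) T)) :
    Xd (S.erase (i,j)) T := by
  intro a b k l h1 h2 h3 h4 h5 h6 h7 h8
  have := hX a b k l
  simp only [mem_erase, mem_insert] at *
  grind

theorem X1 {S : D} {i j : ℕ} (h : Cor S i j) {T : D} (hT : T ⊆ S.erase (i,j))
    (hX : Xd (S.erase (i,j)) T) : Xd S (insert (i,j) T) ↔ A1 S i j T := by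
  have hS : ∀ a k, (a,k) ∈ T → (a,k) ∈ S := fun a k hk => (mem_erase.1 (hT hk)).2
  constructor
  · intro H a k h1 h2 h3 h4 h5 h6
    by_contra h7
    have := H a i k j (hS _ _ h3) h2 h1 h.mem
    simp only [mem_insert] at this
    grind
  · intro H a b k l h1 h2 h3 h4 h5 h6 h7 h8
    have q1 := hX a b k l
    have q2 := H b l
    have q3 := H a k
    have q4 := H a l
    have q5 := H b k
    simp only [mem_erase, mem_insert] at *
    by_cases e1 : (a,k) = (i,j)
    · obtain ⟨rfl, rfl⟩ := Prod.mk.inj e1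
      grind
    by_cases e2 : (b,l) = (i,j)
    · obtain ⟨rfl, rfl⟩ := Prod.mk.inj e2
      grind
    grind

theorem X0 {S : D} {i j : ℕ} (h : Cor S i j) {T : D} (hT : T ⊆ S.erase (i,j)) :
    Xd S T ↔ Xd (S.erase (i,j)) T ∧ A0 S i j T := by
  have hS : ∀ a k, (a,k) ∈ T → (a,k) ∈ S := fun a k hk => (mem_erase.1 (hT hk)).2
  have hc : (i,j) ∉ T := fun hh => by simpa using hT hh
  constructor
  · intro H
    refine ⟨Xd_mono (erase_subset _ _) H, ?_⟩
    intro a k h1 h2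
    by_contra h3
    exact H a i j k (hS _ _ h1) (h.rect (hS _ _ h1) (hS _ _ h2)) h.mem (hS _ _ h2) h1 h2 h3 hc
  · rintro ⟨hX, H⟩ a b k l h1 h2 h3 h4 h5 h6 h7 h8
    have q1 := hX a b k l
    have q2 := H b k
    have q3 := H a l
    simp only [mem_erase] at *
    by_cases e1 : (a,l) = (i,j)
    · obtain ⟨rfl, rfl⟩ := Prod.mk.inj e1
      grind
    by_cases e2 : (b,k) = (i,j)
    · obtain ⟨rfl, rfl⟩ := Prod.mk.inj e2
      grind
    grind

/-- at least one of the two values is allowed in the corner. -/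
theorem A0_of_not_A1 {S : D} {i j : ℕ} (h : Cor S i j) {T : D} (hT : T ⊆ S.erase (i,j))
    (hX : Xd (S.erase (i,j)) T) (h1 : ¬ A1 S i j T) : A0 S i j T := by
  have hS : ∀ a k, (a,k) ∈ T → (a,k) ∈ S := fun a k hk => (mem_erase.1 (hT hk)).2
  have hc : (i,j) ∉ T := fun hh => by simpa using hT hh
  simp only [A1, not_forall] at h1
  obtain ⟨a, k, h1, h2, h3, h4, h5, h6, h7⟩ := h1
  intro b l g1 g2
  by_contra g3
  have hl : l ≠ j := by rintro rfl; exact hc g2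
  have hb : b ≠ i := by rintro rfl; exact hc g1
  have r1 := h.rect h2 (hS _ _ g2)
  have q1 := hX a i k l
  have q2 := hX a b l j
  have := hS _ _ g1
  have := h.rect (hS _ _ g1) (hS _ _ g2)
  simp only [mem_erase] at q1 q2
  grind

theorem rr_of_not_A1 {S : D} {i j : ℕ} (h : Cor S i j) {T : D} (hT : T ⊆ S.erase (i,j))
    (h1 : ¬ A1 S i j T) : rr (S.erase (i,j)) T i := by
  simp only [A1, not_forall] at h1
  obtain ⟨a, k, h1, h2, h3, h4, h5, h6, h7⟩ := h1
  have := h.row _ _ h2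
  exact ⟨k, a, by simp [h1, h6], h4, by omega, h3⟩

open Classical in
noncomputable def L0 (S : D) (i j : ℕ) (z r : ℕ → Prop) : Finset D :=
  (fam Xd S z r).filter (fun T => (i,j) ∉ T)

theorem mem_L0 {S : D} {i j : ℕ} (h : Cor S i j) {z r : ℕ → Prop} (hz : ¬ z j) (hr : r i) {T : D} :
    T ∈ L0 S i j z r ↔ T ⊆ S.erase (i,j) ∧ Xd (S.erase (i,j)) T ∧ A0 S i j T ∧
      (∀ l, zc T l ↔ z l) ∧ ∀ b, b ≠ i → (rr (S.erase (i,j)) T b ↔ r b) := by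
  simp only [L0, mem_filter, mem_fam]
  constructor
  · rintro ⟨⟨h1, h2, h3, h4⟩, h5⟩
    have hT : T ⊆ S.erase (i,j) := subset_erase.2 ⟨h1, h5⟩
    have := (X0 h hT).1 h2
    refine ⟨hT, this.1, this.2, h3, fun b hb => by rw [← rr_erase h b hb, h4]⟩
  · rintro ⟨h1, h2, h3, h4, h5⟩
    have hc : (i,j) ∉ T := fun hh => by simpa using h1 hh
    have hs := h1.trans (erase_subset _ _)
    refine ⟨⟨hs, (X0 h h1).2 ⟨h2, h3⟩, h4, ?_⟩, hc⟩
    intro b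
    by_cases hb : b = i
    · subst hb
      simp only [hr, iff_true]
      exact rr_cor h hs hc (by rwa [h4])
    · rw [rr_erase h b hb, h5 b hb]

open Classical in
theorem E3 {S : D} {i j : ℕ} (h : Cor S i j) {z r : ℕ → Prop} (hz : ¬ z j) (hr : r i) :
    (((L0 S i j z r).filter (A1 S i j)).filter (Full S i j)).card =
      (fam Xd (S.filter (·.1 ≠ i)) z (fun b => r b ∧ b ≠ i)).card := by
  apply card_nbij' (fun T => T.filter (·.1 ≠ i))
    (fun T => T ∪ (S.erase (i,j)).filter (fun p => p.1 = i ∧ ∀ a, (a,j) ∈ T → (a,p.2) ∈ T))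
  · intro T hT
    simp only [mem_coe, mem_filter, mem_L0 h hz hr] at hT
    obtain ⟨⟨⟨h1, h2, h3, h4, h5⟩, h6⟩, h7⟩ := hT
    have hc : (i,j) ∉ T := fun hh => by simpa using h1 hh
    simp only [mem_coe, mem_fam]
    refine ⟨?_, ?_, ?_, ?_⟩
    · intro p hp
      have := h1 (mem_of_mem_filter _ hp)
      grind
    · intro a b k l
      have := h2 a b k l
      simp only [mem_filter, mem_erase] at this ⊢
      grind
    · intro l
      rw [← h4]
      obtain ⟨a, ha⟩ : ∃ a, (a,j) ∈ T := by
        by_contra hh; push Not at hh; exact hz ((h4 j).1 hh)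
      have hai : a ≠ i := by rintro rfl; exact hc ha
      constructor
      · intro hl b hb
        have h8 := hl b
        have h9 := hl a
        simp only [mem_filter] at h8 h9
        have : b = i := by grind
        subst this
        have := h3 a l ha hb
        grind
      · intro hl b hb
        exact hl b (mem_of_mem_filter _ hb)
    · intro b
      by_cases hb : b = i
      · subst hb; simp [rr]
      · simp only [ne_eq, hb, not_false_eq_true, and_true]
        rw [← h5 b hb]
        have := h.row b
        simp only [rr, mem_filter, mem_erase]
        constructor
        · rintro ⟨k, a, q⟩; refine ⟨k, a, ?_⟩; grind
        · rintro ⟨k, a, q⟩; refine ⟨k, a, ?_⟩; grind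
  · intro T hT
    simp only [mem_coe, mem_fam] at hT
    obtain ⟨h1, h2, h3, h4⟩ := hT
    have hS : ∀ a k, (a,k) ∈ T → (a,k) ∈ S ∧ a ≠ i := fun a k hk => by simpa using h1 hk
    obtain ⟨a0, ha0⟩ : ∃ a, (a,j) ∈ T := by
      by_contra hh; push Not at hh; exact hz ((h3 j).1 hh)
    simp only [mem_coe, mem_filter, mem_L0 h hz hr]
    set U := T ∪ (S.erase (i,j)).filter (fun p => p.1 = i ∧ ∀ a, (a,j) ∈ T → (a,p.2) ∈ T) with hU
    have U1 : ∀ a k, a ≠ i → ((a,k) ∈ U ↔ (a,k) ∈ T) := by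
      intro a k hak; simp [hU, hak]
    have U2 : ∀ k, (i,k) ∈ U ↔ k ≠ j ∧ (i,k) ∈ S ∧ ∀ a, (a,j) ∈ T → (a,k) ∈ T := by
      intro k
      have : (i,k) ∉ T := fun hh => (hS _ _ hh).2 rfl
      simp [hU, this, and_assoc]
    have U3 : ∀ a, (a,j) ∈ U ↔ (a,j) ∈ T := by
      intro a
      by_cases hb : a = i
      · subst hb
        simp only [U2]
        have := hS a j
        grind
      · exact U1 a j hb
    clear_value U
    clear hU
    have key : ∀ b k l, b ≠ i → (i,k) ∈ U → (i,l) ∈ S → l ≠ j → (i,l) ∉ U → (b,k) ∈ S →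
        (b,l) ∈ T → (b,k) ∈ T := by
      intro b k l hb g1 g2 g3 g4 g5 g6
      by_contra g7
      rw [U2] at g1 g4
      simp only [g3, g2, ne_eq, not_false_eq_true, true_and, not_forall] at g4
      obtain ⟨a, ha, ha2⟩ := g4
      have := hS _ _ ha
      have r1 := h.rect this.1 g2
      have := h2 a b k l
      simp only [mem_filter] at this
      grind
    refine ⟨⟨⟨?_, ?_, ?_, ?_, ?_⟩, ?_⟩, ?_⟩
    · rintro ⟨a, k⟩ hp
      by_cases hb : a = i
      · subst hb; rw [U2] at hp; simp [hp.1, hp.2.1]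
      · rw [U1 a k hb] at hp
        have := hS _ _ hp
        simp [this.1, hb]
    · intro a b k l g1 g2 g3 g4 g5 g6 g7 g8
      simp only [mem_erase] at g1 g2 g3 g4
      by_cases hb : a = i
      · subst hb
        by_cases hb2 : b = a
        · subst hb2; exact g8 g5
        rw [U1 _ _ hb2] at g6 g8
        exact g8 (key b k l hb2 g5 g2.2 (by grind) g7 g3.2 g6)
      · by_cases hb2 : b = i
        · subst hb2
          rw [U1 _ _ hb] at g5 g7
          exact g7 (key a l k hb g6 g3.2 (by grind) g8 g2.2 g5)
        · rw [U1 _ _ hb] at g5 g7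
          rw [U1 _ _ hb2] at g6 g8
          exact h2 a b k l (by simp [g1, hb]) (by simp [g2, hb]) (by simp [g3, hb2])
            (by simp [g4, hb2]) g5 g6 g7 g8
    · intro a k g1 g2
      rw [U3] at g1
      rw [U2] at g2
      have := hS _ _ g1
      rw [U1 _ _ this.2]
      exact g2.2.2 a g1
    · intro l
      rw [← h3]
      constructor
      · intro hl b hb
        have := hS _ _ hb
        exact hl b (by rwa [U1 _ _ this.2])
      · intro hl b hb
        by_cases hbi : b = i
        · subst hbi
          rw [U2] at hb
          exact hl a0 (hb.2.2 _ ha0)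
        · rw [U1 _ _ hbi] at hb
          exact hl b hb
    · intro b hb
      have h4 := h4 b
      simp only [ne_eq, hb, not_false_eq_true, and_true] at h4
      rw [← h4]
      have := h.row b
      simp only [rr, mem_filter, mem_erase]
      constructor
      · rintro ⟨k, a, q⟩; refine ⟨k, a, ?_⟩
        have := U1 a k; have := U1 b k
        grind
      · rintro ⟨k, a, q⟩; refine ⟨k, a, ?_⟩
        have := U1 a k; have := U1 b k
        grind
    · intro a k g1 g2 g3 g4 g5 g6
      rw [U1 _ _ g5] at g3
      rw [U1 _ _ g5]
      rw [U2] at g4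
      simp only [g6, g1, ne_eq, not_false_eq_true, true_and, not_forall] at g4
      obtain ⟨b, hb, hb2⟩ := g4
      by_contra g7
      have := hS _ _ hb
      have := hS _ _ g3
      have r1 := h.rect g2 g1
      have := h2 a b k j
      have := h.rect (hS _ _ hb).1 g1
      simp only [mem_filter] at *
      grind
    · intro k hk g1
      rw [U2]
      simp only [U3, hk, g1, ne_eq, not_false_eq_true, true_and]
      constructor
      · intro H a ha
        rw [U1 _ _ (hS _ _ ha).2]; exact H a ha
      · intro H a ha
        rw [← U1 _ _ (hS _ _ ha).2]; exact H a ha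
  · intro T hT
    simp only [mem_coe, mem_filter, mem_L0 h hz hr] at hT
    obtain ⟨⟨⟨h1, h2, h3, h4, h5⟩, h6⟩, h7⟩ := hT
    have hc : (i,j) ∉ T := fun hh => by simpa using h1 hh
    have hci : ∀ a, (a,j) ∈ T → a ≠ i := by rintro a ha rfl; exact hc ha
    ext ⟨a, k⟩
    simp only [mem_union, mem_filter]
    by_cases hb : a = i
    · subst hb
      by_cases hk : k = j
      · subst hk; simp [hc]
      · simp only [ne_eq, not_true_eq_false, and_false, false_or, mem_erase, true_and]
        constructor
        · rintro ⟨⟨g1, g2⟩, g3⟩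
          rw [h7 k hk g2]
          intro b hb
          exact (g3 b ⟨hb, hci b hb⟩).1
        · intro g1
          have := mem_erase.1 (h1 g1)
          refine ⟨this, ?_⟩
          rintro b ⟨hb, hb2⟩
          exact ⟨(h7 k hk this.2).1 g1 b hb, hb2⟩
    · simp [hb]
  · intro T hT
    simp only [mem_coe, mem_fam] at hT
    obtain ⟨h1, h2, h3, h4⟩ := hT
    have hS : ∀ a k, (a,k) ∈ T → (a,k) ∈ S ∧ a ≠ i := fun a k hk => by simpa using h1 hk
    ext ⟨a, k⟩
    have := hS a k
    simp only [mem_union, mem_filter]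
    grind

def XB (S : D) (i j : ℕ) (S' T : D) : Prop := Xd S' T ∧ ¬ A1 S i j T

open Classical in
theorem E2 {S : D} {i j : ℕ} (h : Cor S i j) {z r : ℕ → Prop} (hz : ¬ z j) (hr : r i) :
    (L0 S i j z r).filter (fun T => ¬ A1 S i j T) = fam (XB S i j) (S.erase (i,j)) z r := by
  ext T
  simp only [mem_filter, mem_L0 h hz hr, mem_fam, XB]
  constructor
  · rintro ⟨⟨h1, h2, h3, h4, h5⟩, h6⟩
    refine ⟨h1, ⟨h2, h6⟩, h4, ?_⟩
    intro b
    by_cases hb : b = i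
    · subst hb
      simp only [hr, iff_true]
      exact rr_of_not_A1 h h1 h6
    · exact h5 b hb
  · rintro ⟨h1, ⟨h2, h3⟩, h4, h5⟩
    exact ⟨⟨h1, h2, A0_of_not_A1 h h1 h2 h3, h4, fun b _ => h5 b⟩, h3⟩

theorem exists_k1 {S : D} {i j : ℕ} (h : Cor S i j) {T : D} (hT : T ⊆ S.erase (i,j))
    (hX : Xd (S.erase (i,j)) T) (h1 : ¬ A1 S i j T) :
    ∃ k1, k1 ≠ j ∧ (i,k1) ∈ S ∧ (i,k1) ∉ T ∧ (∃ a, (a,j) ∈ S ∧ (a,k1) ∈ T) ∧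
      ∀ a k, k ≠ j → (i,k) ∈ S → (i,k) ∉ T → (a,j) ∈ S → (a,k) ∈ T → (a,k1) ∈ T := by
  classical
  simp only [A1, not_forall] at h1
  obtain ⟨a, k, h1, h2, h3, h4, h5, h6, h7⟩ := h1
  let B := (S.image Prod.snd).filter (fun k => k ≠ j ∧ (i,k) ∈ S ∧ (i,k) ∉ T)
  have hB : ∀ k, k ∈ B ↔ k ≠ j ∧ (i,k) ∈ S ∧ (i,k) ∉ T := by
    intro k
    simp only [B, mem_filter, mem_image]
    constructor
    · exact fun h => h.2
    · exact fun h => ⟨⟨(i,k), h.2.1, rfl⟩, h⟩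
  let f : ℕ → Finset ℕ := fun k => (T.image Prod.fst).filter (fun a => (a,j) ∈ S ∧ (a,k) ∈ T)
  have hf : ∀ k a, a ∈ f k ↔ (a,j) ∈ S ∧ (a,k) ∈ T := by
    intro k a
    simp only [f, mem_filter, mem_image]
    constructor
    · exact fun h => h.2
    · exact fun h => ⟨⟨(a,k), h.2, rfl⟩, h⟩
  obtain ⟨k1, hk1, hm⟩ := B.exists_max_image (fun k => (f k).card) ⟨k, (hB k).2 ⟨h6, h1, h4⟩⟩
  have key : ∀ a k, k ≠ j → (i,k) ∈ S → (i,k) ∉ T → (a,j) ∈ S → (a,k) ∈ T → (a,k1) ∈ T := by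
    intro b l g1 g2 g3 g4 g5
    by_contra g6
    have hlt : (f k1).card < (f l).card := by
      apply card_lt_card
      rw [Finset.ssubset_iff_of_subset]
      · exact ⟨b, (hf _ _).2 ⟨g4, g5⟩, fun hh => g6 ((hf _ _).1 hh).2⟩
      · intro c hc
        rw [hf] at hc ⊢
        refine ⟨hc.1, ?_⟩
        by_contra g7
        have hk := (hB _).1 hk1
        have q1 := h.rect hc.1 g2
        have q2 := h.rect hc.1 hk.2.1
        have q3 := h.rect g4 g2
        have q4 := h.rect g4 hk.2.1
        exact hX b c l k1 (by simp [g1, q3]) (by simp [hk.1, q4]) (by simp [g1, q1])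
          (by simp [hk.1, q2]) g5 hc.2 g6 g7
    have := hm l ((hB l).2 ⟨g1, g2, g3⟩)
    omega
  have hk := (hB _).1 hk1
  exact ⟨k1, hk.1, hk.2.1, hk.2.2, ⟨a, h2, key a k h6 h1 h4 h2 h3⟩, key⟩

open Classical in
theorem E4 {S : D} {i j : ℕ} (h : Cor S i j) {z r : ℕ → Prop} (hz : ¬ z j) (hr : r i) :
    (((L0 S i j z r).filter (A1 S i j)).filter (fun T => ¬ Full S i j T)).card =
      (fam (XB S i j) (S.erase (i,j)) (fun l => z l ∨ l = j) r).card := by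
  have fk : ∀ T, A0 S i j T → ¬ Full S i j T → ∃ k, k ≠ j ∧ (i,k) ∈ S ∧ (i,k) ∉ T ∧
      ∀ a, (a,j) ∈ T → (a,k) ∈ T := by
    intro T h0 hF
    simp only [Full, not_forall] at hF
    obtain ⟨k, hk, g1, g2⟩ := hF
    refine ⟨k, hk, g1, ?_⟩
    have := fun a h1 => h0 a k h1
    grind
  apply card_nbij' (fun T => T.filter (·.2 ≠ j))
    (fun T => T ∪ (S.erase (i,j)).filter (fun p => p.2 = j ∧
      ∃ k, k ≠ j ∧ (i,k) ∈ S ∧ (i,k) ∉ T ∧ (p.1,k) ∈ T))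
  · intro T hT
    simp only [mem_coe, mem_filter, mem_L0 h hz hr] at hT
    obtain ⟨⟨⟨h1, h2, h3, h4, h5⟩, h6⟩, h7⟩ := hT
    have hS : ∀ a k, (a,k) ∈ T → (a,k) ∈ S := fun a k hk => (mem_erase.1 (h1 hk)).2
    have hc : (i,j) ∉ T := fun hh => by simpa using h1 hh
    obtain ⟨k, hk, g1, g2, g3⟩ := fk T h3 h7
    obtain ⟨a0, ha0⟩ : ∃ a, (a,j) ∈ T := by
      by_contra hh; push Not at hh; exact hz ((h4 j).1 hh)
    have hai : a0 ≠ i := by rintro rfl; exact hc ha0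
    simp only [mem_coe, mem_fam, XB]
    have hs : T.filter (·.2 ≠ j) ⊆ S.erase (i,j) := (filter_subset _ _).trans h1
    have nA : ¬ A1 S i j (T.filter (·.2 ≠ j)) := by
      intro H
      have := H a0 k g1 (hS _ _ ha0) (by simp [hk, g3 a0 ha0]) (by simp [g2]) hai hk
      simp at this
    refine ⟨hs, ⟨?_, nA⟩, ?_, ?_⟩
    · intro a b k l
      have := h2 a b k l
      simp only [mem_filter, mem_erase] at this ⊢
      grind
    · intro l
      rw [← h4]
      by_cases hl : l = j
      · subst hl; simp [zc]
      · simp [zc, hl]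
    · intro b
      by_cases hb : b = i
      · subst hb
        simp only [hr, iff_true]
        exact rr_of_not_A1 h hs nA
      · rw [← h5 b hb]
        simp only [rr, mem_filter, mem_erase]
        constructor
        · rintro ⟨l, a, q⟩; refine ⟨l, a, ?_⟩; grind
        · rintro ⟨l, a, q1, q2, q3, q4⟩
          by_cases hl : l = j
          · subst hl
            refine ⟨k, a, ⟨by grind, h.rect q1.2 g1⟩, ?_, q3, g3 a q4, hk⟩
            rintro ⟨q5, -⟩
            exact q2 (h6 b k g1 q1.2 q5 g2 hb hk)
          · refine ⟨l, a, ?_⟩; grind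
  · intro T hT
    simp only [mem_coe, mem_fam, XB] at hT
    obtain ⟨h1, ⟨h2, h3⟩, h4, h5⟩ := hT
    have hS : ∀ a k, (a,k) ∈ T → (a,k) ∈ S := fun a k hk => (mem_erase.1 (h1 hk)).2
    have hj : ∀ a, (a,j) ∉ T := (h4 j).2 (Or.inr rfl)
    obtain ⟨k1, c1, c2, c3, ⟨a0, ha0, ha1⟩, c4⟩ := exists_k1 h h1 h2 h3
    simp only [mem_coe, mem_filter, mem_L0 h hz hr]
    set U := T ∪ (S.erase (i,j)).filter (fun p => p.2 = j ∧
      ∃ k, k ≠ j ∧ (i,k) ∈ S ∧ (i,k) ∉ T ∧ (p.1,k) ∈ T) with hU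
    have U1 : ∀ a k, k ≠ j → ((a,k) ∈ U ↔ (a,k) ∈ T) := by
      intro a k hak; simp [hU, hak]
    have U2 : ∀ a, (a,j) ∈ U ↔ (a,j) ∈ S ∧ (a,k1) ∈ T := by
      intro a
      have := hj a
      simp only [hU, mem_union, this, mem_filter, mem_erase, false_or, true_and]
      constructor
      · rintro ⟨q1, k, q2, q3, q4, q5⟩
        exact ⟨q1.2, c4 a k q2 q3 q4 q1.2 q5⟩
      · rintro ⟨q1, q2⟩
        exact ⟨⟨by grind, q1⟩, k1, c1, c2, c3, q2⟩
    clear_value U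
    clear hU
    have hij : (i,j) ∉ U := by rw [U2]; exact fun hh => c3 hh.2
    refine ⟨⟨⟨?_, ?_, ?_, ?_, ?_⟩, ?_⟩, ?_⟩
    · rintro ⟨a, k⟩ hp
      refine mem_erase.2 ⟨by rintro hh; rw [hh] at hp; exact hij hp, ?_⟩
      by_cases hk : k = j
      · subst hk; exact ((U2 a).1 hp).1
      · exact hS _ _ ((U1 a k hk).1 hp)
    · have sub : ∀ l, ∃ m, ∀ a, (a,l) ∈ S.erase (i,j) → (a,m) ∈ S.erase (i,j) ∧
          ((a,l) ∈ U ↔ (a,m) ∈ T) := by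
        intro l
        by_cases hl : l = j
        · subst hl
          refine ⟨k1, fun a ha => ?_⟩
          rw [mem_erase] at ha ⊢
          refine ⟨⟨by grind, h.rect ha.2 c2⟩, ?_⟩
          rw [U2]; simp [ha.2]
        · exact ⟨l, fun a ha => ⟨ha, U1 a l hl⟩⟩
      intro a b k l g1 g2 g3 g4 g5 g6 g7 g8
      obtain ⟨m, hm⟩ := sub k
      obtain ⟨n, hn⟩ := sub l
      exact h2 a b m n (hm a g1).1 (hn a g2).1 (hm b g3).1 (hn b g4).1 ((hm a g1).2.1 g5)
        ((hn b g4).2.1 g6) (fun hh => g7 ((hn a g2).2.2 hh)) (fun hh => g8 ((hm b g3).2.2 hh))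
    · intro a k g1 g2
      have hk : k ≠ j := by rintro rfl; exact hij g2
      rw [U1 _ _ hk] at g2 ⊢
      rw [U2] at g1
      by_contra g3
      have r1 := h.rect g1.1 (hS _ _ g2)
      have r2 := h.rect g1.1 c2
      exact h2 a i k1 k (by simp [c1, r2]) (by simp [hk, r1]) (by simp [c1, c2])
        (by simp [hk, hS _ _ g2]) g1.2 g2 g3 c3
    · intro l
      by_cases hl : l = j
      · subst hl
        simp only [hz, iff_false]
        exact fun hh => hh a0 ((U2 a0).2 ⟨ha0, ha1⟩)
      · have := h4 l
        simp only [hl, or_false] at this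
        rw [← this]
        simp [zc, U1 _ _ hl]
    · intro b hb
      rw [← h5 b]
      simp only [rr, mem_erase]
      constructor
      · rintro ⟨l, a, q1, q2, q3, q4⟩
        by_cases hl : l = j
        · subst hl
          rw [U2] at q2 q4
          exact ⟨k1, a, ⟨by grind, h.rect q1.2 c2⟩, fun hh => q2 ⟨q1.2, hh⟩, q3, q4.2⟩
        · rw [U1 _ _ hl] at q2 q4
          exact ⟨l, a, q1, q2, q3, q4⟩
      · rintro ⟨l, a, q1, q2, q3, q4⟩
        have hl : l ≠ j := by rintro rfl; exact hj _ q4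
        refine ⟨l, a, q1, ?_, q3, ?_⟩
        · rwa [U1 _ _ hl]
        · rwa [U1 _ _ hl]
    · intro a k g1 g2 g3 g4 g5 g6
      rw [U1 _ _ g6] at g3 g4
      rw [U2]
      exact ⟨g2, c4 a k g6 g1 g4 g2 g3⟩
    · intro H
      have := (H k1 c1 c2).2 (fun a ha => by rw [U1 _ _ c1]; exact ((U2 a).1 ha).2)
      rw [U1 _ _ c1] at this
      exact c3 this
  · intro T hT
    simp only [mem_coe, mem_filter, mem_L0 h hz hr] at hT
    obtain ⟨⟨⟨h1, h2, h3, h4, h5⟩, h6⟩, h7⟩ := hT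
    have hS : ∀ a k, (a,k) ∈ T → (a,k) ∈ S := fun a k hk => (mem_erase.1 (h1 hk)).2
    have hc : (i,j) ∉ T := fun hh => by simpa using h1 hh
    obtain ⟨k, hk, g1, g2, g3⟩ := fk T h3 h7
    ext ⟨a, l⟩
    simp only [mem_union, mem_filter]
    by_cases hl : l = j
    · subst hl
      simp only [ne_eq, not_true_eq_false, and_false, false_or, mem_erase, true_and]
      constructor
      · rintro ⟨q1, m, q2, q3, q4, q5⟩
        refine h6 a m q3 q1.2 q5.1 ?_ (by grind) q2
        exact fun hh => q4 ⟨hh, q2⟩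
      · intro q1
        exact ⟨⟨by rintro hh; rw [hh] at q1; exact hc q1, hS _ _ q1⟩, k, hk, g1, fun hh => g2 hh.1,
          g3 a q1, hk⟩
    · simp [hl]
  · intro T hT
    simp only [mem_coe, mem_fam, XB] at hT
    obtain ⟨h1, ⟨h2, h3⟩, h4, h5⟩ := hT
    have hj : ∀ a, (a,j) ∉ T := (h4 j).2 (Or.inr rfl)
    ext ⟨a, k⟩
    have := hj a
    simp only [mem_union, mem_filter]
    grind

open Classical in
theorem rec_X {S : D} {i j : ℕ} (h : Cor S i j) (z r : ℕ → Prop) (hz : ¬ z j) :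
    (fam Xd S z r).card = (fam Xd (S.erase (i,j)) z r).card
      + (fam Xd (S.erase (i,j)) (fun l => z l ∨ l = j) r).card
      + if r i then (fam Xd (S.filter (·.1 ≠ i)) z (fun b => r b ∧ b ≠ i)).card else 0 := by
  have hsum := split12 (XB S i j) (S.erase (i,j)) j z r hz
  rw [← split12 _ _ _ _ _ hz, ← card_filter_add_card_filter_not (fun T => (i,j) ∈ T),
    card1 Xd h z r hz (fun T hT => Xd_insert_of)]
  set D12 := (S.erase (i,j)).powerset.filter (fun T => Xd (S.erase (i,j)) T ∧
      (∀ l, l ≠ j → (zc T l ↔ z l)) ∧ ∀ b, rr (S.erase (i,j)) T b ↔ r b) with hD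
  have hA : D12.filter (fun T => Xd S (insert (i,j) T)) = D12.filter (A1 S i j) := by
    apply filter_congr
    intro T hT
    simp only [hD, mem_filter, mem_powerset] at hT
    exact X1 h hT.1 hT.2.1
  have hB : D12.filter (fun T => ¬ A1 S i j T) = (S.erase (i,j)).powerset.filter
      (fun T => XB S i j (S.erase (i,j)) T ∧
      (∀ l, l ≠ j → (zc T l ↔ z l)) ∧ ∀ b, rr (S.erase (i,j)) T b ↔ r b) := by
    ext T
    simp only [hD, mem_filter]
    simp only [XB]
    tauto
  have hC := card_filter_add_card_filter_not (s := D12) (A1 S i j)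
  rw [hB] at hC
  rw [hA, ← hC, add_assoc]
  congr 1
  rw [hsum]
  change (L0 S i j z r).card = _
  split_ifs with hr
  · rw [← E3 h hz hr, ← E4 h hz hr, ← E2 h hz hr,
      ← card_filter_add_card_filter_not (s := L0 S i j z r) (A1 S i j),
      ← card_filter_add_card_filter_not (s := (L0 S i j z r).filter (A1 S i j)) (Full S i j)]
    ring
  · have e1 : L0 S i j z r = ∅ := by
      rw [L0, filter_eq_empty_iff]
      intro T hT hc
      rw [mem_fam] at hT
      exact hr ((hT.2.2.2 i).1 (rr_cor h hT.1 hc (by rwa [hT.2.2.1])))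
    have e2 : ∀ z', fam (XB S i j) (S.erase (i,j)) z' r = ∅ := by
      intro z'
      rw [eq_empty_iff_forall_notMem]
      intro T hT
      rw [mem_fam] at hT
      exact hr ((hT.2.2.2 i).1 (rr_of_not_A1 h hT.1 hT.2.1.2))
    simp [e1, e2]

theorem main_count : ∀ (n : ℕ) (S : D), S.card = n → LeC S → ∀ z r,
    (fam Xd S z r).card = (fam Led S z r).card := by
  intro n
  induction n using Nat.strong_induction_on with
  | _ n ih =>
    intro S hn hS z r
    rcases S.eq_empty_or_nonempty with rfl | hne
    · congr 1
      ext T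
      simp [mem_fam, Xd, Led]
    · obtain ⟨i, j, h⟩ := exists_cor hS hne
      have lt : ∀ S' : D, S' ⊆ S → (i,j) ∉ S' → S'.card < n := by
        intro S' h1 h2
        rw [← hn]
        exact card_lt_card ((Finset.ssubset_iff_of_subset h1).2 ⟨_, h.mem, h2⟩)
      by_cases hz : z j
      · rw [fam_col_X h z r hz, fam_col_L h z r hz]
        refine ih _ (lt _ (filter_subset _ _) (by simp)) _ rfl ?_ z r
        intro a b k l h1 h2
        have := hS a b k l h1 h2
        simp only [mem_filter]
        grind
      · rw [rec_X h z r hz, rec_L h z r hz]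
        have l1 : LeC (S.erase (i,j)) := by
          intro a b k l h1 h2
          have := hS a b k l h1 h2
          have := h.row b k
          simp only [mem_erase]
          grind
        have l2 : LeC (S.filter (·.1 ≠ i)) := by
          intro a b k l h1 h2
          have := hS a b k l h1 h2
          simp only [mem_filter]
          grind
        have q1 := lt (S.erase (i,j)) (erase_subset _ _) (by simp)
        have q2 := lt (S.filter (·.1 ≠ i)) (filter_subset _ _) (by simp)
        rw [ih _ q1 _ rfl l1, ih _ q1 _ rfl l1, ih _ q2 _ rfl l2]

end XLe

namespace XLe
open Finset

/-- the set of filled cells -/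
def toF (S : D) (T : ℕ × ℕ → Bool) : D := S.filter (fun c => T c = true)

theorem mem_toF {S : D} {T : ℕ × ℕ → Bool} (h : IsFilling S T) (c : ℕ × ℕ) :
    c ∈ toF S T ↔ T c = true := by
  have := h c
  simp only [toF, mem_filter]
  grind

theorem zc_iff {S : D} {T : ℕ × ℕ → Bool} (h : IsFilling S T) (j : ℕ) :
    zc (toF S T) j ↔ ZeroCol S T j := by
  simp only [zc, ZeroCol, mem_toF h]
  constructor
  · intro H i _; simpa using H i
  · intro H i hi
    by_cases hc : (i,j) ∈ S
    · simp [H i hc] at hi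
    · simp [h _ hc] at hi

theorem rr_iff {S : D} {T : ℕ × ℕ → Bool} (h : IsFilling S T) (i : ℕ) :
    rr S (toF S T) i ↔ RestrictedRow S T i := by
  simp only [rr, RestrictedRow, mem_toF h]
  constructor
  · rintro ⟨j, a, h1, h2, h3, h4⟩
    refine ⟨j, h1, by simpa using h2, a, h3, ?_, h4⟩
    by_contra hc
    simp [h _ hc] at h4
  · rintro ⟨j, h1, h2, a, h3, h4, h5⟩
    exact ⟨j, a, h1, by simp [h2], h3, h5⟩

theorem Xd_iff {S : D} {T : ℕ × ℕ → Bool} : IsXDiagram S T ↔ IsFilling S T ∧ Xd S (toF S T) := by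
  unfold IsXDiagram
  refine and_congr_right fun h => ?_
  simp only [Avoids, Xd, mem_toF h, Bool.not_eq_true]
  constructor
  · rintro ⟨H1, H2⟩ a b k l h1 h2 h3 h4 h5 h6 h7 h8
    have hab : a ≠ b := by rintro rfl; simp [h5] at h8
    have hkl : k ≠ l := by rintro rfl; simp [h5] at h7
    rcases lt_or_gt_of_ne hab with q1 | q1 <;> rcases lt_or_gt_of_ne hkl with q2 | q2
    · exact H1 ⟨a, b, k, l, q1, q2, h1, h2, h3, h4, h5, h7, h8, h6⟩
    · exact H2 ⟨a, b, l, k, q1, q2, h2, h1, h4, h3, h7, h5, h6, h8⟩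
    · exact H2 ⟨b, a, k, l, q1, q2, h3, h4, h1, h2, h8, h6, h5, h7⟩
    · exact H1 ⟨b, a, l, k, q1, q2, h4, h3, h2, h1, h6, h8, h7, h5⟩
  · intro H
    constructor
    · rintro ⟨a, b, k, l, q1, q2, h1, h2, h3, h4, h5, h6, h7, h8⟩
      exact H a b k l h1 h2 h3 h4 h5 h8 h6 h7
    · rintro ⟨a, b, k, l, q1, q2, h1, h2, h3, h4, h5, h6, h7, h8⟩
      exact H a b l k h2 h1 h4 h3 h6 h7 h5 h8

theorem Led_iff {S : D} (hS : LeC S) {T : ℕ × ℕ → Bool} :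
    IsLeDiagram S T ↔ IsFilling S T ∧ Led S (toF S T) := by
  unfold IsLeDiagram
  refine and_congr_right fun h => ?_
  simp only [Avoids, Led, mem_toF h]
  constructor
  · rintro ⟨H1, H2⟩ a b k l q1 q2 h2 h3 h4 h5 h6
    by_contra h7
    have h1 := hS a b k l q1 q2 h3 h4 h2
    rw [Bool.not_eq_true] at h7
    by_cases h8 : T (a,k) = true
    · exact H1 ⟨a, b, k, l, q1, q2, h1, h2, h3, h4, h8, h5, h6, h7⟩
    · exact H2 ⟨a, b, k, l, q1, q2, h1, h2, h3, h4, by simpa using h8, h5, h6, h7⟩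
  · intro H
    constructor
    · rintro ⟨a, b, k, l, q1, q2, h1, h2, h3, h4, h5, h6, h7, h8⟩
      have := H a b k l q1 q2 h2 h3 h4 h6 h7
      simp [h8] at this
    · rintro ⟨a, b, k, l, q1, q2, h1, h2, h3, h4, h5, h6, h7, h8⟩
      have := H a b k l q1 q2 h2 h3 h4 h6 h7
      simp [h8] at this

/-- the pair of statistics -/
def stat (S : D) (T : ℕ × ℕ → Bool) : (ℕ → Prop) × (ℕ → Prop) :=
  (fun j => ZeroCol S T j, fun i => RestrictedRow S T i)

/-- a fiber of the statistics is a family counted above. -/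
noncomputable def fiberEquiv {S : D} (Q : (ℕ × ℕ → Bool) → Prop) (P : D → D → Prop)
    (hQ : ∀ T, Q T ↔ IsFilling S T ∧ P S (toF S T)) (c : (ℕ → Prop) × (ℕ → Prop)) :
    {T : {T // Q T} // stat S T.1 = c} ≃ fam P S c.1 c.2 where
  toFun T := ⟨toF S T.1.1, by
    obtain ⟨⟨T, hT⟩, rfl⟩ := T
    have h := (hQ T).1 hT
    exact mem_fam.2 ⟨filter_subset _ _, h.2, zc_iff h.1, rr_iff h.1⟩⟩
  invFun F := ⟨⟨fun c => decide (c ∈ F.1), by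
      have h := mem_fam.1 F.2
      have e : toF S (fun c => decide (c ∈ F.1)) = F.1 := by
        ext c
        have := @h.1 c
        simp only [toF, mem_filter, decide_eq_true_eq]
        tauto
      refine (hQ _).2 ⟨?_, by rw [e]; exact h.2.1⟩
      intro c hc
      have := @h.1 c
      simp only [decide_eq_false_iff_not]
      tauto⟩, by
      have h := mem_fam.1 F.2
      have e : toF S (fun c => decide (c ∈ F.1)) = F.1 := by
        ext c
        have := @h.1 c
        simp only [toF, mem_filter, decide_eq_true_eq]
        tauto
      have hf : IsFilling S (fun c => decide (c ∈ F.1)) := by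
        intro c hc
        have := @h.1 c
        simp only [decide_eq_false_iff_not]
        tauto
      refine Prod.ext ?_ ?_
      · funext j
        exact propext ((zc_iff hf j).symm.trans (by rw [e]; exact h.2.2.1 j))
      · funext j
        exact propext ((rr_iff hf j).symm.trans (by rw [e]; exact h.2.2.2 j))⟩
  left_inv T := by
    obtain ⟨⟨T, hT⟩, rfl⟩ := T
    have h := (hQ T).1 hT
    apply Subtype.ext
    apply Subtype.ext
    funext c
    simp [mem_toF h.1]
  right_inv F := by
    have h := mem_fam.1 F.2
    apply Subtype.ext
    ext c
    have := @h.1 c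
    simp only [toF, mem_filter, decide_eq_true_eq]
    tauto

end XLe

/-- for every Le-complete polyomino there is a bijection between
X-diagrams and Le-diagrams preserving the set of zero-columns and the set of
restricted rows. -/
theorem stmt18 (S : Finset (ℕ × ℕ)) (hS : IsPolyomino S) (hLe : LeComplete S) :
    ∃ Φ₂ : {T : ℕ × ℕ → Bool // IsXDiagram S T} ≃
           {T : ℕ × ℕ → Bool // IsLeDiagram S T},
      ∀ T : {T : ℕ × ℕ → Bool // IsXDiagram S T},
        (∀ j, ZeroCol S T.1 j ↔ ZeroCol S (Φ₂ T).1 j) ∧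
        (∀ i, RestrictedRow S T.1 i ↔ RestrictedRow S (Φ₂ T).1 i) := by
  classical
  have cnt := XLe.main_count _ S rfl hLe
  let e : ∀ c, {T : {T : ℕ × ℕ → Bool // IsXDiagram S T} // XLe.stat S T.1 = c} ≃
      {T : {T : ℕ × ℕ → Bool // IsLeDiagram S T} // XLe.stat S T.1 = c} := fun c =>
    (XLe.fiberEquiv _ XLe.Xd (fun _ => XLe.Xd_iff) c).trans
      ((Finset.equivOfCardEq (cnt c.1 c.2)).trans
        (XLe.fiberEquiv _ XLe.Led (fun _ => XLe.Led_iff hLe) c).symm)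
  refine ⟨(Equiv.sigmaFiberEquiv (fun T : {T // IsXDiagram S T} => XLe.stat S T.1)).symm.trans
    ((Equiv.sigmaCongrRight e).trans
      (Equiv.sigmaFiberEquiv (fun T : {T // IsLeDiagram S T} => XLe.stat S T.1))), ?_⟩
  intro T
  have hst := (e (XLe.stat S T.1) ⟨T, rfl⟩).2
  have h1 := congrArg Prod.fst hst
  have h2 := congrArg Prod.snd hst
  refine ⟨fun j => ?_, fun i => ?_⟩
  · exact (Iff.of_eq (congrFun h1 j)).symm
  · exact (Iff.of_eq (congrFun h2 i)).symm
end

section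
/- For an integer m ≥ 1 and positive integers c_1, …, c_m, let S(c) denote the stalactite polyomino {(i,j) : 1 ≤ j ≤ m, 1 ≤ i ≤ c_j} (each column j is a top-justified segment of length c_j hanging from the common top row, rows numbered from the top). If (c'_1, …, c'_m) is a permutation of (c_1, …, c_m), then the number of Le-diagrams of shape S(c) equals the number of Le-diagrams of shape S(c'). -/
/-- The stalactite polyomino with column lengths `c`: column `j` is the
top-justified segment of cells `(i, j)` with `i < c j`. -/
def stalCells {m : ℕ} (c : Fin m → ℕ) : Finset (ℕ × ℕ) :=
  Finset.univ.biUnion fun j : Fin m =>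
    (Finset.range (c j)).image fun i => (i, (j : ℕ))

/-- Extended column heights. -/
def extH {m : ℕ} (c : Fin m → ℕ) (j : ℕ) : ℕ := if h : j < m then c ⟨j, h⟩ else 0

/-- Simplified Le condition for column heights `d`. -/
def LeP (d : ℕ → ℕ) (T : ℕ × ℕ → Bool) : Prop :=
  (∀ i j, d j ≤ i → T (i, j) = false) ∧
  (∀ i i' j j', i < i' → j < j' → i' < d j' → T (i, j') = true → T (i', j) = true →
    T (i', j') = true)

lemma mem_stal {m : ℕ} (c : Fin m → ℕ) (i j : ℕ) : (i, j) ∈ stalCells c ↔ i < extH c j := by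
  unfold stalCells extH
  simp only [Finset.mem_biUnion, Finset.mem_univ, true_and, Finset.mem_image, Finset.mem_range,
    Prod.mk.injEq]
  constructor
  · rintro ⟨a, b, hb, rfl, rfl⟩
    simpa using hb
  · intro h
    split_ifs at h with hj
    · exact ⟨⟨j, hj⟩, i, h, rfl, rfl⟩
    · omega

lemma le_iff {m : ℕ} (c : Fin m → ℕ) (T : ℕ × ℕ → Bool) :
    IsLeDiagram (stalCells c) T ↔ LeP (extH c) T := by
  unfold IsLeDiagram LeP IsFilling Avoids
  simp only [mem_stal, Prod.forall]
  constructor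
  · rintro ⟨h1, h2, h3⟩
    refine ⟨fun i j h => h1 i j (by omega), ?_⟩
    intro i i' j j' hi hj hd ht ht'
    by_contra hn
    have hd' : i' < extH c j := by
      by_contra h
      rw [h1 i' j h] at ht'
      simp at ht'
    have hn' : T (i', j') = false := by simpa using hn
    cases hT : T (i, j)
    · exact h3 ⟨i, i', j, j', hi, hj, by omega, by omega, by omega, by omega, hT, ht, ht', hn'⟩
    · exact h2 ⟨i, i', j, j', hi, hj, by omega, by omega, by omega, by omega, hT, ht, ht', hn'⟩
  · rintro ⟨h1, h2⟩
    refine ⟨fun i j h => h1 i j (by omega), ?_, ?_⟩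
    · rintro ⟨i, i', j, j', hi, hj, _, _, _, hd, _, ht, ht', hn⟩
      rw [h2 i i' j j' hi hj hd ht ht'] at hn
      simp at hn
    · rintro ⟨i, i', j, j', hi, hj, _, _, _, hd, _, ht, ht', hn⟩
      rw [h2 i i' j j' hi hj hd ht ht'] at hn
      simp at hn

/-- The set of Le-diagrams. -/
def LeS {m : ℕ} (c : Fin m → ℕ) : Set (ℕ × ℕ → Bool) := {T | LeP (extH c) T}

lemma leS_finite {m : ℕ} (c : Fin m → ℕ) : (LeS c).Finite := by
  classical
  refine (((stalCells c).powerset.finite_toSet).image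
    (fun s : Finset (ℕ × ℕ) => fun x => decide (x ∈ s))).subset ?_
  intro T hT
  refine ⟨(stalCells c).filter (fun x => T x = true), Finset.mem_coe.2 (Finset.mem_powerset.2 (Finset.filter_subset _ _)), ?_⟩
  funext ⟨i, j⟩
  have := hT.1 i j
  simp only [Finset.mem_filter, mem_stal]
  by_cases h : i < extH c j
  · simp [h]
  · rw [this (by omega)]; simp

lemma ext_update {m : ℕ} (c : Fin m → ℕ) (j : Fin m) (v k : ℕ) :
    extH (Function.update c j v) k = if k = j then v else extH c k := by
  unfold extH
  by_cases h : k < m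
  · simp [h, Function.update_apply, Fin.ext_iff]
  · have : k ≠ j := by have := j.2; omega
    simp [h, this]

lemma ext_min {m : ℕ} (c : Fin m → ℕ) (M k : ℕ) :
    extH (fun i => min (c i) M) k = min (extH c k) M := by
  unfold extH
  split_ifs <;> simp

lemma leP_recR (d d' : ℕ → ℕ) (M : ℕ) (hd : ∀ k, d k ≤ M + 1) (h' : ∀ k, d' k = min (d k) M)
    (T : ℕ × ℕ → Bool) : LeP d' T ↔ LeP d T ∧ ∀ k, T (M, k) = false := by
  constructor
  · rintro ⟨h1, h2⟩
    refine ⟨⟨fun i j h => h1 i j (by clear h1 h2; grind), ?_⟩, fun k => h1 M k (by clear h1 h2; grind)⟩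
    intro i i' j j' hi hj hd' ht ht'
    by_cases hM : i' = M
    · have := h1 i' j (by rw [h', hM]; exact min_le_right _ _)
      rw [this] at ht'; simp at ht'
    · exact h2 i i' j j' hi hj (by clear h1 h2; grind) ht ht'
  · rintro ⟨⟨h1, h2⟩, h3⟩
    refine ⟨fun i j h => ?_, fun i i' j j' hi hj hd' ht ht' =>
      h2 i i' j j' hi hj (by clear h1 h2; grind) ht ht'⟩
    by_cases hM : i = M
    · rw [hM]; exact h3 j
    · exact h1 i j (by clear h1 h2; grind)

lemma leP_recC (d d' : ℕ → ℕ) (j₀ : ℕ) (h' : ∀ k, d' k = if k = j₀ then 0 else d k)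
    (T : ℕ × ℕ → Bool) : LeP d' T ↔ LeP d T ∧ ∀ i, T (i, j₀) = false := by
  constructor
  · rintro ⟨h1, h2⟩
    refine ⟨⟨fun i j h => h1 i j (by clear h1 h2; grind), ?_⟩, fun k => h1 k j₀ (by clear h1 h2; grind)⟩
    intro i i' j j' hi hj hd' ht ht'
    by_cases hM : j' = j₀
    · have := h1 i j' (by rw [h', if_pos hM]; omega)
      rw [this] at ht; simp at ht
    · exact h2 i i' j j' hi hj (by clear h1 h2; grind) ht ht'
  · rintro ⟨⟨h1, h2⟩, h3⟩
    refine ⟨fun i j h => ?_, fun i i' j j' hi hj hd' ht ht' =>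
      h2 i i' j j' hi hj (by clear h1 h2; grind) ht ht'⟩
    by_cases hM : j = j₀
    · rw [hM]; exact h3 i
    · exact h1 i j (by clear h1 h2; grind)

lemma leP_rec1 (d d' : ℕ → ℕ) (M j₀ : ℕ) (hd : ∀ k, d k ≤ M + 1) (hj₀ : d j₀ = M + 1)
    (hlast : ∀ k, j₀ < k → d k ≤ M) (h' : ∀ k, d' k = if k = j₀ then M else d k)
    (T : ℕ × ℕ → Bool) (b : Bool) (hT : LeP d' T) (hb : b = true) :
    LeP d (Function.update T (M, j₀) b) := by
  obtain ⟨h1, h2⟩ := hT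
  refine ⟨fun i j h => ?_, fun i i' j j' hi hj hd' ht ht' => ?_⟩
  · have : (i, j) ≠ (M, j₀) := by clear h1 h2; grind
    rw [Function.update_of_ne this]
    exact h1 i j (by clear h1 h2; grind)
  · by_cases hx : (i', j') = (M, j₀)
    · rw [hx]; simpa using hb
    · have e1 : (i, j') ≠ (M, j₀) := by
        have := hd j'
        clear h1 h2; grind
      have e2 : (i', j) ≠ (M, j₀) := by
        have := hlast j'
        clear h1 h2; grind
      rw [Function.update_of_ne hx]
      rw [Function.update_of_ne e1] at ht
      rw [Function.update_of_ne e2] at ht'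
      exact h2 i i' j j' hi hj (by clear h1 h2; grind) ht ht'

lemma leP_rec2 (d d' : ℕ → ℕ) (M j₀ : ℕ) (hd : ∀ k, d k ≤ M + 1) (hj₀ : d j₀ = M + 1)
    (hlast : ∀ k, j₀ < k → d k ≤ M) (h' : ∀ k, d' k = if k = j₀ then M else d k)
    (T : ℕ × ℕ → Bool) (hT : LeP d T) :
    LeP d' (Function.update T (M, j₀) false) := by
  obtain ⟨h1, h2⟩ := hT
  refine ⟨fun i j h => ?_, fun i i' j j' hi hj hd' ht ht' => ?_⟩
  · by_cases hx : (i, j) = (M, j₀)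
    · rw [hx]; simp
    · rw [Function.update_of_ne hx]
      exact h1 i j (by clear h1 h2; grind)
  · have hx : (i', j') ≠ (M, j₀) := by clear h1 h2; grind
    have e1 : (i, j') ≠ (M, j₀) := by
      have := hd j'
      clear h1 h2; grind
    have e2 : (i', j) ≠ (M, j₀) := by
      have := hlast j'
      clear h1 h2; grind
    rw [Function.update_of_ne hx]
    rw [Function.update_of_ne e1] at ht
    rw [Function.update_of_ne e2] at ht'
    exact h2 i i' j j' hi hj (by clear h1 h2; grind) ht ht'

lemma ext_coe {m : ℕ} (c : Fin m → ℕ) (j : Fin m) : extH c j = c j := by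
  simp [extH]

lemma recurrence {m : ℕ} (c : Fin m → ℕ) (M : ℕ) (j : Fin m) (hc : ∀ k, c k ≤ M + 1)
    (hj : c j = M + 1) (hlast : ∀ k, j < k → c k ≤ M) :
    (LeS c).ncard + (LeS (Function.update (fun i => min (c i) M) j 0)).ncard =
    (LeS (Function.update c j M)).ncard + ((LeS (fun i => min (c i) M)).ncard +
      (LeS (Function.update c j 0)).ncard) := by
  have hd : ∀ k, extH c k ≤ M + 1 := by
    intro k; unfold extH; split_ifs
    · exact hc _
    · omega
  have hj₀ : extH c j = M + 1 := by rw [ext_coe, hj]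
  have hl : ∀ k, (j : ℕ) < k → extH c k ≤ M := by
    intro k hk; unfold extH; split_ifs with h
    · exact hlast ⟨k, h⟩ hk
    · omega
  have hR := leP_recR (extH c) _ M hd (ext_min c M)
  have hC := leP_recC (extH c) _ j (ext_update c j 0)
  have hRC := leP_recC (extH (fun i => min (c i) M)) _ j (ext_update _ j 0)
  have hfR := leS_finite (fun i => min (c i) M)
  have hfC := leS_finite (Function.update c j 0)
  have hI : LeS (Function.update (fun i => min (c i) M) j 0) =
      LeS (fun i => min (c i) M) ∩ LeS (Function.update c j 0) := by
    ext T
    have h1 := hR T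
    have h2 := hC T
    have h3 := hRC T
    simp only [LeS, Set.mem_inter_iff, Set.mem_setOf_eq]
    tauto
  have hA : LeS c = (LeS c ∩ {T | T (M, (j : ℕ)) = true}) ∪
      (LeS (fun i => min (c i) M) ∪ LeS (Function.update c j 0)) := by
    ext T
    have h1 := hR T
    have h2 := hC T
    simp only [LeS, Set.mem_inter_iff, Set.mem_union, Set.mem_setOf_eq]
    constructor
    · intro h
      by_cases hx : T (M, (j : ℕ)) = true
      · exact Or.inl ⟨h, hx⟩
      · right
        by_cases hrow : ∀ k, T (M, k) = false
        · exact Or.inl (h1.2 ⟨h, hrow⟩)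
        · right
          refine h2.2 ⟨h, ?_⟩
          push Not at hrow
          obtain ⟨k, hk⟩ := hrow
          have hk : T (M, k) = true := by simpa using hk
          have hkj : k < j := by
            rcases lt_trichotomy k j with h' | h' | h'
            · exact h'
            · subst h'; exact absurd hk hx
            · have := h.1 M k (hl k h')
              simp [this] at hk
          intro i
          by_contra hi
          have hi : T (i, (j : ℕ)) = true := by simpa using hi
          rcases lt_trichotomy i M with h' | h' | h'
          · exact hx (h.2 i M k j h' hkj (by omega) hi hk)
          · subst h'; exact hx hi
          · have := h.1 i j (by omega)
            simp [this] at hi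
    · tauto
  have hdisj : Disjoint (LeS c ∩ {T | T (M, (j : ℕ)) = true})
      (LeS (fun i => min (c i) M) ∪ LeS (Function.update c j 0)) := by
    rw [Set.disjoint_left]
    rintro T ⟨_, hT⟩ h
    have h1 := hR T
    have h2 := hC T
    simp only [Set.mem_setOf_eq] at hT
    rcases h with h | h
    · have := (h1.1 h).2 j
      simp [this] at hT
    · have := (h2.1 h).2 M
      simp [this] at hT
  have hcard : (LeS c ∩ {T | T (M, (j : ℕ)) = true}).ncard =
      (LeS (Function.update c j M)).ncard := by
    refine Set.ncard_congr (fun T _ => Function.update T (M, (j : ℕ)) false) ?_ ?_ ?_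
    · rintro T ⟨hT, _⟩
      exact leP_rec2 _ _ M j hd hj₀ hl (ext_update c j M) T hT
    · rintro T T' ⟨_, hT⟩ ⟨_, hT'⟩ he
      simp only [Set.mem_setOf_eq] at hT hT'
      funext x
      have := congrFun he x
      by_cases hx : x = (M, (j : ℕ))
      · rw [hx, hT, hT']
      · simpa [Function.update_of_ne hx] using this
    · intro T hT
      refine ⟨Function.update T (M, (j : ℕ)) true, ⟨?_, by simp⟩, ?_⟩
      · exact leP_rec1 _ _ M j hd hj₀ hl (ext_update c j M) T true hT rfl
      · have : T (M, (j : ℕ)) = false := hT.1 M j (by rw [ext_update]; simp)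
        simp only [Function.update_idem]
        rw [← this, Function.update_eq_self]
  have hfA : (LeS c ∩ {T | T (M, (j : ℕ)) = true}).Finite :=
    (leS_finite c).subset Set.inter_subset_left
  rw [hI, ← Set.ncard_union_add_ncard_inter _ _ hfR hfC, ← hcard, ← add_assoc,
    ← Set.ncard_union_eq hdisj hfA (hfR.union hfC), ← hA]

lemma exists_last {m : ℕ} (c : Fin m → ℕ) (M : ℕ) (h : ∃ k, c k = M + 1)
    (hc : ∀ k, c k ≤ M + 1) : ∃ j, c j = M + 1 ∧ ∀ k, j < k → c k ≤ M := by
  obtain ⟨k, hk⟩ := h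
  obtain ⟨j, hj, hm⟩ := (Finset.univ.filter (fun i => c i = M + 1)).exists_max_image id
    ⟨k, by simp [hk]⟩
  refine ⟨j, by simpa using hj, fun l hl => ?_⟩
  by_contra hcl
  have := hm l (by have := hc l; simp; omega)
  exact absurd hl (not_lt.2 this)

lemma update_perm {m : ℕ} (c : Fin m → ℕ) (σ : Equiv.Perm (Fin m)) (j j' : Fin m) (v : ℕ)
    (h : c j = c (σ j')) :
    Function.update (c ∘ σ) j' v = Function.update c j v ∘ (σ.trans (Equiv.swap j (σ j'))) := by
  funext k
  simp only [Function.update_apply, Function.comp, Equiv.trans_apply, Equiv.swap_apply_def]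
  have := σ.injective.eq_iff (a := k) (b := j')
  grind

lemma main_aux {m : ℕ} (n : ℕ) : ∀ (c : Fin m → ℕ) (σ : Equiv.Perm (Fin m)), ∑ i, c i = n →
    (LeS (c ∘ σ)).ncard = (LeS c).ncard := by
  induction n using Nat.strong_induction_on with
  | _ n ih =>
  intro c σ hn
  by_cases h0 : ∀ k, c k = 0
  · have : c ∘ σ = c := by funext k; simp [h0]
    rw [this]
  push Not at h0
  obtain ⟨k₀, hk₀⟩ := h0
  obtain ⟨k₁, -, hk₁⟩ := Finset.univ.exists_max_image c ⟨k₀, Finset.mem_univ _⟩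
  obtain ⟨M, hM⟩ : ∃ M, c k₁ = M + 1 :=
    ⟨c k₁ - 1, by have := hk₁ k₀ (Finset.mem_univ _); omega⟩
  have hc : ∀ k, c k ≤ M + 1 := fun k => hM ▸ hk₁ k (Finset.mem_univ _)
  obtain ⟨j, hj, hl⟩ := exists_last c M ⟨k₁, hM⟩ hc
  obtain ⟨j', hj', hl'⟩ := exists_last (c ∘ σ) M ⟨σ.symm k₁, by simp [hM]⟩ (fun k => hc _)
  have r := recurrence c M j hc hj hl
  have r' := recurrence (c ∘ σ) M j' (fun k => hc _) hj' hl'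
  have hlt : ∀ e : Fin m → ℕ, (∀ k, e k ≤ c k) → e j < c j → ∑ i, e i < n := by
    intro e he hej
    rw [← hn]
    exact Finset.sum_lt_sum (fun i _ => he i) ⟨j, Finset.mem_univ _, hej⟩
  have hjj : c j = c (σ j') := by rw [hj]; exact hj'.symm
  have hmin : (fun i => min ((c ∘ σ) i) M) = (fun i => min (c i) M) ∘ σ := rfl
  rw [hmin, update_perm c σ j j' M hjj, update_perm c σ j j' 0 hjj,
    update_perm (fun i => min (c i) M) σ j j' 0 (by simp [hjj])] at r'
  have u : ∀ v, v < M + 1 → ∀ k, Function.update c j v k ≤ c k := by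
    intro v hv k
    rw [Function.update_apply]; split_ifs with h
    · subst h; omega
    · exact le_rfl
  rw [ih _ (hlt _ (u M (by omega)) (by simp [hj])) _ _ rfl,
    ih _ (hlt _ (u 0 (by omega)) (by simp [hj])) _ _ rfl,
    ih _ (hlt (fun i => min (c i) M) (fun k => min_le_left _ _) (by simp [hj])) _ _ rfl,
    ih _ (hlt (Function.update (fun i => min (c i) M) j 0) (fun k => by
      rw [Function.update_apply]; split_ifs <;> simp) (by simp [hj])) _ _ rfl] at r'
  omega

/-- the number of Le-diagrams of a stalactite polyomino only
depends on the multiset of its column lengths. -/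
theorem stmt19 (m : ℕ) (hm : 1 ≤ m) (c c' : Fin m → ℕ) (hc : ∀ j, 0 < c j)
    (hperm : ∃ σ : Equiv.Perm (Fin m), c' = c ∘ σ) :
    {T : ℕ × ℕ → Bool | IsLeDiagram (stalCells c) T}.ncard
  = {T : ℕ × ℕ → Bool | IsLeDiagram (stalCells c') T}.ncard := by
  obtain ⟨σ, rfl⟩ := hperm
  simp only [le_iff]
  exact (main_aux _ c σ rfl).symm
end
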